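/- For sufficiently large odd n, let G = {G_1,...,G_n} be a collection of graphs on a common vertex set V of size n with δ(G_i) ≥ (n-1)/2 for all i. If G contains no transversal Hamilton cycle, then exactly one of the following holds: (a) there is a set A ⊆ V with |A| = (n+1)/2 such that A is independent in every G_i and every G_i contains all edges between A and V \ A; or (b) there is a vertex u with d_{G_i}(u) = n-1 for all i and an equitable partition A ∪ B of V \ {u} such that G_i[V \ {u}] equals the disjoint union of complete graphs on A and on B (each of size (n-1)/2) for every i. -/

import Mathlib

open SimpleGraph

/-- A transversal Hamilton cycle in a collection of `m` graphs on `V`. -/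
def HasTransHamCycle {V : Type*} [DecidableEq V] {m : ℕ} (Gs : Fin m → SimpleGraph V) : Prop :=
  ∃ (v : V) (p : (⊤ : SimpleGraph V).Walk v v),
    p.IsHamiltonianCycle ∧
      ∃ φ : Fin p.edges.length ≃ Fin m, ∀ i, p.edges.get i ∈ (Gs (φ i)).edgeSet

/-- Degree of `v` in `G`, without decidability assumptions. -/
noncomputable def deg {V : Type*} (G : SimpleGraph V) (v : V) : ℕ :=
  (G.neighborSet v).ncard

namespace TH

/-- head vertex of a coloured list, with default -/
def hd {V Γ : Type} : List (V × Γ) → V → V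
  | [], w => w
  | (v, _) :: _, _ => v

/-- slots of a coloured list with final vertex `w` -/
def os {V Γ : Type} : List (V × Γ) → V → List (V × Γ × V)
  | [], _ => []
  | (v, c) :: r, w => (v, c, hd r w) :: os r w

/-- cyclic slots -/
def cyc {V Γ : Type} : List (V × Γ) → List (V × Γ × V)
  | [] => []
  | (v, c) :: r => os ((v, c) :: r) v

@[simp] lemma hd_nil {V Γ : Type} (w : V) : hd ([] : List (V × Γ)) w = w := rfl
@[simp] lemma hd_cons {V Γ : Type} (a : V × Γ) (r : List (V × Γ)) (w : V) :
    hd (a :: r) w = a.1 := rfl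
@[simp] lemma os_nil {V Γ : Type} (w : V) : os ([] : List (V × Γ)) w = [] := rfl
@[simp] lemma os_cons {V Γ : Type} (a : V × Γ) (r : List (V × Γ)) (w : V) :
    os (a :: r) w = (a.1, a.2, hd r w) :: os r w := rfl
lemma cyc_cons {V Γ : Type} (a : V × Γ) (r : List (V × Γ)) :
    cyc (a :: r) = os (a :: r) a.1 := rfl

lemma hd_append {V Γ : Type} (x y : List (V × Γ)) (w : V) :
    hd (x ++ y) w = hd x (hd y w) := by
  cases x <;> rfl

lemma os_append {V Γ : Type} (x y : List (V × Γ)) (w : V) :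
    os (x ++ y) w = os x (hd y w) ++ os y w := by
  induction x with
  | nil => rfl
  | cons a r ih => simp [ih, hd_append]

lemma hd_of_ne {V Γ : Type} {x : List (V × Γ)} (h : x ≠ []) (w w' : V) : hd x w = hd x w' := by
  cases x with
  | nil => exact absurd rfl h
  | cons a r => rfl

lemma cyc_append {V Γ : Type} (x y : List (V × Γ)) (w w' : V) (hx : x ≠ []) (hy : y ≠ []) :
    cyc (x ++ y) = os x (hd y w) ++ os y (hd x w') := by
  cases x with
  | nil => exact absurd rfl hx
  | cons a r =>
    rw [List.cons_append, cyc_cons, ← List.cons_append, os_append]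
    rw [hd_of_ne hy a.1 w]; rfl

lemma cyc_rotate {V Γ : Type} (x y : List (V × Γ)) : (cyc (x ++ y)).Perm (cyc (y ++ x)) := by
  by_cases hx : x = []
  · subst hx; simp
  by_cases hy : y = []
  · subst hy; simp
  obtain ⟨⟨v, _⟩, _, rfl⟩ := List.exists_cons_of_ne_nil hx
  rw [cyc_append _ _ v v hx hy, cyc_append _ _ v v hy hx]
  exact List.perm_append_comm

lemma os_length {V Γ : Type} (x : List (V × Γ)) (w : V) : (os x w).length = x.length := by
  induction x with
  | nil => rfl
  | cons a r ih => simp [ih]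

lemma os_map_colour {V Γ : Type} (x : List (V × Γ)) (w : V) :
    (os x w).map (fun s => s.2.1) = x.map Prod.snd := by
  induction x with
  | nil => rfl
  | cons a r ih => simp [ih]

lemma os_map_tail {V Γ : Type} (x : List (V × Γ)) (w : V) :
    (os x w).map (fun s => s.1) = x.map Prod.fst := by
  induction x with
  | nil => rfl
  | cons a r ih => simp [ih]

/-- slot is an edge of its colour -/
def good {V Γ : Type} (G : Γ → SimpleGraph V) (s : V × Γ × V) : Prop := (G s.2.1).Adj s.1 s.2.2

/-- list arrangement uses all vertices and colours -/
structure Full {V Γ : Type} (z : List (V × Γ)) : Prop where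
  nd : (z.map Prod.fst).Nodup
  all : ∀ v, v ∈ z.map Prod.fst
  cnd : (z.map Prod.snd).Nodup

/-- list version of transversal Hamilton cycle -/
def THC {V Γ : Type} (G : Γ → SimpleGraph V) : Prop :=
  ∃ z : List (V × Γ), Full z ∧ ∀ s ∈ cyc z, good G s

lemma exists_walk {V Γ : Type} (z : List (V × Γ)) (w : V)
    (h : ∀ s ∈ os z w, s.1 ≠ s.2.2) :
    ∃ p : (⊤ : SimpleGraph V).Walk (hd z w) w, p.support = z.map Prod.fst ++ [w] ∧
      p.edges = (os z w).map (fun s => s(s.1, s.2.2)) := by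
  induction z with
  | nil => exact ⟨Walk.nil, by simp, by simp⟩
  | cons a r ih =>
    obtain ⟨p, hp1, hp2⟩ := ih (fun s hs => h s (by simp [hs]))
    have := h (a.1, a.2, hd r w) (by simp)
    have hadj : (⊤ : SimpleGraph V).Adj a.1 (hd r w) := by simpa using this
    refine ⟨Walk.cons hadj p, ?_, ?_⟩
    · simp [hp1]
    · simp [hp2]

lemma THC.toHam {V : Type} [DecidableEq V] [Fintype V] {n : ℕ} (G : Fin n → SimpleGraph V)
    (hn : Fintype.card V = n) (h3 : 3 ≤ n) (h : THC G) : HasTransHamCycle G := by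
  obtain ⟨z, hz, hg⟩ := h
  have hlen : z.length = n := by
    have h1 : (z.map Prod.fst).toFinset = Finset.univ := by
      ext v; simpa using hz.all v
    have h2 := List.toFinset_card_of_nodup hz.nd
    rw [h1, Finset.card_univ, hn] at h2
    simpa using h2.symm
  match z, hz, hg, hlen with
  | [], _, _, hlen => simp at hlen; omega
  | [_], _, _, hlen => simp at hlen; omega
  | [_, _], _, _, hlen => simp at hlen; omega
  | a :: b :: c :: r, hz, hg, hlen =>
    set z := a :: b :: c :: r with hzdef
    have hne : ∀ s ∈ os z a.1, s.1 ≠ s.2.2 := by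
      intro s hs
      exact (hg s hs).ne
    obtain ⟨q, hq1, hq2⟩ : ∃ q : (⊤ : SimpleGraph V).Walk b.1 a.1,
        q.support = (b :: c :: r).map Prod.fst ++ [a.1] ∧
        q.edges = (os (b :: c :: r) a.1).map (fun s => s(s.1, s.2.2)) :=
      exists_walk (b :: c :: r) a.1 (fun s hs => hne s (by
      rw [hzdef, os_cons]; exact List.mem_cons_of_mem _ hs))
    have hab : (⊤ : SimpleGraph V).Adj a.1 b.1 := by
      have := hne (a.1, a.2, b.1) (by simp [hzdef])
      simpa using this
    have hnd := hz.nd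
    have hqp : q.IsPath := by
      rw [Walk.isPath_def, hq1]
      simp only [hzdef, List.map_cons, List.nodup_cons] at hnd
      have : (List.map Prod.fst (b :: c :: r) ++ [a.1]).Perm (a.1 :: List.map Prod.fst (b :: c :: r)) := by
        exact List.perm_append_singleton _ _
      rw [this.nodup_iff]
      simp only [List.map_cons, List.nodup_cons]
      exact hnd
    let p : (⊤ : SimpleGraph V).Walk a.1 a.1 := Walk.cons hab q
    have hpe : p.edges = (os z a.1).map (fun s => s(s.1, s.2.2)) := by
      show (Walk.cons hab q).edges = _
      rw [Walk.edges_cons, hq2]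
      simp [hzdef]
    have hnotin : s(a.1, b.1) ∉ q.edges := by
      rw [hq2]
      intro hmem
      simp only [os_cons, List.map_cons, List.mem_cons] at hmem
      simp only [hzdef, List.map_cons, List.nodup_cons, List.mem_cons, not_or] at hnd
      rcases hmem with hmem | hmem
      · simp only [hd_cons] at hmem
        rw [Sym2.eq_iff] at hmem
        rcases hmem with ⟨h1, _⟩ | ⟨h1, _⟩
        · exact hnd.1.1 h1
        · exact hnd.1.2.1 h1
      · have key : ∀ (x : List (V × Fin n)) (w : V) (s : Sym2 V) (v : V), v ∈ s →
            s ∈ (os x w).map (fun s => s(s.1, s.2.2)) → v ∈ x.map Prod.fst ∨ v = w := by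
          intro x w
          induction x with
          | nil => intro s v _ h; simp at h
          | cons d r ih =>
            intro s v hv hs
            simp only [os_cons, List.map_cons, List.mem_cons] at hs
            rcases hs with rfl | hs
            · simp only [Sym2.mem_iff] at hv
              rcases hv with rfl | rfl
              · left; simp
              · cases r with
                | nil => right; rfl
                | cons e r => left; simp
            · rcases ih s v hv hs with h | h
              · left; simp only [List.map_cons, List.mem_cons]; right; exact h
              · right; exact h
        have := key (c :: r) a.1 s(a.1, b.1) b.1 (by simp) (by simpa using hmem)
        rcases this with h | h
        · simp only [List.map_cons, List.mem_cons] at h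
          rcases h with h | h
          · exact hnd.2.1.1 h
          · exact hnd.2.1.2 h
        · exact hnd.1.1 h.symm
    have hcyc : p.IsCycle := by
      exact (Walk.cons_isCycle_iff _ _).2 ⟨hqp, hnotin⟩
    have hplen : p.edges.length = n := by
      rw [hpe]; simp [os_length, hlen]
    refine ⟨a.1, p, ?_, ?_⟩
    · rw [Walk.isHamiltonianCycle_iff_isCycle_and_support_count_tail_eq_one]
      refine ⟨hcyc, fun v => ?_⟩
      show (Walk.cons hab q).support.tail.count v = 1
      rw [Walk.support_cons, List.tail_cons]
      apply List.count_eq_one_of_mem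
      · exact (Walk.isPath_def _).1 hqp
      · rw [hq1]
        have := hz.all v
        simp only [hzdef, List.map_cons, List.mem_cons] at this
        simp only [List.map_cons, List.cons_append, List.mem_cons, List.mem_append,
          List.not_mem_nil, or_false]
        tauto
    · let f : Fin p.edges.length → Fin n := fun i =>
        (z.map Prod.snd).get ⟨i.1, by have := i.2.trans_eq hplen; simp [hlen, this]⟩
      have hf : Function.Injective f := by
        intro i j hij
        have := (List.nodup_iff_injective_get.1 hz.cnd) hij
        simp only [Fin.mk.injEq] at this
        exact Fin.ext this
      have hfb : Function.Bijective f := by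
        rw [Fintype.bijective_iff_injective_and_card]
        exact ⟨hf, by simp [hplen]⟩
      refine ⟨Equiv.ofBijective f hfb, fun i => ?_⟩
      have hi : i.1 < (os z a.1).length := by
        have := i.2.trans_eq hplen; rw [os_length, hlen]; exact this
      have e1 : p.edges.get i = s(((os z a.1)[i.1]'hi).1, ((os z a.1)[i.1]'hi).2.2) := by
        have : p.edges[i.1]'i.2 = ((os z a.1).map (fun s => s(s.1, s.2.2)))[i.1]'(by simpa using hi) := by
          congr 1
        simpa using this
      have e2 : f i = ((os z a.1)[i.1]'hi).2.1 := by
        have : (z.map Prod.snd)[i.1]'(by have := i.2.trans_eq hplen; simp [hlen, this]) =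
          ((os z a.1).map (fun s => s.2.1))[i.1]'(by simpa using hi) := by
          congr 1; rw [os_map_colour]
        simpa [f] using this
      rw [e1, Equiv.ofBijective_apply, e2]
      exact hg _ (List.getElem_mem hi)

end TH

open SimpleGraph
set_option linter.unusedSectionVars false
set_option linter.unusedVariables false
namespace TH
open scoped Classical

section Count
variable {V Γ : Type} [Fintype V] [Fintype Γ] (G : Γ → SimpleGraph V)

/-- neighbourhood -/
noncomputable def nb (γ : Γ) (v : V) : Finset V := Finset.univ.filter (fun w => (G γ).Adj v w)

/-- adjacent ordered pairs -/
noncomputable def ed (γ : Γ) (X Y : Finset V) : ℕ :=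
  ((X ×ˢ Y).filter (fun p => (G γ).Adj p.1 p.2)).card

/-- non adjacent ordered pairs -/
noncomputable def ms (γ : Γ) (X Y : Finset V) : ℕ :=
  ((X ×ˢ Y).filter (fun p => ¬ (G γ).Adj p.1 p.2)).card

variable {G}

@[simp] lemma mem_nb {γ : Γ} {v w : V} : w ∈ nb G γ v ↔ (G γ).Adj v w := by simp [nb]

lemma ed_add_ms (γ : Γ) (X Y : Finset V) : ed G γ X Y + ms G γ X Y = X.card * Y.card := by
  rw [ed, ms, Finset.card_filter_add_card_filter_not, Finset.card_product]

lemma ed_mono {γ : Γ} {X X' Y Y' : Finset V} (h : X ⊆ X') (h' : Y ⊆ Y') :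
    ed G γ X Y ≤ ed G γ X' Y' :=
  Finset.card_le_card (Finset.filter_subset_filter _ (Finset.product_subset_product h h'))

lemma ms_mono {γ : Γ} {X X' Y Y' : Finset V} (h : X ⊆ X') (h' : Y ⊆ Y') :
    ms G γ X Y ≤ ms G γ X' Y' :=
  Finset.card_le_card (Finset.filter_subset_filter _ (Finset.product_subset_product h h'))

lemma ed_eq_sum (γ : Γ) (X Y : Finset V) : ed G γ X Y = ∑ x ∈ X, (nb G γ x ∩ Y).card := by
  rw [ed, Finset.card_filter, Finset.sum_product]
  refine Finset.sum_congr rfl fun x _ => ?_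
  rw [← Finset.card_filter]
  congr 1; ext y; simp [and_comm]

lemma ed_comm (γ : Γ) (X Y : Finset V) : ed G γ X Y = ed G γ Y X := by
  rw [ed, ed]
  refine Finset.card_bij (fun p _ => (p.2, p.1)) ?_ ?_ ?_
  · rintro ⟨a, b⟩ h
    simp only [Finset.mem_filter, Finset.mem_product] at h ⊢
    exact ⟨⟨h.1.2, h.1.1⟩, h.2.symm⟩
  · rintro ⟨a, b⟩ _ ⟨c, d⟩ _ h
    simp only [Prod.mk.injEq] at h ⊢
    exact ⟨h.2, h.1⟩
  · rintro ⟨a, b⟩ h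
    simp only [Finset.mem_filter, Finset.mem_product] at h
    exact ⟨(b, a), by simpa using ⟨⟨h.1.2, h.1.1⟩, h.2.symm⟩, rfl⟩

lemma ms_comm (γ : Γ) (X Y : Finset V) : ms G γ X Y = ms G γ Y X := by
  have h1 := ed_add_ms (G := G) γ X Y
  have h2 := ed_add_ms (G := G) γ Y X
  rw [ed_comm, mul_comm] at h1
  omega

lemma ed_split (γ : Γ) (X Y : Finset V) : ed G γ X Y + ed G γ X Yᶜ = ∑ x ∈ X, (nb G γ x).card := by
  rw [ed_eq_sum, ed_eq_sum, ← Finset.sum_add_distrib]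
  refine Finset.sum_congr rfl fun x _ => ?_
  rw [← Finset.sdiff_eq_inter_compl]
  exact Finset.card_inter_add_card_sdiff _ _

lemma ms_union_left (γ : Γ) (X X' Y : Finset V) : ms G γ (X ∪ X') Y ≤ ms G γ X Y + ms G γ X' Y := by
  rw [ms, Finset.union_product, Finset.filter_union]
  exact Finset.card_union_le _ _

lemma ms_le_mul (γ : Γ) (X Y : Finset V) : ms G γ X Y ≤ X.card * Y.card := by
  have := ed_add_ms (G := G) γ X Y; omega

lemma ed_le_mul (γ : Γ) (X Y : Finset V) : ed G γ X Y ≤ X.card * Y.card := by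
  have := ed_add_ms (G := G) γ X Y; omega

variable (G)
/-- basic hypotheses -/
structure Hyp (k : ℕ) : Prop where
  cV : Fintype.card V = 2 * k + 1
  cG : Fintype.card Γ = 2 * k + 1
  dg : ∀ γ v, k ≤ (nb G γ v).card

/-- non extremality -/
def NE (ν β : ℝ) : Prop := ∀ (S : Finset V) (Y : Γ → Finset V),
  (1 / 2 - β) * Fintype.card V ≤ S.card → (∀ γ, (1 / 2 - β) * Fintype.card V ≤ (Y γ).card) →
  ν * (Fintype.card V : ℝ) ^ 3 ≤ ∑ γ, (ed G γ (Y γ) S : ℝ)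

/-- extremality witnessed by `A`, `I`, `K` -/
structure ExtW (ε : ℝ) (A : Finset V) (I K : Finset Γ) : Prop where
  cA1 : (A.card : ℝ) ≤ (1 / 2 + ε) * Fintype.card V
  cA2 : (1 / 2 - ε) * Fintype.card V ≤ A.card
  dis : Disjoint I K
  rest : (((I ∪ K)ᶜ.card : ℕ) : ℝ) ≤ ε * Fintype.card V
  mI : ∀ γ ∈ I, (ms G γ A Aᶜ : ℝ) ≤ ε * (Fintype.card V : ℝ) ^ 2
  mK : ∀ γ ∈ K, (ms G γ A A : ℝ) ≤ ε * (Fintype.card V : ℝ) ^ 2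
  mK' : ∀ γ ∈ K, (ms G γ Aᶜ Aᶜ : ℝ) ≤ ε * (Fintype.card V : ℝ) ^ 2
variable {G}

lemma ms_compl_le {k : ℕ} (h : Hyp G k) (γ : Γ) (Y S : Finset V) :
    (ms G γ Y Sᶜ : ℝ) ≤ Y.card * ((Fintype.card V : ℝ) - S.card - k) + ed G γ Y S := by
  have h1 := ed_split (G := G) γ Y S
  have h2 : Y.card * k ≤ ∑ x ∈ Y, (nb G γ x).card := by
    rw [← smul_eq_mul]; exact Finset.card_nsmul_le_sum _ _ _ (fun x _ => h.dg γ x)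
  have h3 := ed_add_ms (G := G) γ Y Sᶜ
  have h4 : (Sᶜ.card : ℝ) = (Fintype.card V : ℝ) - S.card := by
    rw [Finset.card_compl, Nat.cast_sub (Finset.card_le_univ _)]
  have h5 : (ed G γ Y Sᶜ : ℝ) + ms G γ Y Sᶜ = Y.card * Sᶜ.card := by exact_mod_cast h3
  have h6 : (Y.card * k : ℝ) ≤ ed G γ Y S + ed G γ Y Sᶜ := by
    rw [← h1] at h2; exact_mod_cast h2
  rw [h4] at h5
  nlinarith

lemma ms_type {k : ℕ} (h : Hyp G k) {ω β : ℝ} (hω : 0 ≤ ω) (hβ : 0 ≤ β)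
    (hβn : 1 / 2 ≤ β * Fintype.card V)
    (γ : Γ) (Y S : Finset V) (hS : (1 / 2 - β) * Fintype.card V ≤ S.card)
    (he : (ed G γ Y S : ℝ) ≤ ω * (Fintype.card V : ℝ) ^ 2) :
    (ms G γ Y Sᶜ : ℝ) ≤ (2 * β + ω) * (Fintype.card V : ℝ) ^ 2 := by
  have h1 := ms_compl_le h γ Y S
  have hn : (Fintype.card V : ℝ) = 2 * k + 1 := by exact_mod_cast h.cV
  have hY : (Y.card : ℝ) ≤ Fintype.card V := by exact_mod_cast Finset.card_le_univ _
  have h2 : (Fintype.card V : ℝ) - S.card - k ≤ 2 * β * Fintype.card V := by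
    nlinarith
  have h0 : (0 : ℝ) ≤ Fintype.card V := by positivity
  have h3 : (Y.card : ℝ) * ((Fintype.card V : ℝ) - S.card - k) ≤ Fintype.card V * (2 * β * Fintype.card V) := by
    calc (Y.card : ℝ) * ((Fintype.card V : ℝ) - S.card - k) ≤ Y.card * (2 * β * Fintype.card V) := by gcongr
      _ ≤ _ := by gcongr
  nlinarith

lemma dichotomy_colour {k : ℕ} (h : Hyp G k) {ε : ℝ} (hε : 0 < ε) (hε1 : ε ≤ 1)
    (hn : 1 / 2 ≤ ε ^ 2 / 64 * Fintype.card V) (γ : Γ) (Y S : Finset V)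
    (hS : (1 / 2 - ε ^ 2 / 64) * Fintype.card V ≤ S.card)
    (hY : (1 / 2 - ε ^ 2 / 64) * Fintype.card V ≤ Y.card)
    (he : (ed G γ Y S : ℝ) ≤ ε ^ 2 / 32 * (Fintype.card V : ℝ) ^ 2) :
    ((ms G γ S Sᶜ : ℝ) ≤ ε * (Fintype.card V : ℝ) ^ 2) ∨
    ((ms G γ S S : ℝ) ≤ ε * (Fintype.card V : ℝ) ^ 2 ∧
      (ms G γ Sᶜ Sᶜ : ℝ) ≤ ε * (Fintype.card V : ℝ) ^ 2) := by
  set n : ℝ := (Fintype.card V : ℝ) with hndef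
  have hn0 : 0 < n := by
    by_contra hneg
    have : n = 0 := le_antisymm (not_lt.1 hneg) (by positivity)
    rw [this] at hn; norm_num at hn
  have a1 : (ms G γ Y Sᶜ : ℝ) ≤ (2 * (ε ^ 2 / 64) + ε ^ 2 / 32) * n ^ 2 :=
    ms_type h (by positivity) (by positivity) hn γ Y S hS he
  have he' := he
  rw [ed_comm] at he'
  have a2 : (ms G γ S Yᶜ : ℝ) ≤ (2 * (ε ^ 2 / 64) + ε ^ 2 / 32) * n ^ 2 :=
    ms_type h (by positivity) (by positivity) hn γ S Y hY he'
  have b0 := ed_add_ms (G := G) γ (S ∩ Y) (S \ Y)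
  have b1 : ed G γ (S ∩ Y) (S \ Y) ≤ ed G γ Y S := ed_mono Finset.inter_subset_right Finset.sdiff_subset
  have b2 : ms G γ (S ∩ Y) (S \ Y) ≤ ms G γ S Yᶜ := ms_mono Finset.inter_subset_left (by
    intro x hx; simp at hx ⊢; exact hx.2)
  have b : ((S ∩ Y).card : ℝ) * (S \ Y).card ≤ ε ^ 2 / 8 * n ^ 2 := by
    have : ((S ∩ Y).card : ℝ) * (S \ Y).card ≤ ed G γ Y S + ms G γ S Yᶜ := by
      rw [← Nat.cast_mul, ← b0]; exact_mod_cast add_le_add b1 b2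
    nlinarith [sq_nonneg (ε * n)]
  by_cases hc : ε / 4 * n ≤ (S ∩ Y).card
  · left
    have c1 : ((S \ Y).card : ℝ) ≤ ε / 2 * n := by
      by_contra hcon
      push Not at hcon
      have : (ε / 4 * n) * (ε / 2 * n) < ((S ∩ Y).card : ℝ) * (S \ Y).card := by
        apply mul_lt_mul' hc hcon (by positivity) (lt_of_lt_of_le (by positivity) hc)
      nlinarith
    have c2 : ms G γ S Sᶜ ≤ ms G γ Y Sᶜ + (S \ Y).card * Sᶜ.card := by
      calc ms G γ S Sᶜ ≤ ms G γ (Y ∪ S \ Y) Sᶜ := ms_mono (by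
              intro x hx; simp [hx, em, or_comm]) (Finset.Subset.refl _)
        _ ≤ _ := (ms_union_left γ _ _ _).trans (Nat.add_le_add_left (ms_le_mul _ _ _) _)
    have c3 : (Sᶜ.card : ℝ) ≤ n := by rw [hndef]; exact_mod_cast Finset.card_le_univ _
    have c4 : (ms G γ S Sᶜ : ℝ) ≤ ms G γ Y Sᶜ + (S \ Y).card * Sᶜ.card := by exact_mod_cast c2
    have c5 : ((S \ Y).card : ℝ) * Sᶜ.card ≤ ε / 2 * n * n := by gcongr
    nlinarith [mul_nonneg hε.le (sq_nonneg n), mul_nonneg (mul_nonneg hε.le (sub_nonneg.2 hε1)) (sq_nonneg n)]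
  · right
    push Not at hc
    have c3 : (Sᶜ.card : ℝ) ≤ n := by rw [hndef]; exact_mod_cast Finset.card_le_univ _
    have c3' : (S.card : ℝ) ≤ n := by rw [hndef]; exact_mod_cast Finset.card_le_univ _
    have ee : 0 ≤ ε * (1 - ε) * n ^ 2 := mul_nonneg (mul_nonneg hε.le (sub_nonneg.2 hε1)) (sq_nonneg n)
    have ee2 : 0 ≤ ε * n ^ 2 := by positivity
    constructor
    · have d1 : ms G γ S S ≤ ms G γ Yᶜ S + (S ∩ Y).card * S.card := by
        calc ms G γ S S ≤ ms G γ (Yᶜ ∪ (S ∩ Y)) S := ms_mono (by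
              intro x hx; simp [hx, em, or_comm]) (Finset.Subset.refl _)
          _ ≤ _ := (ms_union_left γ _ _ _).trans (Nat.add_le_add_left (ms_le_mul _ _ _) _)
      rw [ms_comm γ Yᶜ S] at d1
      have d2 : (ms G γ S S : ℝ) ≤ ms G γ S Yᶜ + (S ∩ Y).card * S.card := by exact_mod_cast d1
      have d3 : ((S ∩ Y).card : ℝ) * S.card ≤ ε / 4 * n * n := by gcongr
      nlinarith
    · have d1 : ms G γ Sᶜ Sᶜ ≤ ms G γ Y Sᶜ + (Sᶜ \ Y).card * Sᶜ.card := by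
        calc ms G γ Sᶜ Sᶜ ≤ ms G γ (Y ∪ (Sᶜ \ Y)) Sᶜ := ms_mono (by
              intro x hx; simp at hx; simp [hx, em]) (Finset.Subset.refl _)
          _ ≤ _ := (ms_union_left γ _ _ _).trans (Nat.add_le_add_left (ms_le_mul _ _ _) _)
      have d2 : (ms G γ Sᶜ Sᶜ : ℝ) ≤ ms G γ Y Sᶜ + (Sᶜ \ Y).card * Sᶜ.card := by exact_mod_cast d1
      have d4 : ((Sᶜ \ Y).card : ℝ) = n - S.card - Y.card + (S ∩ Y).card := by
        have q1 : Sᶜ \ Y = (S ∪ Y)ᶜ := by ext x; simp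
        rw [q1, Finset.card_compl, Nat.cast_sub (Finset.card_le_univ _)]
        have : ((S ∪ Y).card : ℝ) + (S ∩ Y).card = S.card + Y.card := by
          exact_mod_cast Finset.card_union_add_card_inter _ _
        linarith
      have d5 : ((Sᶜ \ Y).card : ℝ) ≤ (ε ^ 2 / 32 + ε / 4) * n := by rw [d4]; nlinarith
      have d3 : ((Sᶜ \ Y).card : ℝ) * Sᶜ.card ≤ (ε ^ 2 / 32 + ε / 4) * n * n := by gcongr
      nlinarith

lemma dichotomy {k : ℕ} (h : Hyp G k) {ε : ℝ} (hε : 0 < ε) (hε1 : ε ≤ 1 / 2)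
    (hn : 1 / 2 ≤ ε ^ 2 / 64 * Fintype.card V) (hext : ¬ ∃ A I K, ExtW G ε A I K) :
    NE G (ε ^ 3 / 32) (ε ^ 2 / 64) := by
  intro S Y hS hY
  by_contra hcon
  push Not at hcon
  apply hext
  set n : ℝ := (Fintype.card V : ℝ) with hndef
  have hn0 : 0 < n := by
    by_contra hneg
    have : n = 0 := le_antisymm (not_lt.1 hneg) (by positivity)
    rw [this] at hn; norm_num at hn
  set Q : Finset Γ := Finset.univ.filter (fun γ => (ed G γ (Y γ) S : ℝ) ≤ ε ^ 2 / 32 * n ^ 2) with hQ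
  have hQc : (Qᶜ.card : ℝ) ≤ ε * n := by
    by_contra hlt
    push Not at hlt
    have h1 : (Qᶜ.card : ℝ) * (ε ^ 2 / 32 * n ^ 2) ≤ ∑ γ ∈ Qᶜ, (ed G γ (Y γ) S : ℝ) := by
      rw [← nsmul_eq_mul]
      apply Finset.card_nsmul_le_sum
      intro γ hγ
      simp only [hQ, Finset.mem_compl, Finset.mem_filter, Finset.mem_univ, true_and, not_le] at hγ
      exact hγ.le
    have h2 : ∑ γ ∈ Qᶜ, (ed G γ (Y γ) S : ℝ) ≤ ∑ γ, (ed G γ (Y γ) S : ℝ) :=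
      Finset.sum_le_univ_sum_of_nonneg (fun _ => by positivity)
    have h3 : ε * n * (ε ^ 2 / 32 * n ^ 2) ≤ (Qᶜ.card : ℝ) * (ε ^ 2 / 32 * n ^ 2) := by gcongr
    nlinarith
  let I : Finset Γ := Q.filter (fun γ => (ms G γ S Sᶜ : ℝ) ≤ ε * n ^ 2)
  let K : Finset Γ := Q \ I
  have hIK : I ∪ K = Q := Finset.union_sdiff_of_subset (Finset.filter_subset _ _)
  have hK : ∀ γ ∈ K, (ms G γ S S : ℝ) ≤ ε * n ^ 2 ∧ (ms G γ Sᶜ Sᶜ : ℝ) ≤ ε * n ^ 2 := by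
    intro γ hγ
    simp only [K, I, Finset.mem_sdiff, Finset.mem_filter, not_and] at hγ
    have hq := hγ.1
    simp only [hQ, Finset.mem_filter, Finset.mem_univ, true_and] at hq
    rcases dichotomy_colour h hε (by linarith) hn γ (Y γ) S hS (hY γ) hq with h1 | h1
    · exact absurd h1 (hγ.2 hγ.1)
    · exact h1
  refine ⟨S, I, K, ⟨?_, ?_, Finset.disjoint_sdiff, ?_, ?_, fun γ hγ => (hK γ hγ).1, fun γ hγ => (hK γ hγ).2⟩⟩
  · have hQne : Q.Nonempty := by
      by_contra hne
      rw [Finset.not_nonempty_iff_eq_empty] at hne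
      rw [hne, Finset.compl_empty, Finset.card_univ, h.cG, ← h.cV] at hQc
      nlinarith
    obtain ⟨γ, hγ⟩ := hQne
    simp only [hQ, Finset.mem_filter, Finset.mem_univ, true_and] at hγ
    have h1 := ed_split (G := G) γ (Y γ) S
    have h2 : (Y γ).card * k ≤ ∑ x ∈ Y γ, (nb G γ x).card := by
      rw [← smul_eq_mul]; exact Finset.card_nsmul_le_sum _ _ _ (fun x _ => h.dg γ x)
    have h3 := ed_le_mul (G := G) γ (Y γ) Sᶜ
    have h4 : (Sᶜ.card : ℝ) = n - S.card := by
      rw [Finset.card_compl, Nat.cast_sub (Finset.card_le_univ _)]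
    have h5 : (ed G γ (Y γ) Sᶜ : ℝ) ≤ (Y γ).card * Sᶜ.card := by exact_mod_cast h3
    rw [h4] at h5
    have h6 : ((Y γ).card * k : ℝ) ≤ ed G γ (Y γ) S + ed G γ (Y γ) Sᶜ := by
      rw [← h1] at h2; exact_mod_cast h2
    have hnk : n = 2 * k + 1 := by rw [hndef]; exact_mod_cast h.cV
    have h7 : ((Y γ).card : ℝ) * (S.card - n / 2 - 1 / 2) ≤ ε ^ 2 / 32 * n ^ 2 := by
      have : ((Y γ).card : ℝ) * (S.card - n / 2 - 1 / 2) = (Y γ).card * k - (Y γ).card * (n - S.card) := by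
        rw [hnk]; ring
      linarith
    by_contra hbig
    push Not at hbig
    have h8 : ε / 2 * n ≤ S.card - n / 2 - 1 / 2 := by nlinarith
    have h9 : n / 4 ≤ (Y γ).card := by have := hY γ; nlinarith
    have h10 : n / 4 * (ε / 2 * n) ≤ ((Y γ).card : ℝ) * (S.card - n / 2 - 1 / 2) := by
      apply mul_le_mul h9 h8 (by positivity) (by positivity)
    nlinarith [mul_pos hε (pow_pos hn0 2), mul_nonneg (mul_nonneg hε.le (sub_nonneg.2 hε1)) (sq_nonneg n)]
  · have : ε ^ 2 / 64 ≤ ε := by nlinarith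
    nlinarith
  · rw [hIK]; exact hQc
  · intro γ hγ
    exact (Finset.mem_filter.1 hγ).2

end Count
end TH

open SimpleGraph
set_option linter.unusedSectionVars false
set_option linter.unusedVariables false
namespace TH
open scoped Classical

section Completion
variable {V Γ : Type}

lemma os_heads (z : List (V × Γ)) (w : V) :
    hd z w :: (os z w).map (fun s => s.2.2) = z.map Prod.fst ++ [w] := by
  induction z with
  | nil => rfl
  | cons a r ih => simp [← ih]

lemma os_split {z : List (V × Γ)} {w : V} {A B : List (V × Γ × V)} (h : os z w = A ++ B) :
    ∃ x y, z = x ++ y ∧ os x (hd y w) = A ∧ os y w = B := by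
  induction A generalizing z with
  | nil => exact ⟨[], z, rfl, rfl, h⟩
  | cons a A ih =>
    cases z with
    | nil => simp at h
    | cons b r =>
      simp only [os_cons, List.cons_append, List.cons.injEq] at h
      obtain ⟨x, y, rfl, h2, h3⟩ := ih h.2
      refine ⟨b :: x, y, rfl, ?_, h3⟩
      rw [os_cons, h2, ← h.1, hd_append]

lemma os_split_one {z : List (V × Γ)} {w : V} {A B : List (V × Γ × V)} {s : V × Γ × V}
    (h : os z w = A ++ s :: B) :
    ∃ x y, z = x ++ (s.1, s.2.1) :: y ∧ hd y w = s.2.2 ∧ os x s.1 = A ∧ os y w = B := by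
  obtain ⟨x, y, rfl, h1, h2⟩ := os_split h
  cases y with
  | nil => simp at h2
  | cons a y =>
    simp only [os_cons, List.cons.injEq] at h2
    obtain ⟨h2, h3⟩ := h2
    subst h2
    exact ⟨x, y, rfl, rfl, h1, h3⟩

lemma cyc_three (a b d : List (V × Γ)) (p p' y : V) (i j c : Γ) :
    cyc ((a ++ [(p, i)]) ++ (b ++ [(p', j)]) ++ (d ++ [(y, c)])) =
    os a p ++ [(p, i, hd b p')] ++ (os b p' ++ [(p', j, hd d y)]) ++ (os d y ++ [(y, c, hd a p)]) := by
  rw [cyc_append _ _ p p (by simp) (by simp)]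
  simp [os_append, hd_append]

lemma cyc_one (d : List (V × Γ)) (y : V) (c : Γ) :
    cyc (d ++ [(y, c)]) = os d y ++ [(y, c, hd d y)] := by
  cases d with
  | nil => rfl
  | cons a r => 
    rw [List.cons_append, cyc_cons, ← List.cons_append, os_append]; rfl

lemma full_perm {z z' : List (V × Γ)} (h1 : (z'.map Prod.fst).Perm (z.map Prod.fst))
    (h2 : (z'.map Prod.snd).Perm (z.map Prod.snd)) (h : Full z) : Full z' :=
  ⟨h1.nodup_iff.2 h.nd, fun v => h1.mem_iff.2 (h.all v), h2.nodup_iff.2 h.cnd⟩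

/-- a class of slots: tails, colours, heads -/
abbrev Cls (V Γ : Type) := Finset V × Finset Γ × Finset V

/-- membership of a slot in a class -/
def inC (κ : Cls V Γ) (s : V × Γ × V) : Prop := s.1 ∈ κ.1 ∧ s.2.1 ∈ κ.2.1 ∧ s.2.2 ∈ κ.2.2

variable [Fintype V] [Fintype Γ]

/-- nearly complete class, with error `D` -/
structure Near (G : Γ → SimpleGraph V) (D : ℝ) (κ : Cls V Γ) : Prop where
  col : ∀ c ∈ κ.2.1, (ms G c κ.1 κ.2.2 : ℝ) ≤ D
  tl : ∀ y ∈ κ.1, (((κ.2.2 ×ˢ κ.2.1).filter (fun p => ¬ (G p.2).Adj y p.1)).card : ℝ) ≤ D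
  hdd : ∀ x ∈ κ.2.2, (((κ.1 ×ˢ κ.2.1).filter (fun p => ¬ (G p.2).Adj p.1 x)).card : ℝ) ≤ D

lemma card_le_three {α : Type} [DecidableEq α] (B P Q R : Finset α) (D : ℝ) (h : B ⊆ P ∪ Q ∪ R)
    (hP : (P.card : ℝ) ≤ D) (hQ : (Q.card : ℝ) ≤ D) (hR : (R.card : ℝ) ≤ D) : (B.card : ℝ) ≤ 3 * D := by
  have h1 : B.card ≤ P.card + Q.card + R.card :=
    (Finset.card_le_card h).trans ((Finset.card_union_le _ _).trans
      (Nat.add_le_add_right (Finset.card_union_le _ _) _))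
  have h2 : (B.card : ℝ) ≤ P.card + Q.card + R.card := by exact_mod_cast h1
  linarith

lemma exists_pair {G : Γ → SimpleGraph V} {D : ℝ} {κ : Cls V Γ} (hκ : Near G D κ)
    (F : Finset (V × Γ × V)) (hF : ∀ s ∈ F, inC κ s)
    (i1 : ∀ s ∈ F, ∀ t ∈ F, s.1 = t.1 → s = t)
    (i2 : ∀ s ∈ F, ∀ t ∈ F, s.2.1 = t.2.1 → s = t)
    (i3 : ∀ s ∈ F, ∀ t ∈ F, s.2.2 = t.2.2 → s = t)
    (s0 : V × Γ × V) (h0 : inC κ s0) (R : V × Γ × V → V × Γ × V → Prop)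
    (hR : ∀ s ∈ F, ∀ t ∈ F, s ≠ t → R s t ∨ R t s)
    (hcard : 6 * D < (F.card : ℝ) * F.card - F.card) :
    ∃ s ∈ F, ∃ t ∈ F, s ≠ t ∧ R s t ∧ (G s0.2.1).Adj s.1 t.2.2 ∧ (G t.2.1).Adj s0.1 s.2.2 ∧
      (G s.2.1).Adj t.1 s0.2.2 := by
  by_contra hcon
  push Not at hcon
  let P1 := (F ×ˢ F).filter (fun p => ¬ (G s0.2.1).Adj p.1.1 p.2.2.2)
  let P2 := (F ×ˢ F).filter (fun p => ¬ (G p.2.2.1).Adj s0.1 p.1.2.2)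
  let P3 := (F ×ˢ F).filter (fun p => ¬ (G p.1.2.1).Adj p.2.1 s0.2.2)
  have c1 : (P1.card : ℝ) ≤ D := by
    refine le_trans ?_ (hκ.col s0.2.1 h0.2.1)
    rw [ms]; norm_cast
    refine Finset.card_le_card_of_injOn (fun p => (p.1.1, p.2.2.2)) ?_ ?_
    · rintro ⟨s, t⟩ h
      simp only [P1, Finset.coe_filter, Finset.mem_product, Set.mem_setOf_eq] at h ⊢
      exact ⟨⟨(hF s h.1.1).1, (hF t h.1.2).2.2⟩, h.2⟩
    · rintro ⟨s, t⟩ h ⟨s', t'⟩ h' he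
      simp only [P1, Finset.coe_filter, Finset.mem_product, Set.mem_setOf_eq, Prod.mk.injEq] at h h' he ⊢
      exact ⟨i1 _ h.1.1 _ h'.1.1 he.1, i3 _ h.1.2 _ h'.1.2 he.2⟩
  have c2 : (P2.card : ℝ) ≤ D := by
    refine le_trans ?_ (hκ.tl s0.1 h0.1)
    norm_cast
    refine Finset.card_le_card_of_injOn (fun p => (p.1.2.2, p.2.2.1)) ?_ ?_
    · rintro ⟨s, t⟩ h
      simp only [P2, Finset.coe_filter, Finset.mem_product, Set.mem_setOf_eq] at h ⊢
      exact ⟨⟨(hF s h.1.1).2.2, (hF t h.1.2).2.1⟩, h.2⟩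
    · rintro ⟨s, t⟩ h ⟨s', t'⟩ h' he
      simp only [P2, Finset.coe_filter, Finset.mem_product, Set.mem_setOf_eq, Prod.mk.injEq] at h h' he ⊢
      exact ⟨i3 _ h.1.1 _ h'.1.1 he.1, i2 _ h.1.2 _ h'.1.2 he.2⟩
  have c3 : (P3.card : ℝ) ≤ D := by
    refine le_trans ?_ (hκ.hdd s0.2.2 h0.2.2)
    norm_cast
    refine Finset.card_le_card_of_injOn (fun p => (p.2.1, p.1.2.1)) ?_ ?_
    · rintro ⟨s, t⟩ h
      simp only [P3, Finset.coe_filter, Finset.mem_product, Set.mem_setOf_eq] at h ⊢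
      exact ⟨⟨(hF t h.1.2).1, (hF s h.1.1).2.1⟩, h.2⟩
    · rintro ⟨s, t⟩ h ⟨s', t'⟩ h' he
      simp only [P3, Finset.coe_filter, Finset.mem_product, Set.mem_setOf_eq, Prod.mk.injEq] at h h' he ⊢
      exact ⟨i2 _ h.1.1 _ h'.1.1 he.2, i1 _ h.1.2 _ h'.1.2 he.1⟩
  let B := F.offDiag.filter (fun p => R p.1 p.2)
  have cB : (B.card : ℝ) ≤ 3 * D := by
    apply card_le_three B P1 P2 P3 D ?_ c1 c2 c3
    rintro ⟨s, t⟩ h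
    simp only [B, Finset.mem_filter, Finset.mem_offDiag] at h
    have := hcon s h.1.1 t h.1.2.1 h.1.2.2 h.2
    simp only [P1, P2, P3, Finset.mem_union, Finset.mem_filter, Finset.mem_product, h.1.1, h.1.2.1, and_self, true_and]
    tauto
  have hsub : F.offDiag ⊆ B ∪ B.image Prod.swap := by
    rintro ⟨s, t⟩ h
    have h' := Finset.mem_offDiag.1 h
    simp only [Finset.mem_union, Finset.mem_image, B, Finset.mem_filter, Finset.mem_offDiag]
    rcases hR s h'.1 t h'.2.1 h'.2.2 with hr | hr
    · left; exact ⟨h', hr⟩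
    · right; exact ⟨(t, s), ⟨⟨h'.2.1, h'.1, h'.2.2.symm⟩, hr⟩, rfl⟩
  have h1 : F.offDiag.card ≤ B.card + B.card :=
    (Finset.card_le_card hsub).trans ((Finset.card_union_le _ _).trans
      (Nat.add_le_add_left Finset.card_image_le _))
  rw [Finset.offDiag_card] at h1
  have h2 : F.card * F.card ≤ B.card + B.card + F.card := by omega
  have h3 : (F.card : ℝ) * F.card ≤ B.card + B.card + F.card := by exact_mod_cast h2
  linarith

lemma pair_order {α : Type} {l : List α} {s t : α} (hs : s ∈ l) (ht : t ∈ l) (hne : s ≠ t) :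
    (∃ A B C, l = A ++ s :: (B ++ t :: C)) ∨ (∃ A B C, l = A ++ t :: (B ++ s :: C)) := by
  obtain ⟨A, B, rfl⟩ := List.append_of_mem hs
  simp only [List.mem_append, List.mem_cons] at ht
  rcases ht with ht | ht | ht
  · obtain ⟨A1, A2, rfl⟩ := List.append_of_mem ht
    right; exact ⟨A1, A2, B, by simp⟩
  · exact absurd ht.symm hne
  · obtain ⟨A1, A2, rfl⟩ := List.append_of_mem ht
    left; exact ⟨A, A1, A2, by simp⟩

/-- completion lemma -/
lemma completion {G : Γ → SimpleGraph V} {D : ℝ} (cls : Set (Cls V Γ))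
    (hnear : ∀ κ ∈ cls, Near G D κ)
    (hdis : ∀ κ ∈ cls, ∀ κ' ∈ cls, ∀ s, inC κ s → inC κ' s → κ = κ')
    (N : ℕ) (hN : ∀ m : ℕ, N ≤ m + 1 → 6 * D < (m : ℝ) * m - m) :
    ∀ (b : ℕ) (z : List (V × Γ)), Full z → (cyc z).countP (fun s => ¬ good G s) = b →
      (∀ s ∈ cyc z, ¬ good G s → ∃ κ ∈ cls, inC κ s ∧ N ≤ (cyc z).countP (fun s => inC κ s)) →
      THC G := by
  intro b
  induction b using Nat.strong_induction_on with
  | _ b ih =>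
  intro z hz hb hbad
  by_cases hall : ∀ s ∈ cyc z, good G s
  · exact ⟨z, hz, hall⟩
  push Not at hall
  obtain ⟨s0, hs0, hg0⟩ := hall
  obtain ⟨κ, hκ, hin, hcount⟩ := hbad s0 hs0 hg0
  -- rotate
  obtain ⟨r, hfull, hperm⟩ : ∃ r, Full (r ++ [(s0.1, s0.2.1)]) ∧
      (cyc z).Perm (os r s0.1 ++ [s0]) ∧ hd r s0.1 = s0.2.2 := by
    cases z with
    | nil => simp [cyc] at hs0
    | cons a z =>
      rw [cyc_cons] at hs0
      obtain ⟨A, B, hAB⟩ := List.append_of_mem hs0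
      obtain ⟨x, y, hxy, hh, h1, h2⟩ := os_split_one hAB
      have e : a :: z = (x ++ [(s0.1, s0.2.1)]) ++ y := by rw [hxy]; simp
      have hp := cyc_rotate (x ++ [(s0.1, s0.2.1)]) y
      rw [← e, ← List.append_assoc, cyc_one] at hp
      have hh2 : hd (y ++ x) s0.1 = s0.2.2 := by
        rw [← hh, hd_append]
        cases y with
        | cons _ _ => rfl
        | nil =>
          cases x with
          | nil =>
            simp at hxy
            simp [hxy.1]
          | cons c x =>
            simp at hxy
            simp [hxy.1]
      refine ⟨y ++ x, ?_, ?_, hh2⟩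
      · refine full_perm ?_ ?_ hz
        · rw [e]; exact List.Perm.map _ (by rw [List.append_assoc]; exact List.perm_append_comm)
        · rw [e]; exact List.Perm.map _ (by rw [List.append_assoc]; exact List.perm_append_comm)
      · rw [hh2] at hp; exact hp
  obtain ⟨hperm, hhd⟩ := hperm
  set l := os r s0.1 with hl
  have hnd : (r.map Prod.fst).Nodup ∧ s0.1 ∉ r.map Prod.fst := by
    have := hfull.nd
    rw [List.map_append, List.nodup_append] at this
    refine ⟨this.1, fun h => this.2.2 _ h s0.1 (by simp) rfl⟩
  have hcnd : (r.map Prod.snd).Nodup := by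
    have := hfull.cnd
    rw [List.map_append, List.nodup_append] at this
    exact this.1
  have n1 : (l.map (fun s => s.1)).Nodup := by rw [hl, os_map_tail]; exact hnd.1
  have n2 : (l.map (fun s => s.2.1)).Nodup := by rw [hl, os_map_colour]; exact hcnd
  have n3 : (l.map (fun s => s.2.2)).Nodup := by
    have := os_heads r s0.1
    have h2 : (r.map Prod.fst ++ [s0.1]).Nodup := by simpa using hfull.nd
    rw [← this] at h2
    exact (List.nodup_cons.1 h2).2
  have hlnd : l.Nodup := List.Nodup.of_map _ n1
  let F := l.toFinset.filter (fun s => inC κ s)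
  have hFl : ∀ s, s ∈ F ↔ s ∈ l ∧ inC κ s := by intro s; simp [F]
  have inj : ∀ {β : Type} (f : V × Γ × V → β), (l.map f).Nodup → ∀ s ∈ F, ∀ t ∈ F, f s = f t → s = t := by
    intro β f hf s hs t ht hst
    exact List.inj_on_of_nodup_map hf ((hFl s).1 hs).1 ((hFl t).1 ht).1 hst
  have hFc : N ≤ F.card + 1 := by
    rw [hperm.countP_eq, List.countP_append] at hcount
    have e1 : l.countP (fun s => inC κ s) = F.card := by
      rw [List.countP_eq_length_filter]
      rw [← List.toFinset_card_of_nodup (hlnd.filter _)]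
      congr 1
      ext s; simp [hFl]
    have e2 : List.countP (fun s => decide (inC κ s)) [s0] ≤ 1 := List.countP_le_length
    omega
  obtain ⟨s, hs, t, ht, hne, ⟨A, B, C, hABC⟩, g1, g2, g3⟩ := exists_pair (hnear κ hκ) F
    (fun s hs => ((hFl s).1 hs).2) (inj (fun s => s.1) n1) (inj (fun s => s.2.1) n2) (inj (fun s => s.2.2) n3) s0 hin
    (fun s t => ∃ A B C, l = A ++ s :: (B ++ t :: C))
    (fun s hs t ht hne => pair_order ((hFl s).1 hs).1 ((hFl t).1 ht).1 hne) (hN _ hFc)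
  obtain ⟨a, y, hr1, hy, ha, hyB⟩ := os_split_one hABC
  obtain ⟨b', d, hr2, hdd, hb', hdC⟩ := os_split_one hyB
  subst hr2
  have hb'q : hd b' t.1 = s.2.2 := by rw [← hy, hd_append]; rfl
  have hax : hd a s.1 = s0.2.2 := by rw [← hhd, hr1, hd_append]; rfl
  let z' := (a ++ [(s.1, s0.2.1)]) ++ (d ++ [(s0.1, t.2.1)]) ++ (b' ++ [(t.1, s.2.1)])
  have hz'c : cyc z' = os a s.1 ++ [(s.1, s0.2.1, t.2.2)] ++ (os d s0.1 ++ [(s0.1, t.2.1, s.2.2)]) ++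
      (os b' t.1 ++ [(t.1, s.2.1, s0.2.2)]) := by
    rw [← hb'q, ← hax, ← hdd]
    exact cyc_three _ _ _ _ _ _ _ _ _
  have hzc : l ++ [s0] = os a s.1 ++ [s] ++ (os b' t.1 ++ [t]) ++ (os d s0.1 ++ [s0]) := by
    rw [hABC, ha, hb', hdC]; simp
  rw [hzc] at hperm
  -- permutations
  have hfull' : Full z' := by
    refine full_perm ?_ ?_ hfull
    · rw [hr1]
      simp only [z', List.map_append, List.map_cons, List.map_nil]
      rw [← Multiset.coe_eq_coe]
      simp only [← Multiset.coe_add, ← Multiset.cons_coe, Multiset.coe_nil]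
      ac_nf
      simp only [Multiset.cons_add, Multiset.add_cons, ← Multiset.singleton_add]
      simp only [add_zero, zero_add]
      abel
    · rw [hr1]
      simp only [z', List.map_append, List.map_cons, List.map_nil]
      rw [← Multiset.coe_eq_coe]
      simp only [← Multiset.coe_add, ← Multiset.cons_coe, Multiset.coe_nil]
      simp only [Multiset.cons_add, Multiset.add_cons, ← Multiset.singleton_add]
      simp only [add_zero, zero_add]
      abel
  have hsκ := ((hFl s).1 hs).2
  have htκ := ((hFl t).1 ht).2
  have k1 : inC κ (s.1, s0.2.1, t.2.2) := ⟨hsκ.1, hin.2.1, htκ.2.2⟩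
  have k2 : inC κ (s0.1, t.2.1, s.2.2) := ⟨hin.1, htκ.2.1, hsκ.2.2⟩
  have k3 : inC κ (t.1, s.2.1, s0.2.2) := ⟨htκ.1, hsκ.2.1, hin.2.2⟩
  refine ih ((cyc z').countP (fun s => ¬ good G s)) ?_ z' hfull' rfl ?_
  · rw [← hb, hperm.countP_eq, hz'c]
    have q1 : good G (s.1, s0.2.1, t.2.2) := g1
    have q2 : good G (s0.1, t.2.1, s.2.2) := g2
    have q3 : good G (t.1, s.2.1, s0.2.2) := g3
    simp only [List.countP_append, List.countP_cons, List.countP_nil, q1, q2, q3, hg0]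
    simp
    omega
  · intro u hu hgu
    have hucyc : u ∈ cyc z := by
      rw [hperm.mem_iff]
      rw [hz'c] at hu
      simp only [List.mem_append, List.mem_singleton] at hu ⊢
      rcases hu with ((hu | hu) | (hu | hu)) | (hu | hu)
      · tauto
      · exact absurd (hu ▸ g1) hgu
      · tauto
      · exact absurd (hu ▸ g2) hgu
      · tauto
      · exact absurd (hu ▸ g3) hgu
    obtain ⟨κ', hκ', hin', hc'⟩ := hbad u hucyc hgu
    refine ⟨κ', hκ', hin', hc'.trans (le_of_eq ?_)⟩
    rw [hperm.countP_eq, hz'c]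
    by_cases hkk : κ' = κ
    · subst hkk
      simp only [List.countP_append, List.countP_cons, List.countP_nil, hsκ, htκ, hin, k1, k2, k3]
      simp only [decide_true, if_true]
      omega
    · have no : ∀ v, inC κ v → ¬ inC κ' v := fun v h1 h2 => hkk (hdis κ' hκ' κ hκ v h2 h1)
      simp only [List.countP_append, List.countP_cons, List.countP_nil, no _ hsκ, no _ htκ, no _ hin,
        no _ k1, no _ k2, no _ k3]
      omega

end Completion
end TH

open SimpleGraph
set_option linter.unusedSectionVars false
set_option linter.unusedVariables false
namespace TH
open scoped Classical

section Assembly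
variable {V Γ : Type}

/-- a coloured path -/
abbrev Core (V Γ : Type) := List (V × Γ) × V

/-- vertices of a core -/
def cv (c : Core V Γ) : List V := c.1.map Prod.fst ++ [c.2]
/-- colours of a core -/
def cc (c : Core V Γ) : List Γ := c.1.map Prod.snd
/-- head of a core -/
def ch (c : Core V Γ) : V := hd c.1 c.2

/-- join of cores by colours -/
def jn : List (Core V Γ × Γ) → List (V × Γ)
  | [] => []
  | p :: r => p.1.1 ++ (p.1.2, p.2) :: jn r

/-- head of a list of cores -/
def hdc : List (Core V Γ) → V → V
  | [], w => w
  | c :: _, _ => ch c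

/-- joints of a list of cores -/
def joints : List (Core V Γ × Γ) → V → List (V × Γ × V)
  | [], _ => []
  | p :: r, w => (p.1.2, p.2, hdc (r.map Prod.fst) w) :: joints r w

lemma jn_fst (r : List (Core V Γ × Γ)) : (jn r).map Prod.fst = (r.map Prod.fst).flatMap cv := by
  induction r with
  | nil => rfl
  | cons p r ih => simp [jn, ih, cv]

lemma jn_snd (r : List (Core V Γ × Γ)) :
    ((jn r).map Prod.snd).Perm ((r.map Prod.fst).flatMap cc ++ r.map Prod.snd) := by
  induction r with
  | nil => exact List.Perm.refl _
  | cons p r ih =>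
    simp only [jn, List.map_append, List.map_cons, List.flatMap_cons, cc]
    rw [List.append_assoc]
    refine List.Perm.append_left _ ?_
    refine (List.Perm.cons _ ih).trans ?_
    exact List.perm_middle.symm

lemma hd_jn (r : List (Core V Γ × Γ)) (w : V) : hd (jn r) w = hdc (r.map Prod.fst) w := by
  cases r with
  | nil => rfl
  | cons p r =>
    simp only [jn, List.map_cons, hdc, ch, hd_append]
    rfl

lemma os_jn (r : List (Core V Γ × Γ)) (w : V) :
    (os (jn r) w).Perm ((r.map Prod.fst).flatMap (fun c => os c.1 c.2) ++ joints r w) := by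
  induction r with
  | nil => exact List.Perm.refl _
  | cons p r ih =>
    simp only [jn, os_append, List.map_cons, List.flatMap_cons, joints, os_cons, hd_cons, hd_jn]
    rw [List.append_assoc]
    refine List.Perm.append_left _ ?_
    refine (List.Perm.cons _ ih).trans ?_
    exact List.perm_middle.symm

/-- head of a list of types -/
def hdT : List (Bool × Bool) → Bool → Bool
  | [], w => w
  | c :: _, _ => c.1

/-- joint types -/
def jt : List (Bool × Bool) → Bool → List (Bool × Bool)
  | [], _ => []
  | p :: r, w => (p.2, hdT r w) :: jt r w

lemma hdT_append (x y : List (Bool × Bool)) (w : Bool) : hdT (x ++ y) w = hdT x (hdT y w) := by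
  cases x <;> rfl

lemma jt_append (x y : List (Bool × Bool)) (w : Bool) : jt (x ++ y) w = jt x (hdT y w) ++ jt y w := by
  induction x with
  | nil => rfl
  | cons a r ih => simp [jt, ih, hdT_append]

lemma jt_length (x : List (Bool × Bool)) (w : Bool) : (jt x w).length = x.length := by
  induction x with
  | nil => rfl
  | cons a r ih => simp [jt, ih]

/-- end types of a core -/
noncomputable def ends (A : Finset V) (c : Core V Γ) : Bool × Bool := (decide (ch c ∈ A), decide (c.2 ∈ A))

/-- end types of a slot -/
noncomputable def styp (A : Finset V) (s : V × Γ × V) : Bool × Bool := (decide (s.1 ∈ A), decide (s.2.2 ∈ A))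

lemma hdT_ends (A : Finset V) (L : List (Core V Γ)) (w : V) :
    hdT (L.map (ends A)) (decide (w ∈ A)) = decide (hdc L w ∈ A) := by
  cases L <;> rfl

lemma joints_typ (A : Finset V) (r : List (Core V Γ × Γ)) (w : V) :
    (joints r w).map (styp A) = jt ((r.map Prod.fst).map (ends A)) (decide (w ∈ A)) := by
  induction r with
  | nil => rfl
  | cons p r ih =>
    simp only [joints, List.map_cons, jt, ih, hdT_ends]
    simp [styp, ends]

lemma asgn (A : Finset V) (L : List (Core V Γ)) (w : V) : ∀ (CI CK : List Γ),
    CI.length = (jt (L.map (ends A)) (decide (w ∈ A))).countP (fun p => p.1 ≠ p.2) →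
    CK.length = (jt (L.map (ends A)) (decide (w ∈ A))).countP (fun p => p.1 = p.2) →
    ∃ r : List (Core V Γ × Γ), r.map Prod.fst = L ∧ (r.map Prod.snd).Perm (CI ++ CK) ∧
      ∀ s ∈ joints r w, ((styp A s).1 ≠ (styp A s).2 → s.2.1 ∈ CI) ∧ ((styp A s).1 = (styp A s).2 → s.2.1 ∈ CK) := by
  induction L with
  | nil =>
    intro CI CK h1 h2
    simp [jt] at h1 h2
    subst h1; subst h2
    exact ⟨[], rfl, by simp, by simp [joints]⟩
  | cons c L ih =>
    intro CI CK h1 h2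
    simp only [List.map_cons, jt, List.countP_cons, hdT_ends] at h1 h2
    by_cases hc : (ends A c).2 = decide (hdc L w ∈ A)
    · simp [hc] at h1 h2
      obtain ⟨g, CK, rfl⟩ : ∃ g C, CK = g :: C := by
        cases CK with
        | nil => simp at h2
        | cons g C => exact ⟨g, C, rfl⟩
      obtain ⟨r, hr1, hr2, hr3⟩ := ih CI CK (by simpa using h1) (by simpa using h2)
      refine ⟨(c, g) :: r, by simp [hr1], ?_, ?_⟩
      · simp only [List.map_cons]
        exact (List.Perm.cons _ hr2).trans List.perm_middle.symm
      · intro s hs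
        simp only [joints, List.mem_cons, hr1] at hs
        rcases hs with rfl | hs
        · have : (styp A (c.2, g, hdc L w)).1 = (styp A (c.2, g, hdc L w)).2 := hc
          exact ⟨fun h => absurd this h, fun _ => by simp⟩
        · have := hr3 s hs
          exact ⟨this.1, fun h => List.mem_cons_of_mem _ (this.2 h)⟩
    · simp [hc] at h1 h2
      obtain ⟨g, CI, rfl⟩ : ∃ g C, CI = g :: C := by
        cases CI with
        | nil => simp at h1
        | cons g C => exact ⟨g, C, rfl⟩
      obtain ⟨r, hr1, hr2, hr3⟩ := ih CI CK (by simpa using h1) (by simpa using h2)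
      refine ⟨(c, g) :: r, by simp [hr1], ?_, ?_⟩
      · simp only [List.map_cons, List.cons_append]
        exact (List.Perm.cons _ hr2)
      · intro s hs
        simp only [joints, List.mem_cons, hr1] at hs
        rcases hs with rfl | hs
        · have : (styp A (c.2, g, hdc L w)).1 ≠ (styp A (c.2, g, hdc L w)).2 := hc
          exact ⟨fun _ => by simp, fun h => absurd h this⟩
        · have := hr3 s hs
          exact ⟨fun h => List.mem_cons_of_mem _ (this.1 h), this.2⟩

variable [Fintype V] [Fintype Γ]

/-- near extremal context -/
structure Ctx (G : Γ → SimpleGraph V) (D : ℝ) (A B : Finset V) (I K : Finset Γ) : Prop where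
  dAB : Disjoint A B
  dIK : Disjoint I K
  nAA : Near G D (A, K, A)
  nBB : Near G D (B, K, B)
  nAB : Near G D (A, I, B)
  nBA : Near G D (B, I, A)

lemma Ctx.swap {G : Γ → SimpleGraph V} {D : ℝ} {A B : Finset V} {I K : Finset Γ}
    (h : Ctx G D A B I K) : Ctx G D B A I K :=
  ⟨h.dAB.symm, h.dIK, h.nBB, h.nAA, h.nBA, h.nAB⟩

lemma asm {G : Γ → SimpleGraph V} {D : ℝ} {A B : Finset V} {I K : Finset Γ}
    (h : Ctx G D A B I K) (N : ℕ) (hN : ∀ m : ℕ, N ≤ m + 1 → 6 * D < (m : ℝ) * m - m)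
    (c0 : Core V Γ) (L0 : List (Core V Γ)) (hnd : ((c0 :: L0).flatMap cv).Nodup)
    (hall : ∀ v, v ∈ (c0 :: L0).flatMap cv)
    (CI CK : List Γ) (hcnd : ((c0 :: L0).flatMap cc ++ (CI ++ CK)).Nodup)
    (hCI : ∀ γ ∈ CI, γ ∈ I) (hCK : ∀ γ ∈ CK, γ ∈ K)
    (hgood : ∀ c ∈ c0 :: L0, ∀ s ∈ os c.1 c.2, good G s)
    (hends : ∀ c ∈ c0 :: L0, ch c ∈ A ∪ B ∧ c.2 ∈ A ∪ B)
    (T : List (Bool × Bool)) (hT : (c0 :: L0).map (ends A) = T)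
    (h1 : CI.length = (jt T (hdT T true)).countP (fun p => p.1 ≠ p.2))
    (h2 : CK.length = (jt T (hdT T true)).countP (fun p => p.1 = p.2))
    (hcount : ∀ p ∈ jt T (hdT T true), N ≤ (jt T (hdT T true)).count p) : THC G := by
  set L := c0 :: L0 with hL
  set w := ch c0 with hw
  have hTw : hdT T true = decide (w ∈ A) := by rw [← hT]; rfl
  rw [hTw, ← hT] at h1 h2 hcount
  obtain ⟨r, hr1, hr2, hr3⟩ := asgn A L w CI CK h1 h2
  have hrne : jn r ≠ [] := by
    cases r with
    | nil => simp [hL] at hr1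
    | cons p r => simp [jn]
  have hcyc : (cyc (jn r)).Perm (L.flatMap (fun c => os c.1 c.2) ++ joints r w) := by
    have e : cyc (jn r) = os (jn r) w := by
      have h3 : hd (jn r) w = w := by rw [hd_jn, hr1]; rfl
      cases hj : jn r with
      | nil => exact absurd hj hrne
      | cons a q => rw [cyc_cons]; rw [hj] at h3; rw [← h3]; rfl
    rw [e, ← hr1]; exact os_jn r w
  have hfull : Full (jn r) := by
    refine ⟨?_, ?_, ?_⟩
    · rw [jn_fst, hr1]; exact hnd
    · intro v; rw [jn_fst, hr1]; exact hall v
    · rw [(jn_snd r).nodup_iff, hr1]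
      refine (List.Perm.append_left _ hr2).nodup_iff.2 hcnd
  have hjt : (joints r w).map (styp A) = jt (L.map (ends A)) (decide (w ∈ A)) := by
    rw [joints_typ, hr1]
  -- ends of joints
  have hjends : ∀ s ∈ joints r w, s.1 ∈ A ∪ B ∧ s.2.2 ∈ A ∪ B := by
    have gen : ∀ (r : List (Core V Γ × Γ)) (w : V), w ∈ A ∪ B →
        (∀ c ∈ r.map Prod.fst, ch c ∈ A ∪ B ∧ c.2 ∈ A ∪ B) →
        ∀ s ∈ joints r w, s.1 ∈ A ∪ B ∧ s.2.2 ∈ A ∪ B := by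
      intro r w hw
      induction r with
      | nil => intro _ s hs; simp [joints] at hs
      | cons p r ih =>
        intro hc s hs
        simp only [joints, List.mem_cons] at hs
        rcases hs with rfl | hs
        · refine ⟨(hc p.1 (by simp)).2, ?_⟩
          show hdc (r.map Prod.fst) w ∈ A ∪ B
          cases r with
          | nil => exact hw
          | cons q r => exact (hc q.1 (by simp)).1
        · exact ih (fun c hcc => hc c (by simp only [List.map_cons, List.mem_cons]; right; exact hcc)) s hs
    apply gen r w (hends c0 (by simp [hL])).1
    rw [hr1]; exact hends
  let kc : Bool × Bool → Cls V Γ := fun p =>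
    (if p.1 then A else B, if p.1 = p.2 then K else I, if p.2 then A else B)
  have hinC : ∀ s ∈ joints r w, inC (kc (styp A s)) s := by
    intro s hs
    obtain ⟨e1, e2⟩ := hjends s hs
    obtain ⟨e3, e4⟩ := hr3 s hs
    refine ⟨?_, ?_, ?_⟩
    · simp only [kc, styp]
      by_cases ha : s.1 ∈ A <;> simp [ha]
      simpa [ha] using e1
    · simp only [kc]
      by_cases hc : (styp A s).1 = (styp A s).2
      · rw [if_pos hc]; exact hCK _ (e4 hc)
      · rw [if_neg hc]; exact hCI _ (e3 hc)
    · simp only [kc, styp]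
      by_cases ha : s.2.2 ∈ A <;> simp [ha]
      simpa [ha] using e2
  have hdAB : ∀ v, v ∈ A → v ∈ B → False := fun v ha hb => Finset.disjoint_left.1 h.dAB ha hb
  have hdIK : ∀ v, v ∈ I → v ∈ K → False := fun v ha hb => Finset.disjoint_left.1 h.dIK ha hb
  refine completion (G := G) (D := D) (Set.range kc) ?_ ?_ N hN _ (jn r) hfull rfl ?_
  · rintro κ ⟨⟨a, b⟩, rfl⟩
    cases a <;> cases b
    · exact h.nBB
    · exact h.nBA
    · exact h.nAB
    · exact h.nAA
  · rintro κ ⟨⟨a, b⟩, rfl⟩ κ' ⟨⟨a', b'⟩, rfl⟩ s ⟨q1, q2, q3⟩ ⟨q1', q2', q3'⟩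
    have ea : a = a' := by
      cases a <;> cases a' <;> simp [kc] at q1 q1' ⊢
      · exact hdAB _ q1' q1
      · exact hdAB _ q1 q1'
    have eb : b = b' := by
      cases b <;> cases b' <;> simp [kc] at q3 q3' ⊢
      · exact hdAB _ q3' q3
      · exact hdAB _ q3 q3'
    rw [ea, eb]
  · intro s hs hg
    have hsj : s ∈ joints r w := by
      rw [hcyc.mem_iff, List.mem_append] at hs
      rcases hs with hs | hs
      · obtain ⟨c, hc, hsc⟩ := List.mem_flatMap.1 hs
        exact absurd (hgood c hc s hsc) hg
      · exact hs
    refine ⟨kc (styp A s), ⟨_, rfl⟩, hinC s hsj, ?_⟩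
    have hp : styp A s ∈ jt (L.map (ends A)) (decide (w ∈ A)) := by
      rw [← hjt]; exact List.mem_map_of_mem hsj
    refine (hcount _ hp).trans ?_
    rw [← hjt, hcyc.countP_eq, List.countP_append, List.count, List.countP_map]
    refine le_trans ?_ (Nat.le_add_left _ _)
    apply List.countP_mono_left
    intro u hu hue
    simp only [Function.comp, beq_iff_eq] at hue
    rw [← hue]
    simpa using hinC u hu

end Assembly
end TH

open SimpleGraph
set_option linter.unusedSectionVars false
set_option linter.unusedVariables false
namespace TH
open scoped Classical

section Tasks
variable {V Γ : Type}

/-- things to be covered by cores -/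
inductive Task (V Γ : Type) where
  | vert (x : V) (a b : Bool) : Task V Γ
  | edge (x : V) (γ : Γ) (y : V) (a b : Bool) : Task V Γ
  | colr (γ : Γ) (a b : Bool) : Task V Γ

/-- reserved vertices -/
def Task.rv : Task V Γ → List V
  | .vert x _ _ => [x]
  | .edge x _ y _ _ => [x, y]
  | .colr _ _ _ => []
/-- reserved colours -/
def Task.rc : Task V Γ → List Γ
  | .vert _ _ _ => []
  | .edge _ γ _ _ _ => [γ]
  | .colr γ _ _ => [γ]
/-- sides of the ends -/
def Task.sds : Task V Γ → Bool × Bool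
  | .vert _ a b => (a, b)
  | .edge _ _ _ a b => (a, b)
  | .colr _ a b => (a, b)

/-- side set -/
def sd (A B : Finset V) (a : Bool) : Finset V := if a then A else B

/-- `c` performs the task -/
def Task.ok (G : Γ → SimpleGraph V) (A B : Finset V) (C : Finset Γ) : Task V Γ → Core V Γ → Prop
  | .vert x a b, c => ∃ z γ1 γ2 z', c = ([(z, γ1), (x, γ2)], z') ∧ z ∈ sd A B a ∧ z' ∈ sd A B b ∧
      γ1 ∈ C ∧ γ2 ∈ C ∧ (G γ1).Adj z x ∧ (G γ2).Adj x z'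
  | .edge x γ y a b, c => ∃ z γ1 γ2 z', c = ([(z, γ1), (x, γ), (y, γ2)], z') ∧ z ∈ sd A B a ∧
      z' ∈ sd A B b ∧ γ1 ∈ C ∧ γ2 ∈ C ∧ (G γ1).Adj z x ∧ (G γ).Adj x y ∧ (G γ2).Adj y z'
  | .colr γ a b, c => ∃ z z', c = ([(z, γ)], z') ∧ z ∈ sd A B a ∧ z' ∈ sd A B b ∧ (G γ).Adj z z'

noncomputable def lk (G : Γ → SimpleGraph V) (C : Finset Γ) (x : V) (Z : Finset V) : ℕ :=
  ((Z ×ˢ C).filter (fun p => (G p.2).Adj x p.1)).card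

/-- task feasible with abundance `l` -/
def Task.feas (G : Γ → SimpleGraph V) (A B : Finset V) (C : Finset Γ) (l : ℝ) : Task V Γ → Prop
  | .vert x a b => l ≤ lk G C x (sd A B a) ∧ l ≤ lk G C x (sd A B b)
  | .edge x γ y a b => (G γ).Adj x y ∧ l ≤ lk G C x (sd A B a) ∧ l ≤ lk G C y (sd A B b)
  | .colr γ a b => l ≤ ed G γ (sd A B a) (sd A B b)

variable [Fintype V] [Fintype Γ]

lemma fresh_lk {G : Γ → SimpleGraph V} {C : Finset Γ} {x : V} {Z : Finset V} (W : Finset V) (F : Finset Γ)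
    (h : W.card * Fintype.card Γ + F.card * Fintype.card V < lk G C x Z) :
    ∃ z ∈ Z, ∃ γ ∈ C, (G γ).Adj x z ∧ z ∉ W ∧ γ ∉ F := by
  by_contra hcon
  push Not at hcon
  have : (Z ×ˢ C).filter (fun p => (G p.2).Adj x p.1) ⊆ W ×ˢ Finset.univ ∪ Finset.univ ×ˢ F := by
    rintro ⟨z, γ⟩ hp
    simp only [Finset.mem_filter, Finset.mem_product] at hp
    simp only [Finset.mem_union, Finset.mem_product, Finset.mem_univ, and_true, true_and]
    by_cases hz : z ∈ W
    · exact Or.inl hz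
    · exact Or.inr (hcon z hp.1.1 γ hp.1.2 hp.2 hz)
  have h2 := (Finset.card_le_card this).trans (Finset.card_union_le _ _)
  rw [Finset.card_product, Finset.card_product, Finset.card_univ, Finset.card_univ] at h2
  rw [lk] at h
  nlinarith

lemma fresh_ed {G : Γ → SimpleGraph V} {γ : Γ} {Y Z : Finset V} (W W' : Finset V)
    (h : (W.card + W'.card) * Fintype.card V < ed G γ Y Z) :
    ∃ y ∈ Y, ∃ z ∈ Z, (G γ).Adj y z ∧ y ∉ W ∧ z ∉ W' := by
  by_contra hcon
  push Not at hcon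
  have : (Y ×ˢ Z).filter (fun p => (G γ).Adj p.1 p.2) ⊆ W ×ˢ Finset.univ ∪ Finset.univ ×ˢ W' := by
    rintro ⟨y, z⟩ hp
    simp only [Finset.mem_filter, Finset.mem_product] at hp
    simp only [Finset.mem_union, Finset.mem_product, Finset.mem_univ, and_true, true_and]
    by_cases hz : y ∈ W
    · exact Or.inl hz
    · exact Or.inr (hcon y hp.1.1 z hp.1.2 hp.2 hz)
  have h2 := (Finset.card_le_card this).trans (Finset.card_union_le _ _)
  rw [Finset.card_product, Finset.card_product, Finset.card_univ] at h2
  rw [ed] at h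
  nlinarith

lemma card_ins (x : V) (W : Finset V) {s : ℕ} (h : W.card ≤ s) : (insert x W).card ≤ s + 1 :=
  (Finset.card_insert_le _ _).trans (by omega)

lemma build_one {G : Γ → SimpleGraph V} {A B : Finset V} {C : Finset Γ} {l : ℝ} {n s : ℕ}
    (hV : Fintype.card V = n) (hΓ : Fintype.card Γ = n)
    (hl : (2 * (s + 5) * n : ℝ) < l) (τ : Task V Γ) (hf : τ.feas G A B C l)
    (W : Finset V) (F : Finset Γ) (hW : W.card ≤ s) (hF : F.card ≤ s)
    (hWr : ∀ v ∈ τ.rv, v ∉ W) (hFr : ∀ γ ∈ τ.rc, γ ∉ F) :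
    ∃ c, τ.ok G A B C c ∧ (cv c).Nodup ∧ (cc c).Nodup ∧ (∀ v ∈ cv c, v ∉ W) ∧ (∀ γ ∈ cc c, γ ∉ F) := by
  have key : ∀ (m : ℕ) (W' : Finset V) (F' : Finset Γ), l ≤ m → W'.card ≤ s + 5 → F'.card ≤ s + 5 →
      W'.card * Fintype.card Γ + F'.card * Fintype.card V < m := by
    intro m W' F' h1 h2 h3
    have h4 : (W'.card * Fintype.card Γ + F'.card * Fintype.card V : ℕ) ≤ 2 * (s + 5) * n := by
      rw [hV, hΓ]; nlinarith
    have h5 : ((2 * (s + 5) * n : ℕ) : ℝ) < m := by push_cast; linarith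
    have h6 : 2 * (s + 5) * n < m := by exact_mod_cast h5
    omega
  cases τ with
  | vert x a b =>
    obtain ⟨f1, f2⟩ := hf
    have hx : x ∉ W := hWr x (by simp [Task.rv])
    obtain ⟨z, hz, γ1, hγ1, hadj1, hzW, hγF⟩ := fresh_lk (insert x W) F
      (key _ _ _ f1 ((card_ins x W hW).trans (by omega)) (by omega))
    obtain ⟨z', hz', γ2, hγ2, hadj2, hzW', hγF'⟩ := fresh_lk (insert z (insert x W)) (insert γ1 F)
      (key _ _ _ f2 ((card_ins z _ (card_ins x W hW)).trans (by omega))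
        ((Finset.card_insert_le _ _).trans (by omega)))
    simp only [Finset.mem_insert, not_or] at hzW hzW' hγF'
    refine ⟨([(z, γ1), (x, γ2)], z'), ⟨z, γ1, γ2, z', rfl, hz, hz', hγ1, hγ2, hadj1.symm, hadj2⟩, ?_, ?_, ?_, ?_⟩
    · simp only [cv, List.map_cons, List.map_nil, List.cons_append, List.nil_append, List.nodup_cons, List.mem_cons, List.not_mem_nil, or_false, not_or]
      exact ⟨⟨hzW.1, Ne.symm hzW'.1⟩, Ne.symm hzW'.2.1, not_false, List.nodup_nil⟩
    · simp only [cc, List.map_cons, List.map_nil, List.nodup_cons, List.mem_cons, List.not_mem_nil, or_false]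
      exact ⟨Ne.symm hγF'.1, not_false, List.nodup_nil⟩
    · simp only [cv, List.map_cons, List.map_nil, List.cons_append, List.nil_append, List.mem_cons, List.not_mem_nil, or_false]
      rintro v (rfl | rfl | rfl)
      · exact hzW.2
      · exact hx
      · exact hzW'.2.2
    · simp only [cc, List.map_cons, List.map_nil, List.mem_cons, List.not_mem_nil, or_false]
      rintro v (rfl | rfl)
      · exact hγF
      · exact hγF'.2
  | edge x γ y a b =>
    obtain ⟨f0, f1, f2⟩ := hf
    have hx : x ∉ W := hWr x (by simp [Task.rv])
    have hy : y ∉ W := hWr y (by simp [Task.rv])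
    have hγ : γ ∉ F := hFr γ (by simp [Task.rc])
    obtain ⟨z, hz, γ1, hγ1, hadj1, hzW, hγF⟩ := fresh_lk (insert y (insert x W)) (insert γ F)
      (key _ _ _ f1 ((card_ins y _ (card_ins x W hW)).trans (by omega)) ((Finset.card_insert_le _ _).trans (by omega)))
    obtain ⟨z', hz', γ2, hγ2, hadj2, hzW', hγF'⟩ := fresh_lk (insert z (insert y (insert x W))) (insert γ1 (insert γ F))
      (key _ _ _ f2 ((card_ins z _ (card_ins y _ (card_ins x W hW))).trans (by omega))
        (((Finset.card_insert_le _ _).trans (Nat.succ_le_succ (Finset.card_insert_le _ _))).trans (by omega)))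
    simp only [Finset.mem_insert, not_or] at hzW hzW' hγF hγF'
    refine ⟨([(z, γ1), (x, γ), (y, γ2)], z'), ⟨z, γ1, γ2, z', rfl, hz, hz', hγ1, hγ2, hadj1.symm, f0, hadj2⟩, ?_, ?_, ?_, ?_⟩
    · simp only [cv, List.map_cons, List.map_nil, List.cons_append, List.nil_append, List.nodup_cons, List.mem_cons, List.not_mem_nil, or_false, not_or]
      exact ⟨⟨hzW.2.1, hzW.1, Ne.symm hzW'.1⟩, ⟨f0.ne, Ne.symm hzW'.2.2.1⟩, Ne.symm hzW'.2.1, not_false, List.nodup_nil⟩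
    · simp only [cc, List.map_cons, List.map_nil, List.nodup_cons, List.mem_cons, List.not_mem_nil, or_false, not_or]
      exact ⟨⟨hγF.1, Ne.symm hγF'.1⟩, Ne.symm hγF'.2.1, not_false, List.nodup_nil⟩
    · simp only [cv, List.map_cons, List.map_nil, List.cons_append, List.nil_append, List.mem_cons, List.not_mem_nil, or_false]
      rintro v (rfl | rfl | rfl | rfl)
      · exact hzW.2.2
      · exact hx
      · exact hy
      · exact hzW'.2.2.2
    · simp only [cc, List.map_cons, List.map_nil, List.mem_cons, List.not_mem_nil, or_false]
      rintro v (rfl | rfl | rfl)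
      · exact hγF.2
      · exact hγ
      · exact hγF'.2.2
  | colr γ a b =>
    have hγ : γ ∉ F := hFr γ (by simp [Task.rc])
    have hlt : (W.card + W.card) * Fintype.card V < ed G γ (sd A B a) (sd A B b) := by
      have hf' : l ≤ (ed G γ (sd A B a) (sd A B b) : ℝ) := hf
      have h5 : ((2 * (s + 5) * n : ℕ) : ℝ) < (ed G γ (sd A B a) (sd A B b) : ℝ) := by
        push_cast; linarith
      have h6 : 2 * (s + 5) * n < ed G γ (sd A B a) (sd A B b) := by exact_mod_cast h5
      rw [hV]
      nlinarith
    obtain ⟨z, hz, z', hz', hadj, hzW, hzW'⟩ := fresh_ed W W hlt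
    refine ⟨([(z, γ)], z'), ⟨z, z', rfl, hz, hz', hadj⟩, ?_, ?_, ?_, ?_⟩
    · simp [cv, hadj.ne]
    · simp [cc]
    · simp only [cv, List.map_cons, List.map_nil, List.cons_append, List.nil_append, List.mem_cons, List.not_mem_nil, or_false]
      rintro v (rfl | rfl)
      · exact hzW
      · exact hzW'
    · simpa [cc] using hγ

lemma ok_props {G : Γ → SimpleGraph V} {A B : Finset V} {C : Finset Γ} {τ : Task V Γ} {c : Core V Γ}
    (h : τ.ok G A B C c) : (cv c).length ≤ 4 ∧ (cc c).length ≤ 3 ∧ (∀ v ∈ τ.rv, v ∈ cv c) ∧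
      (∀ γ ∈ τ.rc, γ ∈ cc c) ∧ (∀ γ ∈ cc c, γ ∈ τ.rc ∨ γ ∈ C) ∧ (∀ s ∈ os c.1 c.2, good G s) ∧
      ch c ∈ sd A B τ.sds.1 ∧ c.2 ∈ sd A B τ.sds.2 := by
  cases τ with
  | vert x a b =>
    obtain ⟨z, γ1, γ2, z', rfl, hz, hz', h1, h2, h3, h4⟩ := h
    simp [cv, cc, Task.rv, Task.rc, Task.sds, good, ch, hz, hz', h1, h2, h3, h4]
  | edge x γ y a b =>
    obtain ⟨z, γ1, γ2, z', rfl, hz, hz', h1, h2, h3, h5, h4⟩ := h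
    simp [cv, cc, Task.rv, Task.rc, Task.sds, good, ch, hz, hz', h1, h2, h3, h4, h5]
  | colr γ a b =>
    obtain ⟨z, z', rfl, hz, hz', h4⟩ := h
    simp [cv, cc, Task.rv, Task.rc, Task.sds, good, ch, hz, hz', h4]

lemma rv_len (τ : Task V Γ) : τ.rv.length ≤ 2 := by cases τ <;> simp [Task.rv]
lemma rc_len (τ : Task V Γ) : τ.rc.length ≤ 2 := by cases τ <;> simp [Task.rc]

lemma flat_len {α β : Type} (f : α → List β) (m : ℕ) (l : List α) (h : ∀ a ∈ l, (f a).length ≤ m) :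
    (l.flatMap f).length ≤ m * l.length := by
  induction l with
  | nil => simp
  | cons a l ih =>
    have h1 := ih (fun b hb => h b (by simp [hb]))
    have h2 := h a (by simp)
    simp only [List.flatMap_cons, List.length_append, List.length_cons]
    nlinarith

lemma greedy {G : Γ → SimpleGraph V} {A B : Finset V} {C : Finset Γ} {l : ℝ} {n s : ℕ}
    (hV : Fintype.card V = n) (hΓ : Fintype.card Γ = n)
    (hl : (2 * (s + 5) * n : ℝ) < l) (τs : List (Task V Γ)) : ∀ (W : Finset V) (F : Finset Γ),
    (∀ τ ∈ τs, τ.feas G A B C l) →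
    (τs.flatMap Task.rv).Nodup → (τs.flatMap Task.rc).Nodup →
    W.card + 4 * τs.length ≤ s → F.card + 4 * τs.length ≤ s →
    (∀ v ∈ τs.flatMap Task.rv, v ∉ W) → (∀ γ ∈ τs.flatMap Task.rc, γ ∉ F) →
    ∃ cs : List (Core V Γ), List.Forall₂ (fun τ c => τ.ok G A B C c) τs cs ∧
      (cs.flatMap cv).Nodup ∧ (cs.flatMap cc).Nodup ∧ (∀ v ∈ cs.flatMap cv, v ∉ W) ∧
      (∀ γ ∈ cs.flatMap cc, γ ∉ F) := by
  induction τs with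
  | nil => intro W F _ _ _ _ _ _ _; exact ⟨[], List.Forall₂.nil, by simp, by simp, by simp, by simp⟩
  | cons τ τs ih =>
    intro W F hf hrv hrc hW hF hWr hFr
    simp only [List.flatMap_cons, List.nodup_append] at hrv hrc
    simp only [List.length_cons] at hW hF
    have l1 : ((τs.flatMap Task.rv).toFinset).card ≤ 2 * τs.length :=
      (List.toFinset_card_le _).trans (flat_len _ _ _ (fun a _ => rv_len a))
    have l2 : ((τs.flatMap Task.rc).toFinset).card ≤ 2 * τs.length :=
      (List.toFinset_card_le _).trans (flat_len _ _ _ (fun a _ => rc_len a))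
    obtain ⟨c, hok, hc1, hc2, hc3, hc4⟩ := build_one hV hΓ hl τ (hf τ (by simp))
      (W ∪ (τs.flatMap Task.rv).toFinset) (F ∪ (τs.flatMap Task.rc).toFinset)
      ((Finset.card_union_le _ _).trans (by omega)) ((Finset.card_union_le _ _).trans (by omega))
      (by
        intro v hv
        rw [Finset.mem_union, List.mem_toFinset, not_or]
        refine ⟨hWr v ?_, fun hv' => hrv.2.2 v hv v hv' rfl⟩
        rw [List.flatMap_cons]; exact List.mem_append_left _ hv)
      (by
        intro v hv
        rw [Finset.mem_union, List.mem_toFinset, not_or]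
        refine ⟨hFr v ?_, fun hv' => hrc.2.2 v hv v hv' rfl⟩
        rw [List.flatMap_cons]; exact List.mem_append_left _ hv)
    obtain ⟨q1, q2, -⟩ := ok_props hok
    have l3 : ((cv c).toFinset).card ≤ 4 := (List.toFinset_card_le _).trans q1
    have l4 : ((cc c).toFinset).card ≤ 4 := (List.toFinset_card_le _).trans (by omega)
    obtain ⟨cs, h1, h2, h3, h4, h5⟩ := ih (W ∪ (cv c).toFinset) (F ∪ (cc c).toFinset)
      (fun τ hτ => hf τ (by simp [hτ])) hrv.2.1 hrc.2.1
      ((Nat.add_le_add_right (Finset.card_union_le _ _) _).trans (by omega))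
      ((Nat.add_le_add_right (Finset.card_union_le _ _) _).trans (by omega))
      (by
        intro v hv
        rw [Finset.mem_union, List.mem_toFinset, not_or]
        refine ⟨hWr v ?_, fun hv' => ?_⟩
        · rw [List.flatMap_cons]; exact List.mem_append_right _ hv
        · apply hc3 v hv'; rw [Finset.mem_union, List.mem_toFinset]; exact Or.inr hv)
      (by
        intro v hv
        rw [Finset.mem_union, List.mem_toFinset, not_or]
        refine ⟨hFr v ?_, fun hv' => ?_⟩
        · rw [List.flatMap_cons]; exact List.mem_append_right _ hv
        · apply hc4 v hv'; rw [Finset.mem_union, List.mem_toFinset]; exact Or.inr hv)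
    simp only [Finset.mem_union, List.mem_toFinset, not_or] at h4 h5 hc3 hc4
    refine ⟨c :: cs, List.Forall₂.cons hok h1, ?_, ?_, ?_, ?_⟩
    · rw [List.flatMap_cons, List.nodup_append]
      exact ⟨hc1, h2, fun a ha b hb hab => (h4 b hb).2 (hab ▸ ha)⟩
    · rw [List.flatMap_cons, List.nodup_append]
      exact ⟨hc2, h3, fun a ha b hb hab => (h5 b hb).2 (hab ▸ ha)⟩
    · intro v hv
      rw [List.flatMap_cons, List.mem_append] at hv
      rcases hv with hv | hv
      · exact (hc3 v hv).1
      · exact (h4 v hv).1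
    · intro v hv
      rw [List.flatMap_cons, List.mem_append] at hv
      rcases hv with hv | hv
      · exact (hc4 v hv).1
      · exact (h5 v hv).1

end Tasks
end TH

open SimpleGraph
set_option linter.unusedSectionVars false
set_option linter.unusedVariables false
namespace TH
open scoped Classical

section Asm
variable {V Γ : Type} [Fintype V] [Fintype Γ]

lemma cv_length (c : Core V Γ) : (cv c).length = (cc c).length + 1 := by simp [cv, cc]

lemma cv_flat_length (L : List (Core V Γ)) :
    (L.flatMap cv).length = (L.flatMap cc).length + L.length := by
  induction L with
  | nil => rfl
  | cons c L ih => simp only [List.flatMap_cons, List.length_append, List.length_cons, cv_length, ih]; omega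

lemma asm2 {G : Γ → SimpleGraph V} {D : ℝ} {A B : Finset V} {I K : Finset Γ}
    (h : Ctx G D A B I K) (N : ℕ) (hN : ∀ m : ℕ, N ≤ m + 1 → 6 * D < (m : ℝ) * m - m)
    (hVG : Fintype.card V = Fintype.card Γ)
    (L : List (Core V Γ)) (hnd : (L.flatMap cv).Nodup) (hall : ∀ v, v ∈ L.flatMap cv)
    (hcnd : (L.flatMap cc).Nodup)
    (P : Finset Γ) (hPI : P ⊆ I) (hPd : ∀ γ ∈ L.flatMap cc, γ ∉ P)
    (hK : ∀ γ, γ ∉ P → γ ∉ L.flatMap cc → γ ∈ K)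
    (hgood : ∀ c ∈ L, ∀ s ∈ os c.1 c.2, good G s)
    (hends : ∀ c ∈ L, ch c ∈ A ∪ B ∧ c.2 ∈ A ∪ B)
    (T : List (Bool × Bool)) (hT0 : T ≠ []) (hT : T.Perm (L.map (ends A)))
    (h1 : P.card = (jt T (hdT T true)).countP (fun p => p.1 ≠ p.2))
    (hcount : ∀ p ∈ jt T (hdT T true), N ≤ (jt T (hdT T true)).count p) : THC G := by
  have e := congrFun (congrFun (List.eq_map_comp_perm (ends A (Γ := Γ))) T) L
  have e2 := e.mpr hT
  obtain ⟨L', hL1, hL2⟩ := e2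
  cases L' with
  | nil => simp at hL1; exact absurd hL1 hT0
  | cons c0 L0 =>
    have pv : ((c0 :: L0).flatMap cv).Perm (L.flatMap cv) := hL2.flatMap_right _
    have pc : ((c0 :: L0).flatMap cc).Perm (L.flatMap cc) := hL2.flatMap_right _
    have hlen : (L.flatMap cc).length + L.length = Fintype.card Γ := by
      rw [← cv_flat_length, ← hVG, ← List.toFinset_card_of_nodup hnd, ← Finset.card_univ]
      congr 1
      ext v; simpa using hall v
    set CK := (Finset.univ.filter (fun γ => γ ∉ P ∧ γ ∉ L.flatMap cc)) with hCK
    have hdisj : Disjoint P (L.flatMap cc).toFinset := by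
      rw [Finset.disjoint_left]; intro γ h1 h2; exact hPd γ (List.mem_toFinset.1 h2) h1
    have hCKc : CK.card + (P.card + (L.flatMap cc).length) = Fintype.card Γ := by
      rw [← List.toFinset_card_of_nodup hcnd, ← Finset.card_union_of_disjoint hdisj]
      have : CK = (P ∪ (L.flatMap cc).toFinset)ᶜ := by ext γ; simp [hCK, not_or]
      rw [this, Finset.card_compl]
      have := Finset.card_le_univ (P ∪ (L.flatMap cc).toFinset)
      omega
    refine asm h N hN c0 L0 (pv.nodup_iff.2 hnd) (fun v => pv.mem_iff.2 (hall v)) P.toList CK.toList ?_ ?_ ?_ ?_ ?_ T hL1.symm ?_ ?_ hcount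
    · rw [List.nodup_append]
      refine ⟨pc.nodup_iff.2 hcnd, ?_, ?_⟩
      · rw [List.nodup_append]
        refine ⟨P.nodup_toList, CK.nodup_toList, ?_⟩
        intro a ha b hb hab
        subst hab
        rw [Finset.mem_toList] at ha hb
        exact ((Finset.mem_filter.1 hb).2.1) ha
      · intro a ha b hb hab
        subst hab
        have ha := pc.mem_iff.1 ha
        rw [List.mem_append, Finset.mem_toList, Finset.mem_toList] at hb
        rcases hb with hb | hb
        · exact hPd a ha hb
        · exact ((Finset.mem_filter.1 hb).2.2) ha
    · intro γ hγ; exact hPI (Finset.mem_toList.1 hγ)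
    · intro γ hγ
      have := Finset.mem_filter.1 (Finset.mem_toList.1 hγ)
      exact hK γ this.2.1 this.2.2
    · intro c hc; exact hgood c (hL2.mem_iff.1 hc)
    · intro c hc; exact hends c (hL2.mem_iff.1 hc)
    · rw [Finset.length_toList]; exact h1
    · rw [Finset.length_toList]
      have q1 : (jt T (hdT T true)).length = L.length := by
        rw [jt_length, hT.length_eq, List.length_map]
      have q2 := List.length_eq_countP_add_countP (fun p : Bool × Bool => decide (p.1 = p.2)) (l := jt T (hdT T true))
      have q3 : List.countP (fun a => decide ¬decide (a.1 = a.2) = true) (jt T (hdT T true)) = (jt T (hdT T true)).countP (fun p => p.1 ≠ p.2) := by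
        congr 1; funext a; simp
      rw [q3] at q2
      omega

/-- all the data about the cores produced from tasks -/
lemma tasks_cores {G : Γ → SimpleGraph V} {A B : Finset V} {C : Finset Γ} {l : ℝ} {n s : ℕ}
    (hAB : Disjoint A B)
    (hV : Fintype.card V = n) (hΓ : Fintype.card Γ = n)
    (hl : (2 * (s + 5) * n : ℝ) < l) (τs : List (Task V Γ))
    (hf : ∀ τ ∈ τs, τ.feas G A B C l)
    (hrv : (τs.flatMap Task.rv).Nodup) (hrc : (τs.flatMap Task.rc).Nodup)
    (hs : 4 * τs.length ≤ s) (hcov : ∀ v, v ∉ A → v ∉ B → v ∈ τs.flatMap Task.rv) :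
    ∃ (cs : List (Core V Γ)) (SA SB : Finset V), 
      List.Forall₂ (fun τ c => τ.ok G A B C c) τs cs ∧ SA ⊆ A ∧ SB ⊆ B ∧
      A.card ≤ SA.card + 4 * τs.length ∧ B.card ≤ SB.card + 4 * τs.length ∧
      ∃ L : List (Core V Γ), L = cs ++ (SA.toList.map (fun a => (([] : List (V × Γ)), a)) ++ SB.toList.map (fun a => ([], a))) ∧
      (L.flatMap cv).Nodup ∧ (∀ v, v ∈ L.flatMap cv) ∧ (L.flatMap cc).Nodup ∧
      L.flatMap cv = cs.flatMap cv ++ (SA.toList ++ SB.toList) ∧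
      (∀ γ ∈ L.flatMap cc, γ ∈ τs.flatMap Task.rc ∨ γ ∈ C) ∧
      (∀ γ ∈ τs.flatMap Task.rc, γ ∈ L.flatMap cc) ∧
      (∀ c ∈ L, ∀ s ∈ os c.1 c.2, good G s) ∧
      (∀ c ∈ L, ch c ∈ A ∪ B ∧ c.2 ∈ A ∪ B) ∧
      L.map (ends A) = τs.map Task.sds ++ (List.replicate SA.card (true, true) ++ List.replicate SB.card (false, false)) := by
  obtain ⟨cs, h1, h2, h3, -, -⟩ := greedy (G := G) (A := A) (B := B) (C := C) hV hΓ hl τs ∅ ∅ hf hrv hrc (by simpa using hs) (by simpa using hs) (by simp) (by simp)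
  have hlen := h1.length_eq
  have hdAB : ∀ v, v ∈ A → v ∈ B → False := fun v ha hb => Finset.disjoint_left.1 hAB ha hb
  have all : ∀ c ∈ cs, ∃ τ ∈ τs, τ.ok G A B C c := by
    clear hlen h2 h3 hcov hs hrc hrv hf
    induction h1 with
    | nil => simp
    | cons hab _ ih =>
      intro c hc
      rcases List.mem_cons.1 hc with rfl | hc
      · exact ⟨_, by simp, hab⟩
      · obtain ⟨τ, q1, q2⟩ := ih c hc
        exact ⟨τ, by simp [q1], q2⟩
  have all' : ∀ τ ∈ τs, ∃ c ∈ cs, τ.ok G A B C c := by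
    clear hlen h2 h3 hcov hs hrc hrv hf all
    induction h1 with
    | nil => simp
    | cons hab _ ih =>
      intro c hc
      rcases List.mem_cons.1 hc with rfl | hc
      · exact ⟨_, by simp, hab⟩
      · obtain ⟨τ, q1, q2⟩ := ih c hc
        exact ⟨τ, by simp [q1], q2⟩
  have hUl : (cs.flatMap cv).toFinset.card ≤ 4 * τs.length := by
    refine (List.toFinset_card_le _).trans ?_
    rw [hlen]
    apply flat_len
    intro c hc
    obtain ⟨τ, _, q⟩ := all c hc
    exact (ok_props q).1
  set U := (cs.flatMap cv).toFinset with hU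
  have sub1 : ∀ v, v ∈ U → v ∈ cs.flatMap cv := fun v hv => List.mem_toFinset.1 hv
  have sub2 : ∀ v, v ∈ cs.flatMap cv → v ∈ U := fun v hv => List.mem_toFinset.2 hv
  have cardb : ∀ X : Finset V, X.card ≤ (X \ U).card + 4 * τs.length := by
    intro X
    have := Finset.le_card_sdiff U X
    omega
  have fA : ∀ S : Finset V, (S.toList.map (fun a => (([] : List (V × Γ)), a))).flatMap cv = S.toList := by
    intro S
    generalize S.toList = l
    induction l with
    | nil => rfl
    | cons a l ih => simp only [List.map_cons, List.flatMap_cons, ih]; rfl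
  have fA' : ∀ S : Finset V, (S.toList.map (fun a => (([] : List (V × Γ)), a))).flatMap cc = [] := by
    intro S
    generalize S.toList = l
    induction l with
    | nil => rfl
    | cons a l ih => simp only [List.map_cons, List.flatMap_cons, ih]; rfl
  refine ⟨cs, A \ U, B \ U, h1, Finset.sdiff_subset, Finset.sdiff_subset, cardb A, cardb B, _, rfl, ?_⟩
  have ecv : ((cs ++ ((A \ U).toList.map (fun a => (([] : List (V × Γ)), a)) ++ (B \ U).toList.map (fun a => ([], a)))).flatMap cv) = cs.flatMap cv ++ ((A \ U).toList ++ (B \ U).toList) := by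
    rw [List.flatMap_append, List.flatMap_append, fA, fA]
  have ecc : ((cs ++ ((A \ U).toList.map (fun a => (([] : List (V × Γ)), a)) ++ (B \ U).toList.map (fun a => ([], a)))).flatMap cc) = cs.flatMap cc := by
    rw [List.flatMap_append, List.flatMap_append, fA', fA']; simp
  rw [ecv, ecc]
  refine ⟨?_, ?_, h3, rfl, ?_, ?_, ?_, ?_, ?_⟩
  · rw [List.nodup_append, List.nodup_append]
    refine ⟨h2, ⟨Finset.nodup_toList _, Finset.nodup_toList _, ?_⟩, ?_⟩
    · intro a ha b hb hab
      subst hab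
      simp only [Finset.mem_toList, Finset.mem_sdiff] at ha hb
      exact hdAB a ha.1 hb.1
    · intro a ha b hb hab
      subst hab
      simp only [List.mem_append, Finset.mem_toList, Finset.mem_sdiff] at hb
      rcases hb with hb | hb <;> exact hb.2 (sub2 a ha)
  · intro v
    simp only [List.mem_append, Finset.mem_toList, Finset.mem_sdiff]
    by_cases hv : v ∈ cs.flatMap cv
    · exact Or.inl hv
    · right
      have hvU : v ∉ U := fun hh => hv (sub1 v hh)
      by_cases ha : v ∈ A
      · exact Or.inl ⟨ha, hvU⟩
      by_cases hb : v ∈ B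
      · exact Or.inr ⟨hb, hvU⟩
      exfalso
      apply hv
      obtain ⟨τ, hτ, hvτ⟩ := List.mem_flatMap.1 (hcov v ha hb)
      obtain ⟨c, hc, q⟩ := all' τ hτ
      exact List.mem_flatMap.2 ⟨c, hc, (ok_props q).2.2.1 v hvτ⟩
  · intro γ hγ
    obtain ⟨c, hc, hγc⟩ := List.mem_flatMap.1 hγ
    obtain ⟨τ, hτ, q⟩ := all c hc
    rcases (ok_props q).2.2.2.2.1 γ hγc with h | h
    · exact Or.inl (List.mem_flatMap.2 ⟨τ, hτ, h⟩)
    · exact Or.inr h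
  · intro γ hγ
    obtain ⟨τ, hτ, hγτ⟩ := List.mem_flatMap.1 hγ
    obtain ⟨c, hc, q⟩ := all' τ hτ
    exact List.mem_flatMap.2 ⟨c, hc, (ok_props q).2.2.2.1 γ hγτ⟩
  · intro c hc
    rw [List.mem_append, List.mem_append, List.mem_map, List.mem_map] at hc
    rcases hc with hc | ⟨a, _, rfl⟩ | ⟨a, _, rfl⟩
    · obtain ⟨τ, hτ, q⟩ := all c hc
      exact (ok_props q).2.2.2.2.2.1
    · simp
    · simp
  · intro c hc
    rw [List.mem_append, List.mem_append, List.mem_map, List.mem_map] at hc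
    rcases hc with hc | ⟨a, ha, rfl⟩ | ⟨a, ha, rfl⟩
    · obtain ⟨τ, hτ, q⟩ := all c hc
      have q1 := (ok_props q).2.2.2.2.2.2
      have sdu : ∀ b v, v ∈ sd A B b → v ∈ A ∪ B := by
        intro b v hv; cases b <;> simp [sd] at hv <;> simp [hv]
      exact ⟨sdu _ _ q1.1, sdu _ _ q1.2⟩
    · simp only [Finset.mem_toList, Finset.mem_sdiff] at ha
      simp [ch, ha.1]
    · simp only [Finset.mem_toList, Finset.mem_sdiff] at ha
      simp [ch, ha.1]
  · rw [List.map_append, List.map_append]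
    congr 1
    · clear hlen h2 h3 hcov hs hrc hrv hf all all' hUl cardb ecv ecc sub1 sub2 hU 
      induction h1 with
      | nil => rfl
      | cons hab _ ih =>
        rw [List.map_cons, List.map_cons, ih]
        congr 1
        have q1 := (ok_props hab).2.2.2.2.2.2
        have sdu : ∀ b v, v ∈ sd A B b → decide (v ∈ A) = b := by
          intro b v hv; cases b <;> simp [sd] at hv <;> simp [hv]
          exact fun ha => hdAB v ha hv
        rw [ends, sdu _ _ q1.1, sdu _ _ q1.2]
    · congr 1
      · rw [List.map_map, List.eq_replicate_iff]
        simp only [List.length_map, Finset.length_toList, true_and, List.mem_map]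
        rintro p ⟨a, ha, rfl⟩
        simp only [Finset.mem_toList, Finset.mem_sdiff] at ha
        simp [ends, ch, ha.1]
      · rw [List.map_map, List.eq_replicate_iff]
        simp only [List.length_map, Finset.length_toList, true_and, List.mem_map]
        rintro p ⟨a, ha, rfl⟩
        simp only [Finset.mem_toList, Finset.mem_sdiff] at ha
        have : a ∉ A := fun h => hdAB a h ha.1
        simp [ends, ch, this]

end Asm
end TH

open SimpleGraph
set_option linter.unusedSectionVars false
set_option linter.unusedVariables false
namespace TH
open scoped Classical

section Types

/-- alternating pattern -/
def zg : ℕ → List (Bool × Bool)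
  | 0 => []
  | t + 1 => (true, true) :: (false, false) :: zg t
/-- crossing pattern -/
def zx : ℕ → List (Bool × Bool)
  | 0 => []
  | t + 1 => (true, false) :: (false, true) :: zx t

lemma hdT_nil (w : Bool) : hdT [] w = w := rfl
lemma hdT_cons (p : Bool × Bool) (r : List (Bool × Bool)) (w : Bool) : hdT (p :: r) w = p.1 := rfl
lemma hdT_zg (t : ℕ) : hdT (zg t) true = true := by cases t <;> rfl
lemma hdT_zx (t : ℕ) : hdT (zx t) true = true := by cases t <;> rfl
lemma hdT_rep (t : ℕ) (a b : Bool) : hdT (List.replicate t (a, b)) a = a := by cases t <;> rfl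

lemma count_zg (t : ℕ) (p : Bool × Bool) : (zg t).count p = if p.1 = p.2 then t else 0 := by
  induction t with
  | zero => simp [zg]
  | succ t ih =>
    rw [zg, List.count_cons, List.count_cons, ih]
    rcases p with ⟨a, b⟩
    cases a <;> cases b <;> simp

lemma count_zx (t : ℕ) (p : Bool × Bool) : (zx t).count p = if p.1 = p.2 then 0 else t := by
  induction t with
  | zero => simp [zx]
  | succ t ih =>
    rw [zx, List.count_cons, List.count_cons, ih]
    rcases p with ⟨a, b⟩
    cases a <;> cases b <;> simp

lemma jt_zg (t : ℕ) (p : Bool × Bool) : (jt (zg t) true).count p = if p.1 = p.2 then 0 else t := by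
  induction t with
  | zero => simp [zg, jt]
  | succ t ih =>
    simp only [zg, jt, hdT_cons, hdT_zg]
    rw [List.count_cons, List.count_cons, ih]
    rcases p with ⟨a, b⟩
    cases a <;> cases b <;> simp

lemma jt_zx (t : ℕ) (p : Bool × Bool) : (jt (zx t) true).count p = if p.1 = p.2 then t else 0 := by
  induction t with
  | zero => simp [zx, jt]
  | succ t ih =>
    simp only [zx, jt, hdT_cons, hdT_zx]
    rw [List.count_cons, List.count_cons, ih]
    rcases p with ⟨a, b⟩
    cases a <;> cases b <;> simp

lemma jt_rep (t : ℕ) (a : Bool) (b : Bool) : jt (List.replicate t (a, b)) a = List.replicate t (b, a) := by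
  induction t with
  | zero => rfl
  | succ t ih => simp only [List.replicate_succ, jt, hdT_rep, ih]

lemma countP_ne (l : List (Bool × Bool)) : l.countP (fun p => p.1 ≠ p.2) = l.count (true, false) + l.count (false, true) := by
  induction l with
  | nil => rfl
  | cons p l ih =>
    rw [List.countP_cons, List.count_cons, List.count_cons, ih]
    rcases p with ⟨a, b⟩
    cases a <;> cases b <;> simp <;> omega

/-- pattern for the clique-like regime -/
def patK (t s s' j : ℕ) : List (Bool × Bool) :=
  zg t ++ (List.replicate s (true, true) ++ ([(true, false)] ++ (List.replicate s' (false, false) ++ ([(false, true)] ++ zx j))))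

lemma patK_count (t s s' j : ℕ) (p : Bool × Bool) : (patK t s s' j).count p =
    match p with
    | (true, true) => t + s
    | (false, false) => t + s'
    | (true, false) => j + 1
    | (false, true) => j + 1 := by
  simp only [patK, List.count_append, count_zg, count_zx, List.count_replicate]
  rcases p with ⟨a, b⟩
  cases a <;> cases b <;> simp <;> omega

lemma patK_hd (t s s' j : ℕ) : hdT (patK t s s' j) true = true := by
  simp only [patK, hdT_append, hdT_cons]
  rw [hdT_rep, hdT_zg]

lemma patK_jt (t s s' j : ℕ) (p : Bool × Bool) : (jt (patK t s s' j) true).count p =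
    match p with
    | (true, true) => s + j + 1
    | (false, false) => s' + j + 1
    | (true, false) => t
    | (false, true) => t := by
  simp only [patK, jt_append, hdT_append, hdT_cons, hdT_rep, hdT_zx, hdT_zg, jt, hdT_nil, List.count_append, jt_zg, jt_zx, jt_rep, List.count_replicate]
  rcases p with ⟨a, b⟩
  cases a <;> cases b <;> simp <;> omega

/-- pattern for the bipartite-like regime -/
def patI (p m : ℕ) : List (Bool × Bool) := List.replicate p (true, false) ++ zg m

lemma patI_count (q m : ℕ) (p : Bool × Bool) : (patI q m).count p =
    match p with
    | (true, true) => m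
    | (false, false) => m
    | (true, false) => q
    | (false, true) => 0 := by
  simp only [patI, List.count_append, count_zg, List.count_replicate]
  rcases p with ⟨a, b⟩
  cases a <;> cases b <;> simp

lemma patI_hd (q m : ℕ) : hdT (patI q m) true = true := by
  simp only [patI, hdT_append, hdT_zg, hdT_rep]

lemma patI_jt (q m : ℕ) (p : Bool × Bool) : (jt (patI q m) true).count p =
    match p with
    | (true, true) => 0
    | (false, false) => 0
    | (true, false) => m
    | (false, true) => q + m := by
  simp only [patI, jt_append, hdT_zg, List.count_append, jt_zg, jt_rep, List.count_replicate]
  rcases p with ⟨a, b⟩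
  cases a <;> cases b <;> simp
end Types

section Master
variable {V Γ : Type} [Fintype V] [Fintype Γ]

theorem masterK {G : Γ → SimpleGraph V} {D : ℝ} {A B : Finset V} {I K : Finset Γ}
    (h : Ctx G D A B I K) (N : ℕ) (hN : ∀ m : ℕ, N ≤ m + 1 → 6 * D < (m : ℝ) * m - m)
    {l : ℝ} {n s : ℕ} (hV : Fintype.card V = n) (hΓ : Fintype.card Γ = n)
    (hl : (2 * (s + 5) * n : ℝ) < l) (τs : List (Task V Γ))
    (hf : ∀ τ ∈ τs, τ.feas G A B K l)
    (hrv : (τs.flatMap Task.rv).Nodup) (hrc : (τs.flatMap Task.rc).Nodup)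
    (hs : 4 * τs.length ≤ s) (hcov : ∀ v, v ∉ A → v ∉ B → v ∈ τs.flatMap Task.rv)
    (P : Finset Γ) (t : ℕ) (hPI : P ⊆ I) (hPt : P.card = 2 * t) (ht : t = 0 ∨ N ≤ t)
    (hPr : ∀ γ ∈ τs.flatMap Task.rc, γ ∉ P) (hcovc : ∀ γ, γ ∉ P → γ ∉ K → γ ∈ τs.flatMap Task.rc)
    (hA : N + t + 4 * τs.length ≤ A.card) (hB : N + t + 4 * τs.length ≤ B.card)
    (hx : (τs.map Task.sds).count (true, false) = (τs.map Task.sds).count (false, true))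
    (hx0 : 0 < (τs.map Task.sds).count (true, false)) : THC G := by
  obtain ⟨cs, SA, SB, h1, hSA, hSB, cA, cB, L, hL, g1, g2, g3, g4, g5, g6, g7, g8, g9⟩ :=
    tasks_cores h.dAB hV hΓ hl τs hf hrv hrc hs hcov
  obtain ⟨j, hj⟩ : ∃ j, (τs.map Task.sds).count (true, false) = j + 1 := ⟨_, (Nat.sub_add_cancel hx0).symm⟩
  set sA := (τs.map Task.sds).count (true, true) + SA.card - t
  set sB := (τs.map Task.sds).count (false, false) + SB.card - t
  refine asm2 h N hN (hV.trans hΓ.symm) L g1 g2 g3 P hPI ?_ ?_ g7 g8 (patK t sA sB j) ?_ ?_ ?_ ?_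
  · intro γ hγ hP
    rcases g5 γ hγ with h' | h'
    · exact hPr γ h' hP
    · exact Finset.disjoint_left.1 h.dIK (hPI hP) h'
  · intro γ hP hγ
    by_contra hK
    exact hγ (g6 γ (hcovc γ hP hK))
  · intro h0
    have := congrArg (List.count (true, false)) h0
    rw [patK_count] at this
    simp at this
  · rw [List.perm_iff_count]
    intro p
    rw [patK_count, g9, List.count_append, List.count_append, List.count_replicate, List.count_replicate]
    rcases p with ⟨a, b⟩
    cases a <;> cases b <;> simp <;> omega
  · rw [patK_hd, countP_ne, patK_jt, patK_jt, hPt]; simp; omega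
  · rw [patK_hd]
    intro p hp
    have := List.count_pos_iff.2 hp
    rw [patK_jt] at this ⊢
    rcases p with ⟨a, b⟩
    cases a <;> cases b <;> simp at this ⊢ <;> omega

/-- contribution of a side pair -/
def hs : Bool × Bool → ℤ
  | (true, true) => 1
  | (false, false) => -1
  | _ => 0

lemma hs_sum1 (w : V → ℤ) (τs : List (Task V Γ)) :
    (τs.map (fun τ => (τ.rv.map w).sum + 2 * hs τ.sds)).sum = (τs.map (fun τ => (τ.rv.map w).sum + hs τ.sds)).sum + (τs.map (fun τ => hs τ.sds)).sum := by
  induction τs with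
  | nil => rfl
  | cons τ τs ih => simp only [List.map_cons, List.sum_cons, ih]; ring

lemma hs_sum2 (τs : List (Task V Γ)) : (τs.map (fun τ => hs τ.sds)).sum = ((τs.map Task.sds).count (true, true) : ℤ) - (τs.map Task.sds).count (false, false) := by
  induction τs with
  | nil => rfl
  | cons τ τs ih =>
    simp only [List.map_cons, List.sum_cons, ih, List.count_cons]
    rcases τ.sds with ⟨a, b⟩
    cases a <;> cases b <;> simp [hs] <;> ring

theorem masterI {G : Γ → SimpleGraph V} {D : ℝ} {A B : Finset V} {I K : Finset Γ}
    (h : Ctx G D A B I K) (N : ℕ) (hN : ∀ m : ℕ, N ≤ m + 1 → 6 * D < (m : ℝ) * m - m)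
    {l : ℝ} {n s : ℕ} (hV : Fintype.card V = n) (hΓ : Fintype.card Γ = n)
    (hl : (2 * (s + 5) * n : ℝ) < l) (τs : List (Task V Γ))
    (hf : ∀ τ ∈ τs, τ.feas G A B I l)
    (hrv : (τs.flatMap Task.rv).Nodup) (hrc : (τs.flatMap Task.rc).Nodup)
    (hs1 : 4 * τs.length ≤ s) (hcov : ∀ v, v ∉ A → v ∉ B → v ∈ τs.flatMap Task.rv)
    (hcovc : ∀ γ, γ ∉ I → γ ∈ τs.flatMap Task.rc)
    (hA : N + 4 * τs.length + 1 ≤ A.card) (hB : N + 4 * τs.length + 1 ≤ B.card)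
    (hx : (τs.map Task.sds).count (false, true) = 0)
    (w : V → ℤ) (hwA : ∀ v ∈ A, w v = 1) (hwB : ∀ v ∈ B, w v = -1)
    (hw : ∑ v, w v = (τs.map (fun τ => (τ.rv.map w).sum + hs τ.sds)).sum) : THC G := by
  obtain ⟨cs, SA, SB, h1, hSA, hSB, cA, cB, L, hL, g1, g2, g3, g4, g5, g6, g7, g8, g9⟩ :=
    tasks_cores h.dAB hV hΓ hl τs hf hrv hrc hs1 hcov
  have e1 : ∑ v, w v = ((L.flatMap cv).map w).sum := by
    rw [← List.sum_toFinset w g1]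
    congr 1
    ext v; simpa using g2 v
  have e2 : ((cs.flatMap cv).map w).sum = (τs.map (fun τ => (τ.rv.map w).sum + 2 * hs τ.sds)).sum := by
    clear e1 g9 g8 g7 g6 g5 g4 g3 g2 g1 hL L cA cB hw hx hA hB hcov hcovc hrv hrc hf hs1
    induction h1 with
    | nil => rfl
    | @cons τ c τs cs hab _ ih =>
      rw [List.flatMap_cons, List.map_append, List.sum_append, List.map_cons, List.sum_cons, ih]
      congr 1
      have key : ∀ a z, z ∈ sd A B a → w z = if a then 1 else -1 := by
        intro a z hz
        cases a
        · simp [sd] at hz; simp [hwB z hz]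
        · simp [sd] at hz; simp [hwA z hz]
      cases τ with
      | vert x a b =>
        obtain ⟨z, γ1, γ2, z', rfl, hz, hz', -⟩ := hab
        simp only [cv, Task.rv, Task.sds, List.map_cons, List.map_nil, List.cons_append, List.nil_append, List.sum_cons, List.sum_nil, key _ _ hz, key _ _ hz']
        cases a <;> cases b <;> simp [hs] <;> ring
      | edge x γ y a b =>
        obtain ⟨z, γ1, γ2, z', rfl, hz, hz', -⟩ := hab
        simp only [cv, Task.rv, Task.sds, List.map_cons, List.map_nil, List.cons_append, List.nil_append, List.sum_cons, List.sum_nil, key _ _ hz, key _ _ hz']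
        cases a <;> cases b <;> simp [hs] <;> ring
      | colr γ a b =>
        obtain ⟨z, z', rfl, hz, hz', -⟩ := hab
        simp only [cv, Task.rv, Task.sds, List.map_cons, List.map_nil, List.cons_append, List.nil_append, List.sum_cons, List.sum_nil, key _ _ hz, key _ _ hz']
        cases a <;> cases b <;> simp [hs]
  have e3 : (SA.toList.map w).sum = SA.card := by
    rw [Finset.sum_map_toList, Finset.sum_congr rfl (fun v hv => hwA v (hSA hv))]; simp
  have e4 : (SB.toList.map w).sum = -SB.card := by
    rw [Finset.sum_map_toList, Finset.sum_congr rfl (fun v hv => hwB v (hSB hv))]; simp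
  have e5 : (τs.map (fun τ => (τ.rv.map w).sum + 2 * hs τ.sds)).sum = (τs.map (fun τ => (τ.rv.map w).sum + hs τ.sds)).sum + (τs.map (fun τ => hs τ.sds)).sum := by
    exact hs_sum1 w τs
  have e6 : (τs.map (fun τ => hs τ.sds)).sum = ((τs.map Task.sds).count (true, true) : ℤ) - (τs.map Task.sds).count (false, false) := by
    exact hs_sum2 τs
  rw [e1, g4, List.map_append, List.sum_append, List.map_append, List.sum_append, e2, e3, e4, e5, e6] at hw
  have e7 : (τs.map Task.sds).count (true, true) + SA.card = (τs.map Task.sds).count (false, false) + SB.card := by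
    omega
  set P : Finset Γ := Finset.univ.filter (fun γ => γ ∉ L.flatMap cc) with hP
  have hPI : P ⊆ I := by
    intro γ hγ
    by_contra hI
    exact (Finset.mem_filter.1 hγ).2 (g6 γ (hcovc γ hI))
  have hPc : P.card = L.length := by
    have hlen : (L.flatMap cc).length + L.length = Fintype.card Γ := by
      rw [← cv_flat_length, hΓ, ← hV, ← List.toFinset_card_of_nodup g1, ← Finset.card_univ]
      congr 1
      ext v; simpa using g2 v
    have : P = ((L.flatMap cc).toFinset)ᶜ := by ext γ; simp [hP]
    rw [this, Finset.card_compl, List.toFinset_card_of_nodup g3]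
    omega
  set m := (τs.map Task.sds).count (true, true) + SA.card
  set q := (τs.map Task.sds).count (true, false)
  have hperm : (patI q m).Perm (L.map (ends A)) := by
    rw [List.perm_iff_count]
    intro p
    rw [patI_count, g9, List.count_append, List.count_append, List.count_replicate, List.count_replicate]
    rcases p with ⟨a, b⟩
    cases a <;> cases b <;> simp [m, q] <;> omega
  have zgl : ∀ m, (zg m).length = 2 * m := by
    intro m
    induction m with
    | zero => rfl
    | succ m ih => simp [zg, ih]; ring
  refine asm2 h N hN (hV.trans hΓ.symm) L g1 g2 g3 P hPI ?_ ?_ g7 g8 (patI q m) ?_ hperm ?_ ?_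
  · intro γ hγ hP'
    exact (Finset.mem_filter.1 hP').2 hγ
  · intro γ hP' hγ
    exact absurd (show γ ∈ P from Finset.mem_filter.2 ⟨Finset.mem_univ γ, hγ⟩) hP'
  · intro h0
    have := congrArg (List.count (true, true)) h0
    rw [patI_count] at this
    simp at this
    omega
  · rw [patI_hd, countP_ne, patI_jt, patI_jt, hPc]
    have := hperm.length_eq
    rw [List.length_map, patI, List.length_append, List.length_replicate, zgl] at this
    simp; omega
  · rw [patI_hd]
    intro p hp
    have := List.count_pos_iff.2 hp
    rw [patI_jt] at this ⊢
    rcases p with ⟨a, b⟩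
    cases a <;> cases b <;> simp at this ⊢ <;> omega
end Master
end TH

open SimpleGraph
set_option linter.unusedSectionVars false
set_option linter.unusedVariables false
namespace TH
open scoped Classical

section Setup
variable {V Γ : Type} [Fintype V] [Fintype Γ]

/-- missing links -/
noncomputable def mk (G : Γ → SimpleGraph V) (C : Finset Γ) (x : V) (Z : Finset V) : ℕ :=
  ((Z ×ˢ C).filter (fun p => ¬ (G p.2).Adj x p.1)).card

lemma lk_add_mk (G : Γ → SimpleGraph V) (C : Finset Γ) (x : V) (Z : Finset V) :
    lk G C x Z + mk G C x Z = Z.card * C.card := by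
  rw [lk, mk, Finset.card_filter_add_card_filter_not, Finset.card_product]

lemma mk_eq_sum (G : Γ → SimpleGraph V) (C : Finset Γ) (x : V) (Z : Finset V) :
    mk G C x Z = ∑ γ ∈ C, (Z.filter (fun z => ¬ (G γ).Adj x z)).card := by
  rw [mk, Finset.card_filter, Finset.sum_product_right]
  refine Finset.sum_congr rfl fun γ _ => ?_
  rw [Finset.card_filter]

lemma lk_eq_sum (G : Γ → SimpleGraph V) (C : Finset Γ) (x : V) (Z : Finset V) :
    lk G C x Z = ∑ γ ∈ C, (nb G γ x ∩ Z).card := by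
  rw [lk, Finset.card_filter, Finset.sum_product_right]
  refine Finset.sum_congr rfl fun γ _ => ?_
  rw [← Finset.card_filter]
  congr 1; ext z; simp [and_comm]

lemma mk_mono {G : Γ → SimpleGraph V} {C : Finset Γ} {x : V} {Z Z' : Finset V} (h : Z ⊆ Z') :
    mk G C x Z ≤ mk G C x Z' :=
  Finset.card_le_card (Finset.filter_subset_filter _ (Finset.product_subset_product h (Finset.Subset.refl _)))

lemma ms_eq_sum (G : Γ → SimpleGraph V) (γ : Γ) (X Y : Finset V) :
    ms G γ X Y = ∑ x ∈ X, (Y.filter (fun z => ¬ (G γ).Adj x z)).card := by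
  rw [ms, Finset.card_filter, Finset.sum_product]
  refine Finset.sum_congr rfl fun γ _ => ?_
  rw [Finset.card_filter]

lemma sum_mk (G : Γ → SimpleGraph V) (C : Finset Γ) (S Y : Finset V) :
    ∑ a ∈ S, mk G C a Y = ∑ γ ∈ C, ms G γ S Y := by
  simp only [mk_eq_sum, ms_eq_sum]
  exact Finset.sum_comm

lemma typ {G : Γ → SimpleGraph V} {I K : Finset Γ} {S Y Z : Finset V} {E d : ℝ} (hE : 0 ≤ E)
    (hIK : Disjoint I K) (bI : ∀ γ ∈ I, (ms G γ S Y : ℝ) ≤ E) (bK : ∀ γ ∈ K, (ms G γ S Z : ℝ) ≤ E) :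
    ((S.card : ℝ) - (S.filter (fun a => (mk G I a Y : ℝ) ≤ d ∧ (mk G K a Z : ℝ) ≤ d)).card) * d ≤
      Fintype.card Γ * E := by
  set T := S.filter (fun a => (mk G I a Y : ℝ) ≤ d ∧ (mk G K a Z : ℝ) ≤ d) with hT
  have h0 : ((S \ T).card : ℝ) = S.card - T.card := by
    rw [Finset.card_sdiff_of_subset (Finset.filter_subset _ _), Nat.cast_sub (Finset.card_le_card (Finset.filter_subset _ _))]
  rw [← h0]
  have h1 : ((S \ T).card : ℝ) * d ≤ ∑ a ∈ S \ T, ((mk G I a Y : ℝ) + mk G K a Z) := by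
    rw [← nsmul_eq_mul]
    apply Finset.card_nsmul_le_sum
    intro a ha
    simp only [hT, Finset.mem_sdiff, Finset.mem_filter, not_and, not_le] at ha
    by_cases hI : (mk G I a Y : ℝ) ≤ d
    · have := ha.2 ha.1 hI
      have : (0 : ℝ) ≤ mk G I a Y := by positivity
      linarith
    · have : (0 : ℝ) ≤ mk G K a Z := by positivity
      linarith
  have h2 : ∑ a ∈ S \ T, ((mk G I a Y : ℝ) + mk G K a Z) ≤ ∑ a ∈ S, ((mk G I a Y : ℝ) + mk G K a Z) :=
    Finset.sum_le_sum_of_subset_of_nonneg Finset.sdiff_subset (fun _ _ _ => by positivity)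
  have h3 : ∑ a ∈ S, ((mk G I a Y : ℝ) + mk G K a Z) = ∑ γ ∈ I, (ms G γ S Y : ℝ) + ∑ γ ∈ K, (ms G γ S Z : ℝ) := by
    rw [Finset.sum_add_distrib]
    have e1 := sum_mk G I S Y
    have e2 := sum_mk G K S Z
    congr 1
    · exact_mod_cast e1
    · exact_mod_cast e2
  have h4 : ∑ γ ∈ I, (ms G γ S Y : ℝ) ≤ I.card * E := by
    rw [← nsmul_eq_mul]; exact Finset.sum_le_card_nsmul _ _ _ bI
  have h5 : ∑ γ ∈ K, (ms G γ S Z : ℝ) ≤ K.card * E := by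
    rw [← nsmul_eq_mul]; exact Finset.sum_le_card_nsmul _ _ _ bK
  have h6 : (I.card : ℝ) + K.card ≤ Fintype.card Γ := by
    have := Finset.card_union_of_disjoint hIK
    have h7 := Finset.card_le_univ (I ∪ K)
    exact_mod_cast (by omega : I.card + K.card ≤ Fintype.card Γ)
  nlinarith

/-- the setting of the extremal case -/
structure Setup (G : Γ → SimpleGraph V) (k : ℕ) (δ : ℝ) (A B : Finset V) (I K : Finset Γ) : Prop where
  hyp : Hyp G k
  ctx : Ctx G (δ * (Fintype.card V : ℝ) ^ 2) A B I K
  cA : (1 / 2 - δ) * Fintype.card V ≤ A.card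
  cB : (1 / 2 - δ) * Fintype.card V ≤ B.card
  rest : (((I ∪ K)ᶜ.card : ℕ) : ℝ) ≤ δ * Fintype.card V

lemma Setup.swap {G : Γ → SimpleGraph V} {k : ℕ} {δ : ℝ} {A B : Finset V} {I K : Finset Γ}
    (h : Setup G k δ A B I K) : Setup G k δ B A I K := ⟨h.hyp, h.ctx.swap, h.cB, h.cA, h.rest⟩

lemma setup_exists {G : Γ → SimpleGraph V} {k : ℕ} (hy : Hyp G k) {δ : ℝ} (hδ : 0 < δ) (hδ1 : δ ≤ 1)
    {A : Finset V} {I K : Finset Γ} (h : ExtW G (δ ^ 2 / 8) A I K) :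
    ∃ A1 B1, Setup G k δ A1 B1 I K := by
  set n : ℝ := (Fintype.card V : ℝ) with hn
  have hΓ : (Fintype.card Γ : ℝ) = n := by rw [hn, hy.cV, hy.cG]
  have hn0 : 0 < n := by rw [hn, hy.cV]; positivity
  have hmI' : ∀ γ ∈ I, (ms G γ Aᶜ A : ℝ) ≤ δ ^ 2 / 8 * n ^ 2 := by
    intro γ hγ; rw [ms_comm]; exact h.mI γ hγ
  have tA := typ (d := δ * n ^ 2) (by positivity) h.dis h.mI h.mK
  have tB := typ (d := δ * n ^ 2) (by positivity) h.dis hmI' h.mK'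
  set A1 := A.filter (fun a => (mk G I a Aᶜ : ℝ) ≤ δ * n ^ 2 ∧ (mk G K a A : ℝ) ≤ δ * n ^ 2) with hA1
  set B1 := Aᶜ.filter (fun a => (mk G I a A : ℝ) ≤ δ * n ^ 2 ∧ (mk G K a Aᶜ : ℝ) ≤ δ * n ^ 2) with hB1
  have sA : A1 ⊆ A := Finset.filter_subset _ _
  have sB : B1 ⊆ Aᶜ := Finset.filter_subset _ _
  have cut : ∀ x : ℝ, x * (δ * n ^ 2) ≤ (Fintype.card Γ : ℝ) * (δ ^ 2 / 8 * n ^ 2) → x ≤ δ / 8 * n := by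
    intro x hx
    rw [hΓ] at hx
    have : 0 < δ * n ^ 2 := by positivity
    by_contra hc
    push Not at hc
    nlinarith
  have uA := cut _ tA
  have uB := cut _ tB
  have hc : (Aᶜ.card : ℝ) = n - A.card := by
    rw [Finset.card_compl, Nat.cast_sub (Finset.card_le_univ _)]
  have hle : ∀ (m : ℕ) , (m : ℝ) ≤ δ ^ 2 / 8 * n ^ 2 → (m : ℝ) ≤ δ * n ^ 2 := by
    intro m hm
    refine hm.trans ?_
    have : 0 < n ^ 2 := by positivity
    have : δ ^ 2 / 8 ≤ δ := by nlinarith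
    nlinarith
  have h1 := h.cA1
  have h2 := h.cA2
  rw [← hn] at h1 h2
  have hd2 : δ ^ 2 / 8 * n ≤ δ / 8 * n := by
    have : δ ^ 2 / 8 ≤ δ / 8 := by nlinarith
    nlinarith
  have hsy : ∀ (C : Finset Γ) (x : V) (Y : Finset V), (((Y ×ˢ C).filter (fun p => ¬ (G p.2).Adj p.1 x)).card) = mk G C x Y := by
    intro C x Y
    rw [mk]; congr 1; ext p; simp [SimpleGraph.adj_comm]
  have mle : ∀ (C : Finset Γ) (x : V) (Y Y' : Finset V), Y ⊆ Y' → (mk G C x Y' : ℝ) ≤ δ * n ^ 2 → (mk G C x Y : ℝ) ≤ δ * n ^ 2 := by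
    intro C x Y Y' hY h'
    exact le_trans (by exact_mod_cast mk_mono hY) h'
  have msle : ∀ γ (X X' Y Y' : Finset V), X ⊆ X' → Y ⊆ Y' → (ms G γ X' Y' : ℝ) ≤ δ ^ 2 / 8 * n ^ 2 → (ms G γ X Y : ℝ) ≤ δ * n ^ 2 := by
    intro γ X X' Y Y' hX hY hm
    exact hle _ (le_trans (by exact_mod_cast ms_mono hX hY) hm)
  refine ⟨A1, B1, hy, ⟨?_, h.dis, ?_, ?_, ?_, ?_⟩, ?_, ?_, ?_⟩
  · rw [Finset.disjoint_left]
    intro v ha hb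
    exact Finset.mem_compl.1 (sB hb) (sA ha)
  · refine ⟨fun c hc => msle c _ _ _ _ sA sA (h.mK c hc), fun y hy => ?_, fun x hx => ?_⟩
    · exact mle _ _ _ _ sA (Finset.mem_filter.1 hy).2.2
    · simp only [hsy]; exact mle _ _ _ _ sA (Finset.mem_filter.1 hx).2.2
  · refine ⟨fun c hc => msle c _ _ _ _ sB sB (h.mK' c hc), fun y hy => ?_, fun x hx => ?_⟩
    · exact mle _ _ _ _ sB (Finset.mem_filter.1 hy).2.2
    · simp only [hsy]; exact mle _ _ _ _ sB (Finset.mem_filter.1 hx).2.2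
  · refine ⟨fun c hc => msle c _ _ _ _ sA sB (h.mI c hc), fun y hy => ?_, fun x hx => ?_⟩
    · exact mle _ _ _ _ sB (Finset.mem_filter.1 hy).2.1
    · simp only [hsy]; exact mle _ _ _ _ sA (Finset.mem_filter.1 hx).2.1
  · refine ⟨fun c hc => msle c _ _ _ _ sB sA (hmI' c hc), fun y hy => ?_, fun x hx => ?_⟩
    · exact mle _ _ _ _ sA (Finset.mem_filter.1 hy).2.1
    · simp only [hsy]; exact mle _ _ _ _ sB (Finset.mem_filter.1 hx).2.1
  · rw [← hn]; nlinarith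
  · rw [← hn]; nlinarith
  · have := h.rest
    rw [← hn] at this ⊢
    nlinarith
end Setup
end TH

open SimpleGraph
set_option linter.unusedSectionVars false
set_option linter.unusedVariables false
namespace TH
open scoped Classical

section KReg
variable {V Γ : Type} [Fintype V] [Fintype Γ]

lemma flatMap_single {α β γ : Type} (f : α → β) (g : β → List γ) (h : α → γ) (l : List α) (hh : ∀ a ∈ l, g (f a) = [h a]) :
    (l.map f).flatMap g = l.map h := by
  induction l with
  | nil => rfl
  | cons a l ih =>
    rw [List.map_cons, List.flatMap_cons, ih (fun b hb => hh b (by simp [hb])), hh a (by simp)]; rfl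

lemma flatMap_none {α β γ : Type} (f : α → β) (g : β → List γ) (l : List α) (hh : ∀ a ∈ l, g (f a) = []) :
    (l.map f).flatMap g = [] := by
  induction l with
  | nil => rfl
  | cons a l ih =>
    rw [List.map_cons, List.flatMap_cons, ih (fun b hb => hh b (by simp [hb])), hh a (by simp)]; rfl

lemma count_none {α : Type} (f : α → Bool × Bool) (l : List α) (p : Bool × Bool) (hh : ∀ a ∈ l, f a ≠ p) :
    (l.map f).count p = 0 := by
  rw [List.count_eq_zero]
  intro h
  obtain ⟨a, ha, e⟩ := List.mem_map.1 h
  exact hh a ha e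

lemma K0 {G : Γ → SimpleGraph V} {k : ℕ} {δ : ℝ} {A B : Finset V} {I K : Finset Γ}
    (S : Setup G k δ A B I K) (N : ℕ)
    (hN : ∀ m : ℕ, N ≤ m + 1 → 6 * (δ * (Fintype.card V : ℝ) ^ 2) < (m : ℝ) * m - m)
    {l : ℝ} {s : ℕ} (hl : (2 * (s + 5) * (2 * k + 1 : ℕ) : ℝ) < l) (At : Finset V)
    (hAt : ∀ x ∈ At, l ≤ lk G K x A) (hBt : ∀ x, x ∉ At → l ≤ lk G K x B)
    (P : Finset Γ) (t : ℕ) (hPI : P ⊆ I) (hPt : P.card = 2 * t) (ht : t = 0 ∨ N ≤ t)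
    (items : List (Task V Γ)) (hf : ∀ τ ∈ items, τ.feas G A B K l)
    (hrv : (items.flatMap Task.rv).Nodup) (hrc : (items.flatMap Task.rc).Nodup)
    (hPr : ∀ γ ∈ items.flatMap Task.rc, γ ∉ P)
    (hcol : ∀ γ, γ ∉ K → γ ∉ P → γ ∉ items.flatMap Task.rc → l ≤ ed G γ A A ∨ l ≤ ed G γ B B)
    (hs : 4 * (items.length + ((A ∪ B)ᶜ).card + ((K ∪ P)ᶜ).card) ≤ s)
    (hA : N + t + s ≤ A.card) (hB : N + t + s ≤ B.card)
    (hx : (items.map Task.sds).count (true, false) = (items.map Task.sds).count (false, true))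
    (hx0 : 0 < (items.map Task.sds).count (true, false)) : THC G := by
  set XS := ((A ∪ B)ᶜ).filter (fun x => x ∉ items.flatMap Task.rv) with hXS
  set QS := (Finset.univ : Finset Γ).filter (fun γ => γ ∉ K ∧ γ ∉ P ∧ γ ∉ items.flatMap Task.rc) with hQS
  set f : V → Task V Γ := fun x => if x ∈ At then .vert x true true else .vert x false false with hf'
  set g : Γ → Task V Γ := fun γ => if l ≤ ed G γ A A then .colr γ true true else .colr γ false false with hg
  have e1 : (XS.toList.map f).flatMap Task.rv = XS.toList := by
    rw [flatMap_single f _ id, List.map_id]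
    intro x _; simp only [f]; split_ifs <;> rfl
  have e2 : (XS.toList.map f).flatMap Task.rc = [] := by
    apply flatMap_none; intro x _; simp only [f]; split_ifs <;> rfl
  have e3 : (QS.toList.map g).flatMap Task.rv = [] := by
    apply flatMap_none; intro x _; simp only [g]; split_ifs <;> rfl
  have e4 : (QS.toList.map g).flatMap Task.rc = QS.toList := by
    rw [flatMap_single g _ id, List.map_id]
    intro x _; simp only [g]; split_ifs <;> rfl
  set τs := items ++ (XS.toList.map f ++ QS.toList.map g) with hτ
  have erv : τs.flatMap Task.rv = items.flatMap Task.rv ++ XS.toList := by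
    rw [hτ, List.flatMap_append, List.flatMap_append, e1, e3, List.append_nil]
  have erc : τs.flatMap Task.rc = items.flatMap Task.rc ++ QS.toList := by
    rw [hτ, List.flatMap_append, List.flatMap_append, e2, e4, List.nil_append]
  have elen : 4 * τs.length ≤ s := by
    have h1 : XS.card ≤ ((A ∪ B)ᶜ).card := Finset.card_le_card (Finset.filter_subset _ _)
    have h2 : QS.card ≤ ((K ∪ P)ᶜ).card := by
      apply Finset.card_le_card
      intro γ hγ
      have := (Finset.mem_filter.1 hγ).2
      simp [this.1, this.2.1]
    rw [hτ, List.length_append, List.length_append, List.length_map, List.length_map, Finset.length_toList, Finset.length_toList]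
    omega
  have cnt : ∀ b : Bool, (τs.map Task.sds).count (b, !b) = (items.map Task.sds).count (b, !b) := by
    intro b
    have cf : ∀ x ∈ XS.toList, (Task.sds ∘ f) x ≠ (b, !b) := by
      intro x _; simp only [Function.comp, f]; split_ifs <;> cases b <;> simp [Task.sds]
    have cg : ∀ x ∈ QS.toList, (Task.sds ∘ g) x ≠ (b, !b) := by
      intro x _; simp only [Function.comp, g]; split_ifs <;> cases b <;> simp [Task.sds]
    rw [hτ, List.map_append, List.map_append, List.map_map, List.map_map, List.count_append, List.count_append,
      count_none (Task.sds ∘ f) _ _ cf, count_none (Task.sds ∘ g) _ _ cg]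
    omega
  have c1 := cnt true
  have c2 := cnt false
  simp only [Bool.not_true, Bool.not_false] at c1 c2
  refine masterK S.ctx N hN (l := l) (s := s) S.hyp.cV S.hyp.cG hl τs ?_ ?_ ?_ elen ?_ P t hPI hPt ht ?_ ?_ (by omega) (by omega) (by omega) (by omega)
  · intro τ hτ'
    rw [hτ, List.mem_append, List.mem_append, List.mem_map, List.mem_map] at hτ'
    rcases hτ' with h | ⟨x, hx, rfl⟩ | ⟨γ, hγ, rfl⟩
    · exact hf τ h
    · simp only [f]
      split_ifs with hh
      · exact ⟨hAt x hh, hAt x hh⟩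
      · exact ⟨hBt x hh, hBt x hh⟩
    · have hγ' := (Finset.mem_filter.1 (Finset.mem_toList.1 hγ)).2
      simp only [g]
      split_ifs with hh
      · exact hh
      · rcases hcol γ hγ'.1 hγ'.2.1 hγ'.2.2 with h | h
        · exact absurd h hh
        · exact h
  · rw [erv, List.nodup_append]
    refine ⟨hrv, Finset.nodup_toList _, ?_⟩
    intro a ha b hb hab
    subst hab
    exact (Finset.mem_filter.1 (Finset.mem_toList.1 hb)).2 ha
  · rw [erc, List.nodup_append]
    refine ⟨hrc, Finset.nodup_toList _, ?_⟩
    intro a ha b hb hab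
    subst hab
    exact (Finset.mem_filter.1 (Finset.mem_toList.1 hb)).2.2.2 ha
  · intro v ha hb
    rw [erv, List.mem_append, Finset.mem_toList]
    by_cases h : v ∈ items.flatMap Task.rv
    · exact Or.inl h
    · right
      refine Finset.mem_filter.2 ⟨?_, h⟩
      simp [ha, hb]
  · intro γ hγ
    rw [erc, List.mem_append, Finset.mem_toList] at hγ
    rcases hγ with h | h
    · exact hPr γ h
    · exact (Finset.mem_filter.1 h).2.2.1
  · intro γ hP hK
    rw [erc, List.mem_append, Finset.mem_toList]
    by_cases h : γ ∈ items.flatMap Task.rc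
    · exact Or.inl h
    · right
      exact Finset.mem_filter.2 ⟨Finset.mem_univ _, hK, hP, h⟩

lemma split_list {α : Type} (l : List α) (a : ℕ) (ha : a ≤ l.length) :
    ∃ l1 l2 : List α, l = l1 ++ l2 ∧ l1.length = a :=
  ⟨l.take a, l.drop a, (List.take_append_drop a l).symm, by simp [ha]⟩

/-- crossing tasks from forced colours -/
lemma forced_items {G : Γ → SimpleGraph V} {A B : Finset V} {C : Finset Γ} {l : ℝ} (F : Finset Γ)
    (hF : ∀ γ ∈ F, l ≤ ed G γ A B) (a : ℕ) (ha : a ≤ F.card) :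
    ∃ L : List (Task V Γ), L.flatMap Task.rv = [] ∧ L.flatMap Task.rc = F.toList ∧ L.length = F.card ∧
      (L.map Task.sds).count (true, false) = a ∧ (L.map Task.sds).count (false, true) = F.card - a ∧
      ∀ τ ∈ L, τ.feas G A B C l := by
  obtain ⟨l1, l2, e, hl1⟩ := split_list F.toList a (by rw [Finset.length_toList]; exact ha)
  have hlen : l1.length + l2.length = F.card := by
    rw [← List.length_append, ← e, Finset.length_toList]
  refine ⟨l1.map (fun γ => .colr γ true false) ++ l2.map (fun γ => .colr γ false true), ?_, ?_, ?_, ?_, ?_, ?_⟩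
  · rw [List.flatMap_append, flatMap_none, flatMap_none]
    · rfl
    · intro a _; rfl
    · intro a _; rfl
  · rw [List.flatMap_append, flatMap_single _ _ id, flatMap_single _ _ id, List.map_id, List.map_id, e]
    · intro a _; rfl
    · intro a _; rfl
  · simp [hlen]
  · rw [List.map_append, List.map_map, List.map_map, List.count_append, count_none (Task.sds ∘ fun γ => Task.colr γ false true)]
    · have : l1.map (Task.sds ∘ fun γ => (Task.colr γ true false : Task V Γ)) = List.replicate l1.length (true, false) := by
        rw [List.eq_replicate_iff]; simp [Task.sds]
      rw [this]; simp [hl1]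
    · intro a _; simp [Task.sds]
  · rw [List.map_append, List.map_map, List.map_map, List.count_append, count_none (Task.sds ∘ fun γ => Task.colr γ true false)]
    · have : l2.map (Task.sds ∘ fun γ => (Task.colr γ false true : Task V Γ)) = List.replicate l2.length (false, true) := by
        rw [List.eq_replicate_iff]; simp [Task.sds]
      rw [this]; simp; omega
    · intro a _; simp [Task.sds]
  · intro τ hτ
    rw [List.mem_append, List.mem_map, List.mem_map] at hτ
    rcases hτ with ⟨γ, hγ, rfl⟩ | ⟨γ, hγ, rfl⟩
    · exact hF γ (Finset.mem_toList.1 (e ▸ List.mem_append_left _ hγ))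
    · have := hF γ (Finset.mem_toList.1 (e ▸ List.mem_append_right _ hγ))
      rw [ed_comm] at this
      exact this

lemma K1 {G : Γ → SimpleGraph V} {k : ℕ} {δ : ℝ} {A B : Finset V} {I K : Finset Γ}
    (S : Setup G k δ A B I K) (N : ℕ)
    (hN : ∀ m : ℕ, N ≤ m + 1 → 6 * (δ * (Fintype.card V : ℝ) ^ 2) < (m : ℝ) * m - m)
    {l : ℝ} {s : ℕ} (hl : (2 * (s + 5) * (2 * k + 1 : ℕ) : ℝ) < l) (At : Finset V)
    (hAAt : A ⊆ At) (hk : At.card ≤ k) (hK0 : K.Nonempty) (hA0 : A.Nonempty)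
    (hAt : ∀ x ∈ At, l ≤ lk G K x A) (hBt : ∀ x, x ∉ At → l ≤ lk G K x B)
    (P : Finset Γ) (t : ℕ) (hPI : P ⊆ I) (hPt : P.card = 2 * t) (ht : t = 0 ∨ N ≤ t)
    (F : Finset Γ) (hFK : ∀ γ ∈ F, γ ∉ K) (hFP : ∀ γ ∈ F, γ ∉ P) (hF : ∀ γ ∈ F, l ≤ ed G γ A B) (hF0 : F.Nonempty)
    (hcol : ∀ γ, γ ∉ K → γ ∉ P → γ ∉ F → l ≤ ed G γ A A ∨ l ≤ ed G γ B B)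
    (hs : 4 * (((A ∪ B)ᶜ).card + 2 * ((K ∪ P)ᶜ).card + 1) ≤ s)
    (hA : N + t + s ≤ A.card) (hB : N + t + s ≤ B.card) : THC G := by
  have hFc : F.card ≤ ((K ∪ P)ᶜ).card := by
    apply Finset.card_le_card
    intro γ hγ
    simp [hFK γ hγ, hFP γ hγ]
  have hpos : 0 < F.card := hF0.card_pos
  rcases Nat.even_or_odd' F.card with ⟨b, hb | hb⟩
  · obtain ⟨L, r1, r2, r3, r4, r5, r6⟩ := forced_items (C := K) F hF b (by omega)
    refine K0 S N hN hl At hAt hBt P t hPI hPt ht L r6 ?_ ?_ ?_ ?_ (by omega) hA hB (by omega) (by omega)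
    · rw [r1]; simp
    · rw [r2]; exact Finset.nodup_toList _
    · rw [r2]; intro γ hγ; exact hFP γ (Finset.mem_toList.1 hγ)
    · rw [r2]; intro γ h1 h2 h3; exact hcol γ h1 h2 (fun h => h3 (Finset.mem_toList.2 h))
  · obtain ⟨L, r1, r2, r3, r4, r5, r6⟩ := forced_items (C := K) F hF b (by omega)
    obtain ⟨γ0, hγ0⟩ := hK0
    obtain ⟨a, ha⟩ := hA0
    have : ∃ w, w ∉ At ∧ (G γ0).Adj a w := by
      by_contra hcon
      push Not at hcon
      have h1 : nb G γ0 a ⊆ At.erase a := by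
        intro w hw
        rw [mem_nb] at hw
        rw [Finset.mem_erase]
        refine ⟨hw.ne', ?_⟩
        by_contra hh
        exact hcon w hh hw
      have h2 := Finset.card_le_card h1
      rw [Finset.card_erase_of_mem (hAAt ha)] at h2
      have h3 := S.hyp.dg γ0 a
      have h4 : 0 < At.card := Finset.card_pos.2 ⟨a, hAAt ha⟩
      omega
    obtain ⟨w, hw, haw⟩ := this
    refine K0 S N hN hl At hAt hBt P t hPI hPt ht (.edge a γ0 w true false :: L) ?_ ?_ ?_ ?_ ?_ ?_ hA hB ?_ ?_
    · intro τ hτ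
      rcases List.mem_cons.1 hτ with rfl | h
      · exact ⟨haw, hAt a (hAAt ha), hBt w hw⟩
      · exact r6 τ h
    · rw [List.flatMap_cons, r1]; simp [Task.rv, haw.ne]
    · rw [List.flatMap_cons, r2]
      simp only [Task.rc, List.cons_append, List.nil_append, List.nodup_cons, Finset.mem_toList]
      exact ⟨fun h => hFK γ0 h hγ0, Finset.nodup_toList _⟩
    · rw [List.flatMap_cons, r2]
      intro γ hγ
      simp only [Task.rc, List.cons_append, List.nil_append, List.mem_cons, Finset.mem_toList] at hγ
      rcases hγ with rfl | h
      · exact fun h => Finset.disjoint_left.1 S.ctx.dIK (hPI h) hγ0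
      · exact hFP γ h
    · rw [List.flatMap_cons, r2]
      intro γ h1 h2 h3
      simp only [Task.rc, List.cons_append, List.nil_append, List.mem_cons, Finset.mem_toList, not_or] at h3
      exact hcol γ h1 h2 h3.2
    · rw [List.length_cons]; omega
    · simp [Task.sds, r4, r5]; omega
    · simp [Task.sds]

/-- conclusion (b) -/
def Cb (G : Γ → SimpleGraph V) (k : ℕ) : Prop :=
  ∃ (u : V) (A B : Finset V), Disjoint A B ∧ (∀ v, (v ∈ A ∨ v ∈ B) ↔ v ≠ u) ∧ A.card = k ∧ B.card = k ∧
    (∀ γ v, v ≠ u → (G γ).Adj u v) ∧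
    (∀ γ x y, x ≠ u → y ≠ u → ((G γ).Adj x y ↔ x ≠ y ∧ ((x ∈ A ∧ y ∈ A) ∨ (x ∈ B ∧ y ∈ B))))

/-- two disjoint crossing edges -/
lemma K2 {G : Γ → SimpleGraph V} {k : ℕ} {δ : ℝ} {A B : Finset V} {I K : Finset Γ}
    (S : Setup G k δ A B I K) (N : ℕ)
    (hN : ∀ m : ℕ, N ≤ m + 1 → 6 * (δ * (Fintype.card V : ℝ) ^ 2) < (m : ℝ) * m - m)
    {l : ℝ} {s : ℕ} (hl : (2 * (s + 5) * (2 * k + 1 : ℕ) : ℝ) < l) (At : Finset V)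
    (hAt : ∀ x ∈ At, l ≤ lk G K x A) (hBt : ∀ x, x ∉ At → l ≤ lk G K x B)
    (hcol : ∀ γ, γ ∉ K → l ≤ ed G γ A A ∨ l ≤ ed G γ B B)
    (hs : 4 * (((A ∪ B)ᶜ).card + (Kᶜ).card + 2) ≤ s)
    (hA : N + s ≤ A.card) (hB : N + s ≤ B.card)
    {x1 x2 y1 y2 : V} {γ1 γ2 : Γ} (h1 : x1 ∈ At) (h2 : x2 ∈ At) (h3 : y1 ∉ At) (h4 : y2 ∉ At)
    (h5 : x1 ≠ x2) (h6 : y1 ≠ y2) (h7 : γ1 ≠ γ2) (h8 : (G γ1).Adj x1 y1) (h9 : (G γ2).Adj x2 y2) : THC G := by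
  refine K0 S N hN hl At hAt hBt ∅ 0 (by simp) rfl (Or.inl rfl)
    [.edge x1 γ1 y1 true false, .edge y2 γ2 x2 false true] ?_ ?_ ?_ ?_ ?_ ?_ (by omega) (by omega) ?_ ?_
  · intro τ hτ
    simp only [List.mem_cons, List.not_mem_nil, or_false] at hτ
    rcases hτ with rfl | rfl
    · exact ⟨h8, hAt _ h1, hBt _ h3⟩
    · exact ⟨h9.symm, hBt _ h4, hAt _ h2⟩
  · have q1 : x1 ≠ y2 := fun h => h4 (h ▸ h1)
    have q2 : y1 ≠ x2 := fun h => h3 (h ▸ h2)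
    simp [Task.rv, h8.ne, h9.ne', h5, h6, q1, q2]
  · simp [Task.rc, h7]
  · simp
  · intro γ hK _ _; exact hcol γ hK
  · simp only [Finset.union_empty, List.length_cons, List.length_nil]; omega
  · simp [Task.sds]
  · simp [Task.sds]

lemma bcase {G : Γ → SimpleGraph V} {k : ℕ} (hy : Hyp G k) (hk : 3 ≤ k) (At : Finset V) (hAk : At.card ≤ k)
    (hA3 : 3 ≤ At.card)
    (hno : ∀ x1 ∈ At, ∀ x2 ∈ At, ∀ y1 y2, y1 ∉ At → y2 ∉ At → ∀ γ1 γ2, x1 ≠ x2 → γ1 ≠ γ2 →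
      (G γ1).Adj x1 y1 → (G γ2).Adj x2 y2 → y1 = y2) : Cb G k := by
  have hcross : ∀ x ∈ At, ∀ γ, ∃ y, y ∉ At ∧ (G γ).Adj x y := by
    intro x hx γ
    by_contra hcon
    push Not at hcon
    have h1 : nb G γ x ⊆ At.erase x := by
      intro w hw
      rw [mem_nb] at hw
      rw [Finset.mem_erase]
      refine ⟨hw.ne', ?_⟩
      by_contra hh
      exact hcon w hh hw
    have h2 := Finset.card_le_card h1
    rw [Finset.card_erase_of_mem hx] at h2
    have h3 := hy.dg γ x
    omega
  obtain ⟨x1, x2, x3, hx1, hx2, hx3, h12, h13, h23⟩ := Finset.two_lt_card_iff.1 (by omega : 2 < At.card)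
  have hΓ3 : 2 < (Finset.univ : Finset Γ).card := by rw [Finset.card_univ, hy.cG]; omega
  obtain ⟨g1, g2, g3, _, _, _, c12, c13, c23⟩ := Finset.two_lt_card_iff.1 hΓ3
  obtain ⟨u, hu, hadj⟩ := hcross x1 hx1 g1
  have key1 : ∀ x ∈ At, x ≠ x1 → ∀ γ, γ ≠ g1 → ∀ y, y ∉ At → (G γ).Adj x y → y = u := by
    intro x hx hne γ hγ y hyy ha
    exact (hno x1 hx1 x hx u y hu hyy g1 γ hne.symm hγ.symm hadj ha).symm
  -- every vertex of At in every colour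
  have key : ∀ x ∈ At, ∀ γ y, y ∉ At → (G γ).Adj x y → y = u := by
    intro x hx γ y hyy ha
    obtain ⟨x', hx', hne1, hne2⟩ : ∃ x' ∈ At, x' ≠ x1 ∧ x' ≠ x := by
      by_cases h : x2 = x
      · exact ⟨x3, hx3, h13.symm, fun h' => h23 (h.trans h'.symm)⟩
      · exact ⟨x2, hx2, h12.symm, h⟩
    obtain ⟨g', hg1, hg2⟩ : ∃ g', g' ≠ g1 ∧ g' ≠ γ := by
      by_cases h : g2 = γ
      · exact ⟨g3, c13.symm, fun h' => c23 (h.trans h'.symm)⟩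
      · exact ⟨g2, c12.symm, h⟩
    obtain ⟨y', hy', ha'⟩ := hcross x' hx' g'
    have e := key1 x' hx' hne1 g' hg1 y' hy' ha'
    rw [e] at ha'
    exact (hno x' hx' x hx u y hu hyy g' γ hne2 hg2 ha' ha).symm
  have hxu : ∀ x ∈ At, ∀ γ, (G γ).Adj x u := by
    intro x hx γ
    obtain ⟨y, hy1, hy2⟩ := hcross x hx γ
    rw [← key x hx γ y hy1 hy2]; exact hy2
  have hsub : ∀ x ∈ At, ∀ γ, nb G γ x ⊆ insert u (At.erase x) := by
    intro x hx γ w hw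
    rw [mem_nb] at hw
    rw [Finset.mem_insert, Finset.mem_erase]
    by_cases hh : w ∈ At
    · exact Or.inr ⟨hw.ne', hh⟩
    · exact Or.inl (key x hx γ w hh hw)
  have hci : ∀ x ∈ At, (insert u (At.erase x)).card = At.card := by
    intro x hx
    rw [Finset.card_insert_of_notMem (fun h => hu (Finset.mem_of_mem_erase h)), Finset.card_erase_of_mem hx]
    omega
  have hAtk : At.card = k := by
    have h1 := Finset.card_le_card (hsub x1 hx1 g1)
    have h2 := hy.dg g1 x1
    rw [hci x1 hx1] at h1
    omega
  have heq : ∀ x ∈ At, ∀ γ, nb G γ x = insert u (At.erase x) := by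
    intro x hx γ
    apply Finset.eq_of_subset_of_card_le (hsub x hx γ)
    rw [hci x hx, hAtk]; exact hy.dg γ x
  set Bt := (insert u At)ᶜ with hBt
  have hBtk : Bt.card = k := by
    rw [hBt, Finset.card_compl, Finset.card_insert_of_notMem hu, hy.cV, hAtk]; omega
  have hBtm : ∀ y, y ∈ Bt ↔ y ≠ u ∧ y ∉ At := by intro y; simp [hBt, not_or]
  have hnoc : ∀ x ∈ At, ∀ y ∈ Bt, ∀ γ, ¬ (G γ).Adj x y := by
    intro x hx y hyB γ ha
    exact ((hBtm y).1 hyB).1 (key x hx γ y ((hBtm y).1 hyB).2 ha)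
  have heqB : ∀ y ∈ Bt, ∀ γ, nb G γ y = insert u (Bt.erase y) := by
    intro y hyB γ
    apply Finset.eq_of_subset_of_card_le
    · intro w hw
      rw [mem_nb] at hw
      rw [Finset.mem_insert, Finset.mem_erase]
      by_cases hwu : w = u
      · exact Or.inl hwu
      · right
        refine ⟨hw.ne', (hBtm w).2 ⟨hwu, ?_⟩⟩
        intro hwA
        exact hnoc w hwA y hyB γ hw.symm
    · rw [Finset.card_insert_of_notMem (fun h => ((hBtm u).1 (Finset.mem_of_mem_erase h)).1 rfl), Finset.card_erase_of_mem hyB, hBtk]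
      have := hy.dg γ y
      omega
  refine ⟨u, At, Bt, ?_, ?_, hAtk, hBtk, ?_, ?_⟩
  · rw [Finset.disjoint_left]; intro v h1 h2; exact ((hBtm v).1 h2).2 h1
  · intro v
    rw [hBtm]
    constructor
    · rintro (h | h)
      · rintro rfl; exact hu h
      · exact h.1
    · intro h
      by_cases hv : v ∈ At
      · exact Or.inl hv
      · exact Or.inr ⟨h, hv⟩
  · intro γ v hv
    by_cases hvA : v ∈ At
    · exact (hxu v hvA γ).symm
    · have hvB := (hBtm v).2 ⟨hv, hvA⟩
      have : u ∈ nb G γ v := by rw [heqB v hvB γ]; simp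
      exact (mem_nb.1 this).symm
  · intro γ x y hxu' hyu'
    by_cases hxA : x ∈ At
    · rw [← mem_nb, heq x hxA γ, Finset.mem_insert, Finset.mem_erase]
      have : x ∉ Bt := fun h => ((hBtm x).1 h).2 hxA
      simp [hyu', hxA, this, eq_comm]
    · have hxB := (hBtm x).2 ⟨hxu', hxA⟩
      rw [← mem_nb, heqB x hxB γ, Finset.mem_insert, Finset.mem_erase]
      simp [hyu', hxA, hxB, eq_comm]
end KReg
end TH

open SimpleGraph
set_option linter.unusedSectionVars false
set_option linter.unusedVariables false
namespace TH
open scoped Classical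

section KMain
variable {V Γ : Type} [Fintype V] [Fintype Γ]

lemma nb_two {G : Γ → SimpleGraph V} {k : ℕ} (hy : Hyp G k) (A B : Finset V) (γ : Γ) (x : V) :
    k ≤ (nb G γ x ∩ A).card + (nb G γ x ∩ B).card + ((A ∪ B)ᶜ).card := by
  have h := hy.dg γ x
  have h1 : nb G γ x ⊆ (nb G γ x ∩ A) ∪ (nb G γ x ∩ B) ∪ (A ∪ B)ᶜ := by
    intro v hv
    by_cases h1 : v ∈ A
    · simp [h1, mem_nb.1 hv]
    · by_cases h2 : v ∈ B
      · simp [h2, mem_nb.1 hv]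
      · simp [h1, h2]
  have h2 := (Finset.card_le_card h1).trans (Finset.card_union_le _ _)
  have h3 := Finset.card_union_le (nb G γ x ∩ A) (nb G γ x ∩ B)
  omega

lemma lk_two {G : Γ → SimpleGraph V} {k : ℕ} (hy : Hyp G k) (A B : Finset V) (C : Finset Γ) (x : V) :
    C.card * k ≤ lk G C x A + lk G C x B + C.card * ((A ∪ B)ᶜ).card := by
  rw [lk_eq_sum, lk_eq_sum, ← smul_eq_mul, ← smul_eq_mul, ← Finset.sum_const, ← Finset.sum_const,
    ← Finset.sum_add_distrib, ← Finset.sum_add_distrib]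
  exact Finset.sum_le_sum (fun γ _ => nb_two hy A B γ x)

lemma ed_two {G : Γ → SimpleGraph V} {k : ℕ} (hy : Hyp G k) (A B Z : Finset V) (γ : Γ) :
    Z.card * k ≤ ed G γ Z A + ed G γ Z B + Z.card * ((A ∪ B)ᶜ).card := by
  rw [ed_eq_sum, ed_eq_sum, ← smul_eq_mul, ← smul_eq_mul, ← Finset.sum_const, ← Finset.sum_const,
    ← Finset.sum_add_distrib, ← Finset.sum_add_distrib]
  exact Finset.sum_le_sum (fun x _ => nb_two hy A B γ x)

lemma hN_num {n : ℕ} (hn : 10 ^ 20 ≤ n) : ∀ m : ℕ, n / 10 ^ 7 ≤ m + 1 →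
    6 * (1 / 10 ^ 16 * (n : ℝ) ^ 2) < (m : ℝ) * m - m := by
  intro m hm
  have h1 : (n : ℝ) ≤ 10 ^ 7 * ((m : ℝ) + 2) := by
    have : n ≤ 10 ^ 7 * (m + 2) := by omega
    exact_mod_cast this
  have h2 : (10 : ℝ) ^ 20 ≤ n := by exact_mod_cast hn
  have h3 : (n : ℝ) ^ 2 ≤ (10 ^ 7 * ((m : ℝ) + 2)) ^ 2 := by gcongr
  have h4 : (10 : ℝ) ^ 12 ≤ m := by linarith
  nlinarith

/-- consequences of the setup -/
lemma setup_X {G : Γ → SimpleGraph V} {k : ℕ} {δ : ℝ} {A B : Finset V} {I K : Finset Γ}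
    (S : Setup G k δ A B I K) :
    (A.card : ℝ) + B.card + (((A ∪ B)ᶜ).card : ℝ) = Fintype.card V := by
  have h1 := Finset.card_union_of_disjoint S.ctx.dAB
  have h2 := Finset.card_add_card_compl (A ∪ B)
  rw [h1] at h2
  exact_mod_cast h2

lemma Kaux {G : Γ → SimpleGraph V} {k : ℕ} {A B : Finset V} {I K : Finset Γ}
    (S : Setup G k (1 / 10 ^ 16) A B I K) (hk : 10 ^ 20 ≤ k) (hK : 2 * k + 1 ≤ 1000 * K.card)
    (At : Finset V) (hAAt : A ⊆ At) (hAk : At.card ≤ k)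
    (hAt : ∀ x ∈ At, (1 / 10 ^ 4 * (2 * k + 1 : ℕ) ^ 2 : ℝ) ≤ lk G K x A)
    (hBt : ∀ x, x ∉ At → (1 / 10 ^ 4 * (2 * k + 1 : ℕ) ^ 2 : ℝ) ≤ lk G K x B) : THC G ∨ Cb G k := by
  have hX := setup_X S
  have hcA := S.cA
  have hcB := S.cB
  have hrest := S.rest
  have hcV := S.hyp.cV
  have hN := hN_num (n := 2 * k + 1) (by omega)
  have hedX := ed_two S.hyp A B A
  rw [← hcV] at hN
  have hKI : I.card + K.card + ((I ∪ K)ᶜ).card = 2 * k + 1 := by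
    rw [← Finset.card_union_of_disjoint S.ctx.dIK, Finset.card_add_card_compl, S.hyp.cG]
  set X := ((A ∪ B)ᶜ).card with hXd
  set l : ℝ := 1 / 10 ^ 4 * ((2 * k + 1 : ℕ) : ℝ) ^ 2 with hl
  obtain ⟨n, hn⟩ : ∃ n, n = 2 * k + 1 := ⟨_, rfl⟩
  rw [hcV, ← hn] at hX hcA hcB hrest
  have hnk : (n : ℝ) = 2 * k + 1 := by rw [hn]; push_cast; ring
  have hn20 : (2 * 10 ^ 20 : ℝ) ≤ n := by
    have : (10 ^ 20 : ℝ) ≤ k := by exact_mod_cast hk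
    linarith
  have hXX : (X : ℝ) ≤ 2 / 10 ^ 16 * n := by linarith
  rw [← hn] at hl
  set s : ℕ := n / 10 ^ 5 with hs
  have hs1 : (s : ℝ) ≤ 1 / 10 ^ 5 * n := by
    have : 10 ^ 5 * s ≤ n := by omega
    have : (10 ^ 5 * s : ℝ) ≤ n := by exact_mod_cast this
    linarith
  have hls : (2 * (s + 5) * (2 * k + 1 : ℕ) : ℝ) < l := by
    rw [← hn, hl]; nlinarith
  have hAn : 100 * n ≤ 201 * A.card ∧ 100 * n ≤ 201 * B.card ∧ 10 ^ 15 * X ≤ n ∧ 10 ^ 15 * ((I ∪ K)ᶜ).card ≤ n ∧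
      10 ^ 10 * n ≤ 2 * 10 ^ 10 * A.card + n ∧ 10 ^ 10 * n ≤ 2 * 10 ^ 10 * B.card + n := by
    refine ⟨?_, ?_, ?_, ?_, ?_, ?_⟩
    · have : (100 * n : ℝ) ≤ 201 * A.card := by linarith
      exact_mod_cast this
    · have : (100 * n : ℝ) ≤ 201 * B.card := by linarith
      exact_mod_cast this
    · have : (10 ^ 15 * X : ℝ) ≤ n := by linarith
      exact_mod_cast this
    · have : (10 ^ 15 * ((I ∪ K)ᶜ).card : ℝ) ≤ n := by linarith
      exact_mod_cast this
    · have : (10 ^ 10 * n : ℝ) ≤ 2 * 10 ^ 10 * A.card + n := by linarith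
      exact_mod_cast this
    · have : (10 ^ 10 * n : ℝ) ≤ 2 * 10 ^ 10 * B.card + n := by linarith
      exact_mod_cast this
  obtain ⟨b1, b2, b3, b4, b5, b6⟩ := hAn
  have hcl : ∀ γ, ¬ (l ≤ ed G γ A A) → l ≤ ed G γ A B := by
    intro γ h
    have h1 : ((A.card * k : ℕ) : ℝ) ≤ ((ed G γ A A + ed G γ A B + A.card * X : ℕ) : ℝ) := by exact_mod_cast hedX γ
    push_cast at h1
    push Not at h
    have h2 : (0.4 * n) * (k - X) ≤ (A.card : ℝ) * (k - X) := by
      apply mul_le_mul_of_nonneg_right <;> linarith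
    have h3 : (0.4 * n) * (0.4 * n) ≤ (0.4 * n) * (k - X : ℝ) := by
      apply mul_le_mul_of_nonneg_left <;> linarith
    nlinarith
  have hclI : ∀ γ ∈ I, l ≤ ed G γ A B := by
    intro γ h
    have h1 := S.ctx.nAB.col γ h
    simp only at h1
    have h2 := ed_add_ms (G := G) γ A B
    have h2 : ((ed G γ A B : ℝ)) + ms G γ A B = A.card * B.card := by exact_mod_cast h2
    rw [hcV, ← hn] at h1
    have h3 : (0.4 * n) * (0.4 * n) ≤ (A.card : ℝ) * B.card := by
      apply mul_le_mul <;> linarith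
    nlinarith
  have hK0 : K.Nonempty := Finset.card_pos.1 (by omega)
  have hA0 : A.Nonempty := Finset.card_pos.1 (by omega)
  by_cases hI : n ≤ 10 ^ 6 * I.card
  · -- many I colours
    left
    obtain ⟨j, t, hj, hjt, hj3⟩ : ∃ j t : ℕ, 1 ≤ j ∧ I.card = j + 2 * t ∧ j ≤ 2 := by
      rcases Nat.even_or_odd' I.card with ⟨c, h | h⟩
      · exact ⟨2, c - 1, by omega, by omega, by omega⟩
      · exact ⟨1, c, by omega, by omega, by omega⟩
    obtain ⟨J, hJ, hJc⟩ := Finset.exists_subset_card_eq (s := I) (n := j) (by omega)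
    have hP : (I \ J).card = 2 * t := by rw [Finset.card_sdiff_of_subset hJ]; omega
    have hKP : ((K ∪ (I \ J))ᶜ).card ≤ ((I ∪ K)ᶜ).card + 2 := by
      have : (K ∪ (I \ J))ᶜ ⊆ (I ∪ K)ᶜ ∪ J := by
        intro γ; simp only [Finset.mem_compl, Finset.mem_union, Finset.mem_sdiff]; tauto
      have := (Finset.card_le_card this).trans (Finset.card_union_le _ _)
      omega
    refine K1 S (n / 10 ^ 7) (by rw [hn, ← hcV]; exact hN) (l := l) (s := s) hls At hAAt hAk hK0 hA0 hAt hBt (I \ J) t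
      Finset.sdiff_subset hP (Or.inr (by omega))
      (J ∪ ((I ∪ K)ᶜ).filter (fun γ => ¬ (l ≤ ed G γ A A))) ?_ ?_ ?_ ?_ ?_ ?_ ?_ ?_
    · intro γ hγ
      rcases Finset.mem_union.1 hγ with h | h
      · exact Finset.disjoint_left.1 S.ctx.dIK (hJ h)
      · have := (Finset.mem_filter.1 h).1
        intro hh; simp [hh] at this
    · intro γ hγ
      rcases Finset.mem_union.1 hγ with h | h
      · simp [h]
      · have := (Finset.mem_filter.1 h).1
        intro hh; simp [(Finset.mem_sdiff.1 hh).1] at this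
    · intro γ hγ
      rcases Finset.mem_union.1 hγ with h | h
      · exact hclI γ (hJ h)
      · exact hcl γ (Finset.mem_filter.1 h).2
    · exact (Finset.card_pos.1 (by omega : 0 < J.card)).mono Finset.subset_union_left
    · intro γ h1 h2 h3
      left
      by_contra hcon
      apply h3
      by_cases hJ' : γ ∈ J
      · exact Finset.mem_union_left _ hJ'
      · apply Finset.mem_union_right
        refine Finset.mem_filter.2 ⟨?_, hcon⟩
        simp only [Finset.mem_compl, Finset.mem_union, not_or]
        refine ⟨fun hi => h2 (Finset.mem_sdiff.2 ⟨hi, hJ'⟩), h1⟩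
    · omega
    · omega
    · omega
  · push Not at hI
    have hKc : (Kᶜ).card ≤ I.card + ((I ∪ K)ᶜ).card := by
      rw [Finset.card_compl, S.hyp.cG]; omega
    by_cases hF : ∃ γ, γ ∉ K ∧ ¬ (l ≤ ed G γ A A) ∧ ¬ (l ≤ ed G γ B B)
    · left
      obtain ⟨γ0, hγ0⟩ := hF
      refine K1 S (n / 10 ^ 7) (by rw [hn, ← hcV]; exact hN) (l := l) (s := s) hls At hAAt hAk hK0 hA0 hAt hBt ∅ 0
        (by simp) rfl (Or.inl rfl)
        (Finset.univ.filter (fun γ => γ ∉ K ∧ ¬ (l ≤ ed G γ A A) ∧ ¬ (l ≤ ed G γ B B))) ?_ ?_ ?_ ?_ ?_ ?_ ?_ ?_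
      · intro γ hγ; exact (Finset.mem_filter.1 hγ).2.1
      · intro γ hγ; simp
      · intro γ hγ; exact hcl γ (Finset.mem_filter.1 hγ).2.2.1
      · exact ⟨γ0, Finset.mem_filter.2 ⟨Finset.mem_univ _, hγ0⟩⟩
      · intro γ h1 _ h3
        by_contra hcon
        push Not at hcon
        exact h3 (Finset.mem_filter.2 ⟨Finset.mem_univ _, h1, not_le.2 hcon.1, not_le.2 hcon.2⟩)
      · rw [Finset.union_empty]; omega
      · omega
      · omega
    · push Not at hF
      by_cases hd : ∃ x1 ∈ At, ∃ x2 ∈ At, ∃ y1 y2, y1 ∉ At ∧ y2 ∉ At ∧ ∃ γ1 γ2, x1 ≠ x2 ∧ γ1 ≠ γ2 ∧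
          (G γ1).Adj x1 y1 ∧ (G γ2).Adj x2 y2 ∧ y1 ≠ y2
      · left
        obtain ⟨x1, h1, x2, h2, y1, y2, h3, h4, γ1, γ2, h5, h7, h8, h9, h6⟩ := hd
        refine K2 S (n / 10 ^ 7) (by rw [hn, ← hcV]; exact hN) (l := l) (s := s) hls At hAt hBt ?_ ?_ ?_ ?_ h1 h2 h3 h4 h5 h6 h7 h8 h9
        · intro γ hγ
          by_cases h : l ≤ ed G γ A A
          · exact Or.inl h
          · exact Or.inr (hF γ hγ (not_le.1 h))
        · omega
        · omega
        · omega
      · right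
        push Not at hd
        apply bcase S.hyp (by omega) At hAk
        · have := Finset.card_le_card hAAt; omega
        · intro x1 h1 x2 h2 y1 y2 h3 h4 γ1 γ2 h5 h6 h7 h8
          exact hd x1 h1 x2 h2 y1 y2 h3 h4 γ1 γ2 h5 h6 h7 h8

theorem Kreg {G : Γ → SimpleGraph V} {k : ℕ} {A B : Finset V} {I K : Finset Γ}
    (S : Setup G k (1 / 10 ^ 16) A B I K) (hk : 10 ^ 20 ≤ k) (hK : 2 * k + 1 ≤ 1000 * K.card) : THC G ∨ Cb G k := by
  have hX := setup_X S
  have hcA := S.cA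
  have hcB := S.cB
  have hcV := S.hyp.cV
  obtain ⟨n, hn⟩ : ∃ n, n = 2 * k + 1 := ⟨_, rfl⟩
  set X := ((A ∪ B)ᶜ).card with hXd
  rw [hcV, ← hn] at hX hcA hcB
  have hnk : (n : ℝ) = 2 * k + 1 := by rw [hn]; push_cast; ring
  have hn20 : (2 * 10 ^ 20 : ℝ) ≤ n := by
    have : (10 ^ 20 : ℝ) ≤ k := by exact_mod_cast hk
    linarith
  have hKR : (n : ℝ) ≤ 1000 * K.card := by rw [hn]; exact_mod_cast hK
  have hKn : (K.card : ℝ) ≤ n := by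
    have := Finset.card_le_univ K
    rw [S.hyp.cG, ← hn] at this
    exact_mod_cast this
  have hgen : ∀ (C D : Finset V), (1 / 2 - 1 / 10 ^ 16) * (n : ℝ) ≤ C.card → Near G (1 / 10 ^ 16 * (Fintype.card V : ℝ) ^ 2) (C, K, C) →
      ∀ a ∈ C, (1 / 10 ^ 4 * (2 * k + 1 : ℕ) ^ 2 : ℝ) ≤ lk G K a C := by
    intro C _ hC hN a ha
    have h1 := hN.tl a ha
    have h2 := lk_add_mk G K a C
    have h2 : (lk G K a C : ℝ) + mk G K a C = C.card * K.card := by exact_mod_cast h2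
    have h3 : (mk G K a C : ℝ) ≤ 1 / 10 ^ 16 * n ^ 2 := by rw [hn, ← hcV]; exact h1
    have h4 : (0.4 * n) * (n / 1000) ≤ (C.card : ℝ) * K.card := by
      apply mul_le_mul <;> linarith
    rw [← hn]
    nlinarith
  have hlA := hgen A B hcA S.ctx.nAA
  have hlB := hgen B A hcB S.ctx.nBB
  have hdi : ∀ x, ¬ ((1 / 10 ^ 4 * (2 * k + 1 : ℕ) ^ 2 : ℝ) ≤ lk G K x A) → (1 / 10 ^ 4 * (2 * k + 1 : ℕ) ^ 2 : ℝ) ≤ lk G K x B := by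
    intro x h
    have h1 := lk_two S.hyp A B K x
    have h1 : ((K.card : ℝ)) * k ≤ lk G K x A + lk G K x B + K.card * X := by exact_mod_cast h1
    push Not at h
    rw [← hn] at h ⊢
    have h2 : (n / 1000 : ℝ) * (0.4 * n) ≤ K.card * (k - X) := by
      apply mul_le_mul <;> linarith
    nlinarith
  set At := A ∪ (Bᶜ).filter (fun x => (1 / 10 ^ 4 * (2 * k + 1 : ℕ) ^ 2 : ℝ) ≤ lk G K x A) with hAt
  have q1 : ∀ x ∈ At, (1 / 10 ^ 4 * (2 * k + 1 : ℕ) ^ 2 : ℝ) ≤ lk G K x A := by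
    intro x hx
    rcases Finset.mem_union.1 hx with h | h
    · exact hlA x h
    · exact (Finset.mem_filter.1 h).2
  have q2 : ∀ x, x ∉ At → (1 / 10 ^ 4 * (2 * k + 1 : ℕ) ^ 2 : ℝ) ≤ lk G K x B := by
    intro x hx
    by_cases hB : x ∈ B
    · exact hlB x hB
    · apply hdi
      intro h
      exact hx (Finset.mem_union_right _ (Finset.mem_filter.2 ⟨by simp [hB], h⟩))
  by_cases hc : At.card ≤ k
  · exact Kaux S hk hK At Finset.subset_union_left hc q1 q2
  · refine Kaux S.swap hk hK Atᶜ ?_ ?_ ?_ ?_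
    · intro b hb
      rw [Finset.mem_compl]
      intro h
      rcases Finset.mem_union.1 h with h | h
      · exact Finset.disjoint_left.1 S.ctx.dAB h hb
      · have := (Finset.mem_filter.1 h).1
        simp [hb] at this
    · rw [Finset.card_compl, hcV]; omega
    · intro x hx; exact q2 x (Finset.mem_compl.1 hx)
    · intro x hx; exact q1 x (by simpa using hx)
end KMain
end TH

open SimpleGraph
set_option linter.unusedSectionVars false
set_option linter.unusedVariables false
namespace TH
open scoped Classical

section IReg
variable {V Γ : Type} [Fintype V] [Fintype Γ]

/-- signed weight for a vertex set -/
noncomputable def wt (At : Finset V) (v : V) : ℤ := if v ∈ At then 1 else -1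

/-- contribution of a task -/
noncomputable def ph (At : Finset V) (τ : Task V Γ) : ℤ := (τ.rv.map (wt At)).sum + hs τ.sds

lemma sum_wt (At : Finset V) : ∑ v, wt At v = (At.card : ℤ) - (Atᶜ.card : ℤ) := by
  simp only [wt]
  rw [Finset.sum_ite]
  simp [Finset.filter_mem_eq_inter]
  rw [← sub_eq_add_neg]
  congr 2
  congr 1
  ext x; simp

lemma sum_map_zero {α : Type} (f : α → ℤ) (L : List α) (h : ∀ a ∈ L, f a = 0) : (L.map f).sum = 0 := by
  induction L with
  | nil => rfl
  | cons a L ih => rw [List.map_cons, List.sum_cons, h a (by simp), ih (fun b hb => h b (by simp [hb])), add_zero]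

lemma sum_map_const {α : Type} (f : α → ℤ) (c : ℤ) (L : List α) (h : ∀ a ∈ L, f a = c) : (L.map f).sum = c * L.length := by
  induction L with
  | nil => simp
  | cons a L ih =>
    rw [List.map_cons, List.sum_cons, h a (by simp), ih (fun b hb => h b (by simp [hb])), List.length_cons]
    push_cast; ring

lemma I0 {G : Γ → SimpleGraph V} {k : ℕ} {δ : ℝ} {A B : Finset V} {I K : Finset Γ}
    (S : Setup G k δ A B I K) (N : ℕ)
    (hN : ∀ m : ℕ, N ≤ m + 1 → 6 * (δ * (Fintype.card V : ℝ) ^ 2) < (m : ℝ) * m - m)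
    {l : ℝ} {s : ℕ} (hl : (2 * (s + 5) * (2 * k + 1 : ℕ) : ℝ) < l) (At : Finset V)
    (hAAt : A ⊆ At) (hBAt : ∀ b ∈ B, b ∉ At)
    (hAt : ∀ x ∈ At, l ≤ lk G I x B) (hBt : ∀ x, x ∉ At → l ≤ lk G I x A)
    (items : List (Task V Γ)) (hf : ∀ τ ∈ items, τ.feas G A B I l)
    (hrv : (items.flatMap Task.rv).Nodup) (hrc : (items.flatMap Task.rc).Nodup)
    (hcol : ∀ γ, γ ∉ I → γ ∉ items.flatMap Task.rc → l ≤ ed G γ A B)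
    (hs' : 4 * (items.length + ((A ∪ B)ᶜ).card + (Iᶜ).card) ≤ s)
    (hA : N + s + 1 ≤ A.card) (hB : N + s + 1 ≤ B.card)
    (hx : ∀ τ ∈ items, τ.sds ≠ (false, true))
    (hsum : (At.card : ℤ) - (Atᶜ.card : ℤ) = (items.map (ph At)).sum) : THC G := by
  set XS := ((A ∪ B)ᶜ).filter (fun x => x ∉ items.flatMap Task.rv) with hXS
  set QS := (Finset.univ : Finset Γ).filter (fun γ => γ ∉ I ∧ γ ∉ items.flatMap Task.rc) with hQS
  set f : V → Task V Γ := fun x => if x ∈ At then .vert x false false else .vert x true true with hf'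
  set g : Γ → Task V Γ := fun γ => .colr γ true false with hg
  have e1 : (XS.toList.map f).flatMap Task.rv = XS.toList := by
    rw [flatMap_single f _ id, List.map_id]
    intro x _; simp only [f]; split_ifs <;> rfl
  have e2 : (XS.toList.map f).flatMap Task.rc = [] := by
    apply flatMap_none; intro x _; simp only [f]; split_ifs <;> rfl
  have e3 : (QS.toList.map g).flatMap Task.rv = [] := by
    apply flatMap_none; intro x _; rfl
  have e4 : (QS.toList.map g).flatMap Task.rc = QS.toList := by
    rw [flatMap_single g _ id, List.map_id]
    intro x _; rfl
  set τs := items ++ (XS.toList.map f ++ QS.toList.map g) with hτ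
  have erv : τs.flatMap Task.rv = items.flatMap Task.rv ++ XS.toList := by
    rw [hτ, List.flatMap_append, List.flatMap_append, e1, e3, List.append_nil]
  have erc : τs.flatMap Task.rc = items.flatMap Task.rc ++ QS.toList := by
    rw [hτ, List.flatMap_append, List.flatMap_append, e2, e4, List.nil_append]
  have elen : 4 * τs.length ≤ s := by
    have h1 : XS.card ≤ ((A ∪ B)ᶜ).card := Finset.card_le_card (Finset.filter_subset _ _)
    have h2 : QS.card ≤ (Iᶜ).card := by
      apply Finset.card_le_card
      intro γ hγ
      have := (Finset.mem_filter.1 hγ).2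
      simp [this.1]
    rw [hτ, List.length_append, List.length_append, List.length_map, List.length_map, Finset.length_toList, Finset.length_toList]
    omega
  refine masterI S.ctx N hN (l := l) (s := s) S.hyp.cV S.hyp.cG hl τs ?_ ?_ ?_ elen ?_ ?_ (by omega) (by omega) ?_ (wt At) ?_ ?_ ?_
  · intro τ hτ'
    rw [hτ, List.mem_append, List.mem_append, List.mem_map, List.mem_map] at hτ'
    rcases hτ' with h | ⟨x, hx, rfl⟩ | ⟨γ, hγ, rfl⟩
    · exact hf τ h
    · simp only [f]
      split_ifs with hh
      · exact ⟨hAt x hh, hAt x hh⟩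
      · exact ⟨hBt x hh, hBt x hh⟩
    · have hγ' := (Finset.mem_filter.1 (Finset.mem_toList.1 hγ)).2
      exact hcol γ hγ'.1 hγ'.2
  · rw [erv, List.nodup_append]
    refine ⟨hrv, Finset.nodup_toList _, ?_⟩
    intro a ha b hb hab
    subst hab
    exact (Finset.mem_filter.1 (Finset.mem_toList.1 hb)).2 ha
  · rw [erc, List.nodup_append]
    refine ⟨hrc, Finset.nodup_toList _, ?_⟩
    intro a ha b hb hab
    subst hab
    exact (Finset.mem_filter.1 (Finset.mem_toList.1 hb)).2.2 ha
  · intro v ha hb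
    rw [erv, List.mem_append, Finset.mem_toList]
    by_cases h : v ∈ items.flatMap Task.rv
    · exact Or.inl h
    · right
      refine Finset.mem_filter.2 ⟨?_, h⟩
      simp [ha, hb]
  · intro γ hI
    rw [erc, List.mem_append, Finset.mem_toList]
    by_cases h : γ ∈ items.flatMap Task.rc
    · exact Or.inl h
    · right
      exact Finset.mem_filter.2 ⟨Finset.mem_univ _, hI, h⟩
  · apply count_none
    intro τ hτ'
    rw [hτ, List.mem_append, List.mem_append, List.mem_map, List.mem_map] at hτ'
    rcases hτ' with h | ⟨x, hx, rfl⟩ | ⟨γ, hγ, rfl⟩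
    · exact hx τ h
    · simp only [f]; split_ifs <;> simp [Task.sds]
    · simp [g, Task.sds]
  · intro v hv; simp [wt, hAAt hv]
  · intro v hv; simp [wt, hBAt v hv]
  · rw [sum_wt, hsum]
    change _ = (τs.map (ph At)).sum
    rw [hτ, List.map_append, List.map_append, List.sum_append, List.sum_append, List.map_map, List.map_map,
      sum_map_zero (ph At ∘ f), sum_map_zero (ph At ∘ g)]
    · simp
    · intro γ _; simp [g, ph, Task.rv, Task.sds, TH.hs]
    · intro x _; simp only [Function.comp, f]; split_ifs with h <;> simp [ph, Task.rv, Task.sds, TH.hs, wt, h]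

/-- rainbow matching -/
lemma matching {G : Γ → SimpleGraph V} (I : Finset Γ) (Z : Finset V) (r : ℕ) (hr : 1 ≤ r)
    (hdeg : ∀ γ ∈ I, ∀ z ∈ Z, r ≤ (nb G γ z ∩ Z).card) (q : ℝ) (hq0 : 0 ≤ q) (hq : ∀ z ∈ Z, (lk G I z Z : ℝ) ≤ q)
    (h1 : 2 * r ≤ I.card) (h2 : 4 * r ≤ Z.card)
    (hbig : 4 * q < ((I.card : ℝ) - 2 * r) * (Z.card - 4 * r)) (j : ℕ) (hj : j ≤ 2 * r + 1) :
    ∃ L : List (V × Γ × V), L.length = j ∧ (L.flatMap (fun e => [e.1, e.2.2])).Nodup ∧ (L.map (fun e => e.2.1)).Nodup ∧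
      ∀ e ∈ L, e.1 ∈ Z ∧ e.2.2 ∈ Z ∧ e.2.1 ∈ I ∧ (G e.2.1).Adj e.1 e.2.2 := by
  induction j with
  | zero => exact ⟨[], rfl, by simp, by simp, by simp⟩
  | succ j ih =>
    obtain ⟨L, l1, l2, l3, l4⟩ := ih (by omega)
    set W := (L.flatMap (fun e => [e.1, e.2.2])).toFinset with hW
    set F := (L.map (fun e => e.2.1)).toFinset with hF
    have hWc : W.card ≤ 4 * r := by
      have := flat_len (fun e : V × Γ × V => [e.1, e.2.2]) 2 L (fun _ _ => by simp)
      have h3 := List.toFinset_card_le (L.flatMap (fun e => [e.1, e.2.2]))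
      rw [← hW] at h3
      omega
    have hFc : F.card ≤ 2 * r := by
      have h3 := List.toFinset_card_le (L.map (fun e => e.2.1))
      rw [List.length_map, ← hF] at h3
      omega
    have key : ∃ γ ∈ I, γ ∉ F ∧ ∃ x ∈ Z, ∃ y ∈ Z, x ∉ W ∧ y ∉ W ∧ (G γ).Adj x y := by
      by_contra hcon
      push Not at hcon
      have c1 : ∀ γ ∈ I \ F, (Z \ W).card * r ≤ ∑ w ∈ W ∩ Z, (nb G γ w ∩ Z).card := by
        intro γ hγ
        rw [Finset.mem_sdiff] at hγ
        calc (Z \ W).card * r = ∑ z ∈ Z \ W, r := by simp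
          _ ≤ ∑ z ∈ Z \ W, (nb G γ z ∩ (W ∩ Z)).card := by
            apply Finset.sum_le_sum
            intro z hz
            rw [Finset.mem_sdiff] at hz
            refine (hdeg γ hγ.1 z hz.1).trans (Finset.card_le_card ?_)
            intro y hy
            rw [Finset.mem_inter] at hy
            by_cases hyW : y ∈ W
            · simp only [Finset.mem_inter]; exact ⟨hy.1, hyW, hy.2⟩
            · exact absurd (mem_nb.1 hy.1) (hcon γ hγ.1 hγ.2 z hz.1 y hy.2 hz.2 hyW)
          _ = ed G γ (Z \ W) (W ∩ Z) := (ed_eq_sum _ _ _).symm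
          _ = ed G γ (W ∩ Z) (Z \ W) := ed_comm _ _ _
          _ ≤ ed G γ (W ∩ Z) Z := ed_mono le_rfl Finset.sdiff_subset
          _ = _ := ed_eq_sum _ _ _
      have c2 : (I \ F).card * ((Z \ W).card * r) ≤ ∑ w ∈ W ∩ Z, lk G I w Z := by
        calc (I \ F).card * ((Z \ W).card * r) = ∑ γ ∈ I \ F, (Z \ W).card * r := by simp
          _ ≤ ∑ γ ∈ I \ F, ∑ w ∈ W ∩ Z, (nb G γ w ∩ Z).card := Finset.sum_le_sum c1
          _ ≤ ∑ γ ∈ I, ∑ w ∈ W ∩ Z, (nb G γ w ∩ Z).card :=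
            Finset.sum_le_sum_of_subset Finset.sdiff_subset
          _ = ∑ w ∈ W ∩ Z, ∑ γ ∈ I, (nb G γ w ∩ Z).card := Finset.sum_comm
          _ = _ := Finset.sum_congr rfl (fun w _ => (lk_eq_sum _ _ _ _).symm)
      have c3 : ((∑ w ∈ W ∩ Z, lk G I w Z : ℕ) : ℝ) ≤ 4 * r * q := by
        push_cast
        calc ∑ w ∈ W ∩ Z, (lk G I w Z : ℝ) ≤ ∑ w ∈ W ∩ Z, q :=
              Finset.sum_le_sum (fun w hw => hq w (Finset.mem_inter.1 hw).2)
          _ = (W ∩ Z).card * q := by simp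
          _ ≤ 4 * r * q := by
            apply mul_le_mul_of_nonneg_right _ hq0
            have := (Finset.card_le_card (Finset.inter_subset_left (s₁ := W) (s₂ := Z))).trans hWc
            exact_mod_cast this
      have c4 : ((I.card : ℝ) - 2 * r) ≤ (I \ F).card := by
        have := Finset.le_card_sdiff F I
        have : I.card ≤ (I \ F).card + 2 * r := by omega
        have : (I.card : ℝ) ≤ (I \ F).card + 2 * r := by exact_mod_cast this
        linarith
      have c5 : ((Z.card : ℝ) - 4 * r) ≤ (Z \ W).card := by
        have := Finset.le_card_sdiff W Z
        have : Z.card ≤ (Z \ W).card + 4 * r := by omega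
        have : (Z.card : ℝ) ≤ (Z \ W).card + 4 * r := by exact_mod_cast this
        linarith
      have c6 : ((I.card : ℝ) - 2 * r) * (Z.card - 4 * r) ≤ (I \ F).card * (Z \ W).card := by
        have z1 : (2 * r : ℝ) ≤ I.card := by exact_mod_cast h1
        have z2 : (4 * r : ℝ) ≤ Z.card := by exact_mod_cast h2
        apply mul_le_mul c4 c5 (by linarith) (by positivity)
      have c7 : (((I \ F).card * ((Z \ W).card * r) : ℕ) : ℝ) ≤ 4 * r * q := le_trans (by exact_mod_cast c2) c3
      push_cast at c7
      have hr' : (0 : ℝ) < r := by exact_mod_cast hr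
      have c8 : ((I \ F).card * (Z \ W).card : ℝ) * r ≤ (4 * q) * r := by linarith
      have c9 := le_of_mul_le_mul_right c8 hr'
      linarith
    obtain ⟨γ, hγ, hγF, x, hx, y, hy, hxW, hyW, ha⟩ := key
    refine ⟨(x, γ, y) :: L, by simp [l1], ?_, ?_, ?_⟩
    · rw [List.flatMap_cons]
      simp only [hW, List.mem_toFinset] at hxW hyW
      simp only [List.cons_append, List.nil_append, List.nodup_cons, List.mem_cons, not_or]
      exact ⟨⟨ha.ne, hxW⟩, hyW, l2⟩
    · rw [List.map_cons, List.nodup_cons]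
      exact ⟨by simpa [hF] using hγF, l3⟩
    · intro e he
      rcases List.mem_cons.1 he with rfl | h
      · exact ⟨hx, hy, hγ, ha⟩
      · exact l4 e h

/-- items supplied inside -/
structure Sup (G : Γ → SimpleGraph V) (A B : Finset V) (I : Finset Γ) (l : ℝ) (At : Finset V) (Y : Finset V) (m : ℕ)
    (L : List (Task V Γ)) : Prop where
  f : ∀ τ ∈ L, τ.feas G A B I l
  rv : (L.flatMap Task.rv).Nodup
  rvA : ∀ v ∈ L.flatMap Task.rv, v ∈ Y
  rc : (L.flatMap Task.rc).Nodup
  rcI : ∀ γ ∈ L.flatMap Task.rc, γ ∈ I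
  sd : ∀ τ ∈ L, τ.sds ≠ (false, true)
  len : L.length ≤ m
  sum : (L.map (ph At)).sum = m

lemma supU {G : Γ → SimpleGraph V} {A B : Finset V} {I : Finset Γ} {l : ℝ} {At U : Finset V} (hU : U ⊆ At)
    (hAt : ∀ x ∈ At, l ≤ lk G I x B) (hUl : ∀ x ∈ U, l ≤ lk G I x A) (m : ℕ) (hm : m ≤ 2 * U.card) :
    ∃ L, Sup G A B I l At U m L ∧ L.flatMap Task.rc = [] := by
  rcases Nat.even_or_odd' m with ⟨c, h | h⟩
  · obtain ⟨l1, l2, e, hl1⟩ := split_list U.toList c (by rw [Finset.length_toList]; omega)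
    have hsub : ∀ x ∈ l1, x ∈ U := fun x hx => Finset.mem_toList.1 (e ▸ List.mem_append_left _ hx)
    have hnd : l1.Nodup := by
      have := Finset.nodup_toList U; rw [e] at this; exact (List.nodup_append.1 this).1
    have erv : (l1.map (fun x => (Task.vert x true true : Task V Γ))).flatMap Task.rv = l1 := by
      rw [flatMap_single _ _ id, List.map_id]; intro x _; rfl
    have erc : (l1.map (fun x => (Task.vert x true true : Task V Γ))).flatMap Task.rc = [] := by
      apply flatMap_none; intro x _; rfl
    refine ⟨l1.map (fun x => .vert x true true), ⟨?_, ?_, ?_, ?_, ?_, ?_, ?_, ?_⟩, erc⟩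
    · intro τ hτ
      obtain ⟨x, hx, rfl⟩ := List.mem_map.1 hτ
      exact ⟨hUl x (hsub x hx), hUl x (hsub x hx)⟩
    · rw [erv]; exact hnd
    · rw [erv]; exact hsub
    · rw [erc]; simp
    · rw [erc]; simp
    · intro τ hτ
      obtain ⟨x, hx, rfl⟩ := List.mem_map.1 hτ
      simp [Task.sds]
    · rw [List.length_map]; omega
    · rw [List.map_map, sum_map_const _ 2]
      · rw [hl1, h]; push_cast; ring
      · intro x hx; simp [ph, Task.rv, Task.sds, wt, hU (hsub x hx), TH.hs]
  · obtain ⟨l1, l2, e, hl1⟩ := split_list U.toList (c + 1) (by rw [Finset.length_toList]; omega)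
    have hsub : ∀ x ∈ l1, x ∈ U := fun x hx => Finset.mem_toList.1 (e ▸ List.mem_append_left _ hx)
    have hnd : l1.Nodup := by
      have := Finset.nodup_toList U; rw [e] at this; exact (List.nodup_append.1 this).1
    cases l1 with
    | nil => simp at hl1
    | cons u l1 =>
    rw [List.length_cons] at hl1
    have hu : u ∈ U := hsub u (by simp)
    have hsub' : ∀ x ∈ l1, x ∈ U := fun x hx => hsub x (by simp [hx])
    have erv : ((.vert u true false : Task V Γ) :: l1.map (fun x => (Task.vert x true true : Task V Γ))).flatMap Task.rv = u :: l1 := by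
      rw [List.flatMap_cons, flatMap_single _ _ id, List.map_id]
      · rfl
      · intro x _; rfl
    have erc : ((.vert u true false : Task V Γ) :: l1.map (fun x => (Task.vert x true true : Task V Γ))).flatMap Task.rc = [] := by
      rw [List.flatMap_cons, flatMap_none]
      · rfl
      · intro x _; rfl
    refine ⟨(.vert u true false : Task V Γ) :: l1.map (fun x => .vert x true true), ⟨?_, ?_, ?_, ?_, ?_, ?_, ?_, ?_⟩, erc⟩
    · intro τ hτ
      rcases List.mem_cons.1 hτ with rfl | hτ
      · exact ⟨hUl u hu, hAt u (hU hu)⟩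
      obtain ⟨x, hx, rfl⟩ := List.mem_map.1 hτ
      exact ⟨hUl x (hsub' x hx), hUl x (hsub' x hx)⟩
    · rw [erv]; exact hnd
    · rw [erv]; exact hsub
    · rw [erc]; simp
    · rw [erc]; simp
    · intro τ hτ
      rcases List.mem_cons.1 hτ with rfl | hτ
      · simp [Task.sds]
      obtain ⟨x, hx, rfl⟩ := List.mem_map.1 hτ
      simp [Task.sds]
    · rw [List.length_cons, List.length_map]; omega
    · rw [List.map_cons, List.sum_cons, List.map_map, sum_map_const _ 2]
      · have : l1.length = c := by omega
        rw [this, h]; simp [ph, Task.rv, Task.sds, wt, hU hu, TH.hs]; ring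
      · intro x hx; simp [ph, Task.rv, Task.sds, wt, hU (hsub' x hx), TH.hs]

lemma supM {G : Γ → SimpleGraph V} {A B : Finset V} {I : Finset Γ} {l : ℝ} {At Z : Finset V} (hZ : Z ⊆ At)
    (hAt : ∀ x ∈ At, l ≤ lk G I x B) (L : List (V × Γ × V))
    (h1 : (L.flatMap (fun e => [e.1, e.2.2])).Nodup) (h2 : (L.map (fun e => e.2.1)).Nodup)
    (h3 : ∀ e ∈ L, e.1 ∈ Z ∧ e.2.2 ∈ Z ∧ e.2.1 ∈ I ∧ (G e.2.1).Adj e.1 e.2.2) :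
    ∃ L', Sup G A B I l At Z L.length L' := by
  refine ⟨L.map (fun e => .edge e.1 e.2.1 e.2.2 false false), ?_, ?_, ?_, ?_, ?_, ?_, ?_, ?_⟩
  · intro τ hτ
    obtain ⟨e, he, rfl⟩ := List.mem_map.1 hτ
    obtain ⟨q1, q2, q3, q4⟩ := h3 e he
    exact ⟨q4, hAt _ (hZ q1), hAt _ (hZ q2)⟩
  · rw [List.flatMap_map]; exact h1
  · rw [List.flatMap_map]
    intro v hv
    obtain ⟨e, he, hv⟩ := List.mem_flatMap.1 hv
    obtain ⟨q1, q2, q3, q4⟩ := h3 e he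
    simp only [Task.rv, List.mem_cons, List.not_mem_nil, or_false] at hv
    rcases hv with rfl | rfl <;> assumption
  · rw [flatMap_single _ _ (fun e => e.2.1)]
    · exact h2
    · intro e _; rfl
  · rw [flatMap_single _ _ (fun e => e.2.1)]
    · intro γ hγ
      obtain ⟨e, he, rfl⟩ := List.mem_map.1 hγ
      exact (h3 e he).2.2.1
    · intro e _; rfl
  · intro τ hτ
    obtain ⟨e, he, rfl⟩ := List.mem_map.1 hτ
    simp [Task.sds]
  · rw [List.length_map]
  · rw [List.map_map, sum_map_const _ 1, one_mul]
    intro e he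
    obtain ⟨q1, q2, q3, q4⟩ := h3 e he
    simp [ph, Task.rv, Task.sds, wt, hZ q1, hZ q2, TH.hs]

lemma Sup.append {G : Γ → SimpleGraph V} {A B : Finset V} {I : Finset Γ} {l : ℝ} {At Y Y' : Finset V} {m m' : ℕ}
    {L L' : List (Task V Γ)} (h : Sup G A B I l At Y m L) (h' : Sup G A B I l At Y' m' L') (hd : Disjoint Y Y')
    (hrc : ∀ γ ∈ L.flatMap Task.rc, γ ∉ L'.flatMap Task.rc) : Sup G A B I l At (Y ∪ Y') (m + m') (L ++ L') := by
  refine ⟨?_, ?_, ?_, ?_, ?_, ?_, ?_, ?_⟩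
  · intro τ hτ
    rcases List.mem_append.1 hτ with hh | hh
    · exact h.f τ hh
    · exact h'.f τ hh
  · rw [List.flatMap_append, List.nodup_append]
    refine ⟨h.rv, h'.rv, ?_⟩
    rintro a ha b hb rfl
    exact Finset.disjoint_left.1 hd (h.rvA a ha) (h'.rvA a hb)
  · rw [List.flatMap_append]
    intro v hv
    rcases List.mem_append.1 hv with hh | hh
    · exact Finset.mem_union_left _ (h.rvA v hh)
    · exact Finset.mem_union_right _ (h'.rvA v hh)
  · rw [List.flatMap_append, List.nodup_append]
    refine ⟨h.rc, h'.rc, ?_⟩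
    rintro a ha b hb rfl
    exact hrc a ha hb
  · rw [List.flatMap_append]
    intro v hv
    rcases List.mem_append.1 hv with hh | hh
    · exact h.rcI v hh
    · exact h'.rcI v hh
  · intro τ hτ
    rcases List.mem_append.1 hτ with hh | hh
    · exact h.sd τ hh
    · exact h'.sd τ hh
  · rw [List.length_append]; have := h.len; have := h'.len; omega
  · rw [List.map_append, List.sum_append, h.sum, h'.sum]; push_cast; ring

/-- supply of `m` inside units -/
lemma supply {G : Γ → SimpleGraph V} {k : ℕ} (hy : Hyp G k) {A B : Finset V} {I : Finset Γ} {l : ℝ} {At U : Finset V} (hU : U ⊆ At)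
    (hAt : ∀ x ∈ At, l ≤ lk G I x B) (hUl : ∀ x ∈ U, l ≤ lk G I x A) {d : ℕ} (hd : At.card = k + 1 + d)
    (q : ℝ) (hq0 : 0 ≤ q) (hq : ∀ z ∈ At \ U, (lk G I z At : ℝ) ≤ q)
    (h1 : 2 * d ≤ I.card) (h2 : 5 * d ≤ At.card)
    (hbig : 4 * q < ((I.card : ℝ) - 2 * d) * (At.card - 5 * d))
    (m : ℕ) (hm : m ≤ 2 * d ∨ (m ≤ 2 * d + 1 ∧ U.card ≠ d)) :
    ∃ L, Sup G A B I l At At m L := by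
  have hmono : ∀ {Y : Finset V} {L}, Y ⊆ At → Sup G A B I l At Y m L → Sup G A B I l At At m L := by
    intro Y L hY h
    exact ⟨h.f, h.rv, fun v hv => hY (h.rvA v hv), h.rc, h.rcI, h.sd, h.len, h.sum⟩
  by_cases hmu : m ≤ 2 * U.card
  · obtain ⟨L, hL, _⟩ := supU (B := B) hU hAt hUl m hmu
    exact ⟨L, hmono hU hL⟩
  · have hUd : U.card < d := by omega
    obtain ⟨r, hr⟩ : ∃ r, d = U.card + r := ⟨d - U.card, by omega⟩
    have hZc : (At \ U).card + U.card = At.card := Finset.card_sdiff_add_card_eq_card hU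
    have hbd : ∀ z ∈ At, ∀ γ, r ≤ (nb G γ z ∩ (At \ U)).card := by
      intro z hz γ
      have h3 := hy.dg γ z
      have h4 : nb G γ z ⊆ (nb G γ z ∩ (At \ U)) ∪ Atᶜ ∪ U := by
        intro v hv
        simp only [Finset.mem_union, Finset.mem_inter, Finset.mem_sdiff, Finset.mem_compl]
        tauto
      have h5 := (Finset.card_le_card h4).trans (Finset.card_union_le _ _)
      have h6 := Finset.card_union_le (nb G γ z ∩ (At \ U)) Atᶜ
      have h7 : Atᶜ.card = 2 * k + 1 - At.card := by rw [Finset.card_compl, hy.cV]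
      omega
    obtain ⟨M, M1, M2, M3, M4⟩ := matching (G := G) I (At \ U) r (by omega) (fun γ _ z hz => hbd z (Finset.mem_sdiff.1 hz).1 γ) q hq0
      (by
        intro z hz
        refine le_trans ?_ (hq z hz)
        rw [lk_eq_sum, lk_eq_sum]
        exact_mod_cast Finset.sum_le_sum (fun γ _ => Finset.card_le_card (Finset.inter_subset_inter_left Finset.sdiff_subset)))
      (by omega) (by omega)
      (by
        refine hbig.trans_le ?_
        have z1 : (d : ℝ) = U.card + r := by exact_mod_cast hr
        have z2 : ((At \ U).card : ℝ) + U.card = At.card := by exact_mod_cast hZc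
        have z3 : (5 * d : ℝ) ≤ At.card := by exact_mod_cast h2
        have z4 : (2 * d : ℝ) ≤ I.card := by exact_mod_cast h1
        have z5 : (0 : ℝ) ≤ U.card := by positivity
        apply mul_le_mul <;> linarith)
      (m - 2 * U.card) (by omega)
    obtain ⟨L2, hL2⟩ := supM (A := A) (B := B) (l := l) (Finset.sdiff_subset : At \ U ⊆ At) hAt M M2 M3 M4
    obtain ⟨L1, hL1, hrc⟩ := supU (B := B) hU hAt hUl (2 * U.card) le_rfl
    have h := hL1.append hL2 Finset.disjoint_sdiff (by rw [hrc]; simp)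
    rw [M1, show 2 * U.card + (m - 2 * U.card) = m by omega] at h
    exact ⟨L1 ++ L2, hmono (Finset.union_subset hU Finset.sdiff_subset) h⟩
end IReg
end TH

open SimpleGraph
set_option linter.unusedSectionVars false
set_option linter.unusedVariables false
namespace TH
open scoped Classical

section IMain
variable {V Γ : Type} [Fintype V] [Fintype Γ]

/-- conclusion (a) -/
def Ca (G : Γ → SimpleGraph V) (k : ℕ) : Prop :=
  ∃ A : Finset V, A.card = k + 1 ∧ (∀ γ, ∀ x ∈ A, ∀ y ∈ A, ¬ (G γ).Adj x y) ∧
    (∀ γ, ∀ x ∈ A, ∀ y, y ∉ A → (G γ).Adj x y)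

lemma acase {G : Γ → SimpleGraph V} {k : ℕ} (hy : Hyp G k) (Z : Finset V) (hZ : Z.card = k + 1)
    (h : ∀ γ, ∀ x ∈ Z, ∀ y ∈ Z, ¬ (G γ).Adj x y) : Ca G k := by
  refine ⟨Z, hZ, h, ?_⟩
  intro γ x hx y hyZ
  have h1 : nb G γ x ⊆ Zᶜ := by
    intro v hv
    rw [Finset.mem_compl]
    intro hvZ
    exact h γ x hx v hvZ (mem_nb.1 hv)
  have h2 : nb G γ x = Zᶜ := by
    apply Finset.eq_of_subset_of_card_le h1
    rw [Finset.card_compl, hy.cV, hZ]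
    have := hy.dg γ x
    omega
  rw [← mem_nb, h2]; simpa using hyZ

lemma signed_items {G : Γ → SimpleGraph V} {A B At : Finset V} {C : Finset Γ} {l : ℝ} (F : Finset Γ)
    (hF : ∀ γ ∈ F, l ≤ ed G γ A A) (hF' : ∀ γ ∈ F, l ≤ ed G γ B B) (a : ℕ) (ha : a ≤ F.card) :
    ∃ L : List (Task V Γ), L.flatMap Task.rv = [] ∧ L.flatMap Task.rc = F.toList ∧ L.length = F.card ∧
      (∀ τ ∈ L, τ.sds ≠ (false, true)) ∧ (L.map (ph At)).sum = 2 * a - F.card ∧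
      ∀ τ ∈ L, τ.feas G A B C l := by
  obtain ⟨l1, l2, e, hl1⟩ := split_list F.toList a (by rw [Finset.length_toList]; exact ha)
  have hlen : l1.length + l2.length = F.card := by
    rw [← List.length_append, ← e, Finset.length_toList]
  refine ⟨l1.map (fun γ => .colr γ true true) ++ l2.map (fun γ => .colr γ false false), ?_, ?_, ?_, ?_, ?_, ?_⟩
  · rw [List.flatMap_append, flatMap_none, flatMap_none]
    · rfl
    · intro a _; rfl
    · intro a _; rfl
  · rw [List.flatMap_append, flatMap_single _ _ id, flatMap_single _ _ id, List.map_id, List.map_id, e]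
    · intro a _; rfl
    · intro a _; rfl
  · simp [hlen]
  · intro τ hτ
    rw [List.mem_append, List.mem_map, List.mem_map] at hτ
    rcases hτ with ⟨γ, hγ, rfl⟩ | ⟨γ, hγ, rfl⟩ <;> simp [Task.sds]
  · rw [List.map_append, List.sum_append, List.map_map, List.map_map, sum_map_const _ 1, sum_map_const _ (-1)]
    · rw [hl1, ← hlen, hl1]; push_cast; ring
    · intro γ _; simp [ph, Task.rv, Task.sds, TH.hs]
    · intro γ _; simp [ph, Task.rv, Task.sds, TH.hs]
  · intro τ hτ
    rw [List.mem_append, List.mem_map, List.mem_map] at hτ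
    rcases hτ with ⟨γ, hγ, rfl⟩ | ⟨γ, hγ, rfl⟩
    · exact hF γ (Finset.mem_toList.1 (e ▸ List.mem_append_left _ hγ))
    · exact hF' γ (Finset.mem_toList.1 (e ▸ List.mem_append_right _ hγ))

set_option maxHeartbeats 4000000 in
lemma Iaux {G : Γ → SimpleGraph V} {k : ℕ} {A B : Finset V} {I K : Finset Γ}
    (S : Setup G k (1 / 10 ^ 16) A B I K) (hk : 10 ^ 20 ≤ k) (hK : 1000 * K.card < 2 * k + 1)
    (At : Finset V) (hAAt : A ⊆ At) (hBAt : ∀ b ∈ B, b ∉ At) (hAk : k + 1 ≤ At.card)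
    (hAt : ∀ x ∈ At, (21 / 1000 * (2 * k + 1 : ℕ) ^ 2 : ℝ) ≤ lk G I x B)
    (hBt : ∀ x, x ∉ At → (21 / 1000 * (2 * k + 1 : ℕ) ^ 2 : ℝ) ≤ lk G I x A) : THC G ∨ Ca G k := by
  have hX := setup_X S
  have hcA := S.cA
  have hcB := S.cB
  have hrest := S.rest
  have hcV := S.hyp.cV
  have hN := hN_num (n := 2 * k + 1) (by omega)
  have hedXA := ed_two S.hyp A B A
  have hedXB := ed_two S.hyp B A B
  rw [Finset.union_comm B A] at hedXB
  rw [← hcV] at hN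
  have hKI : I.card + K.card + ((I ∪ K)ᶜ).card = 2 * k + 1 := by
    rw [← Finset.card_union_of_disjoint S.ctx.dIK, Finset.card_add_card_compl, S.hyp.cG]
  set X := ((A ∪ B)ᶜ).card with hXd
  set l : ℝ := 21 / 1000 * ((2 * k + 1 : ℕ) : ℝ) ^ 2 with hl
  obtain ⟨n, hn⟩ : ∃ n, n = 2 * k + 1 := ⟨_, rfl⟩
  rw [hcV, ← hn] at hX hcA hcB hrest
  have hnk : (n : ℝ) = 2 * k + 1 := by rw [hn]; push_cast; ring
  have hn20 : (2 * 10 ^ 20 : ℝ) ≤ n := by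
    have : (10 ^ 20 : ℝ) ≤ k := by exact_mod_cast hk
    linarith
  have hXX : (X : ℝ) ≤ 2 / 10 ^ 16 * n := by linarith
  rw [← hn] at hl
  set s : ℕ := n / 100 with hs
  have hs1 : (s : ℝ) ≤ 1 / 100 * n := by
    have : 100 * s ≤ n := by omega
    have : (100 * s : ℝ) ≤ n := by exact_mod_cast this
    linarith
  have hls : (2 * (s + 5) * (2 * k + 1 : ℕ) : ℝ) < l := by
    rw [← hn, hl]; nlinarith
  have hAn : 100 * n ≤ 201 * A.card ∧ 100 * n ≤ 201 * B.card ∧ 10 ^ 15 * X ≤ n ∧ 10 ^ 15 * ((I ∪ K)ᶜ).card ≤ n ∧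
      10 ^ 10 * n ≤ 2 * 10 ^ 10 * A.card + n ∧ 10 ^ 10 * n ≤ 2 * 10 ^ 10 * B.card + n := by
    refine ⟨?_, ?_, ?_, ?_, ?_, ?_⟩
    · have : (100 * n : ℝ) ≤ 201 * A.card := by linarith
      exact_mod_cast this
    · have : (100 * n : ℝ) ≤ 201 * B.card := by linarith
      exact_mod_cast this
    · have : (10 ^ 15 * X : ℝ) ≤ n := by linarith
      exact_mod_cast this
    · have : (10 ^ 15 * ((I ∪ K)ᶜ).card : ℝ) ≤ n := by linarith
      exact_mod_cast this
    · have : (10 ^ 10 * n : ℝ) ≤ 2 * 10 ^ 10 * A.card + n := by linarith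
      exact_mod_cast this
    · have : (10 ^ 10 * n : ℝ) ≤ 2 * 10 ^ 10 * B.card + n := by linarith
      exact_mod_cast this
  obtain ⟨b1, b2, b3, b4, b5, b6⟩ := hAn
  have hclg : ∀ C D : Finset V, (∀ γ, C.card * k ≤ ed G γ C C + ed G γ C D + C.card * X) →
      (1 / 2 - 1 / 10 ^ 16) * (n : ℝ) ≤ C.card → ∀ γ, ¬ (l ≤ ed G γ C D) → l ≤ ed G γ C C := by
    intro C D hed hC γ h
    have h1 : ((C.card * k : ℕ) : ℝ) ≤ ((ed G γ C C + ed G γ C D + C.card * X : ℕ) : ℝ) := by exact_mod_cast hed γ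
    push_cast at h1
    push Not at h
    have h2 : (0.4 * n) * (k - X) ≤ (C.card : ℝ) * (k - X) := by
      apply mul_le_mul_of_nonneg_right <;> linarith
    have h3 : (0.4 * n) * (0.4 * n) ≤ (0.4 * n) * (k - X : ℝ) := by
      apply mul_le_mul_of_nonneg_left <;> linarith
    nlinarith
  have hclA := hclg A B hedXA hcA
  have hclB : ∀ γ, ¬ (l ≤ ed G γ A B) → l ≤ ed G γ B B := by
    intro γ h
    rw [ed_comm] at h
    exact hclg B A (fun γ => by have := hedXB γ; omega) hcB γ h
  have hIc : (Iᶜ).card = K.card + ((I ∪ K)ᶜ).card := by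
    rw [Finset.card_compl, S.hyp.cG]; omega
  obtain ⟨d, hd⟩ : ∃ d, At.card = k + 1 + d := ⟨At.card - (k + 1), by omega⟩
  have hAtB : At.card + B.card ≤ n := by
    have : At ⊆ Bᶜ := fun x hx => Finset.mem_compl.2 (fun h => hBAt x h hx)
    have := Finset.card_le_card this
    rw [Finset.card_compl, hcV] at this
    omega
  have hAtc : Atᶜ.card = k - d := by rw [Finset.card_compl, hcV]; omega
  have hdk : d ≤ k := by omega
  have hdn : 10 ^ 9 * d ≤ n := by omega
  set U := At.filter (fun x => l ≤ lk G I x A) with hU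
  have hUs : U ⊆ At := Finset.filter_subset _ _
  have hUl : ∀ x ∈ U, l ≤ lk G I x A := fun x hx => (Finset.mem_filter.1 hx).2
  set F := (Iᶜ).filter (fun γ => ¬ (l ≤ ed G γ A B)) with hF
  have hFc : F.card ≤ Iᶜ.card := Finset.card_le_card (Finset.filter_subset _ _)
  have hq : ∀ z ∈ At \ U, (lk G I z At : ℝ) ≤ 0.03 * n ^ 2 := by
    intro z hz
    rw [Finset.mem_sdiff] at hz
    have h1 : (lk G I z A : ℝ) < l := by
      by_contra hc
      exact hz.2 (Finset.mem_filter.2 ⟨hz.1, not_lt.1 hc⟩)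
    have h2 : lk G I z At ≤ lk G I z A + I.card * X := by
      rw [lk_eq_sum, lk_eq_sum, ← smul_eq_mul, ← Finset.sum_const, ← Finset.sum_add_distrib]
      apply Finset.sum_le_sum
      intro γ _
      refine le_trans (Finset.card_le_card ?_) (Finset.card_union_le _ _)
      intro v hv
      rw [Finset.mem_inter] at hv
      by_cases hvA : v ∈ A
      · exact Finset.mem_union_left _ (Finset.mem_inter.2 ⟨hv.1, hvA⟩)
      · apply Finset.mem_union_right
        rw [Finset.mem_compl, Finset.mem_union, not_or]
        exact ⟨hvA, fun h => hBAt v h hv.2⟩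
    have h3 : (lk G I z At : ℝ) ≤ lk G I z A + I.card * X := by exact_mod_cast h2
    have h4 : (I.card : ℝ) ≤ n := by
      have : I.card ≤ n := by omega
      exact_mod_cast this
    have h5 : (I.card : ℝ) * X ≤ n * (2 / 10 ^ 16 * n) := by
      apply mul_le_mul <;> first | assumption | positivity
    nlinarith
  have hsup : ∀ m, (m ≤ 2 * d ∨ (m ≤ 2 * d + 1 ∧ U.card ≠ d)) → ∃ L, Sup G A B I l At At m L := by
    refine supply S.hyp hUs hAt hUl hd (0.03 * n ^ 2) (by positivity) hq (by omega) (by omega) ?_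
    have z1 : (0.9 * n : ℝ) ≤ I.card - 2 * d := by
      have : 9 * n + 20 * d ≤ 10 * I.card := by omega
      have : (9 * n + 20 * d : ℝ) ≤ 10 * I.card := by exact_mod_cast this
      linarith
    have z2 : (0.4 * n : ℝ) ≤ At.card - 5 * d := by
      have : 4 * n + 50 * d ≤ 10 * At.card := by omega
      have : (4 * n + 50 * d : ℝ) ≤ 10 * At.card := by exact_mod_cast this
      linarith
    have z3 : (0.9 * n) * (0.4 * n) ≤ ((I.card : ℝ) - 2 * d) * (At.card - 5 * d) := by
      apply mul_le_mul z1 z2 (by positivity) (by linarith)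
    nlinarith
  have fin : ∀ (E L : List (Task V Γ)) (m a : ℕ) (F' : Finset Γ) (Y : Finset V), Sup G A B I l At Y m L → m ≤ 2 * d + 1 →
      E.length ≤ 1 → (∀ τ ∈ E, τ.feas G A B I l) → (E.flatMap Task.rv).Nodup → (E.flatMap Task.rc).Nodup →
      (∀ v ∈ E.flatMap Task.rv, v ∉ L.flatMap Task.rv) → (∀ v ∈ E.flatMap Task.rc, v ∉ L.flatMap Task.rc) →
      (∀ τ ∈ E, τ.sds ≠ (false, true)) → (∀ γ ∈ F', γ ∈ F) → (∀ γ ∈ E.flatMap Task.rc, γ ∉ F') →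
      (∀ γ ∈ F, γ ∈ F' ∨ γ ∈ E.flatMap Task.rc) → a ≤ F'.card →
      (2 * (d : ℤ) + 1 = (E.map (ph At)).sum + (m + (2 * a - F'.card))) → THC G := by
    intro E L m a F' Y hL hm e1 e2 e3 e4 e5 e6 e7 f1 f2 f3 ha hsum
    obtain ⟨Q, q1, q2, q3, q4, q5, q6⟩ := signed_items (G := G) (A := A) (B := B) (At := At) (C := I) (l := l) F'
      (fun γ h => hclA γ (Finset.mem_filter.1 (f1 γ h)).2) (fun γ h => hclB γ (Finset.mem_filter.1 (f1 γ h)).2) a ha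
    have hF'c : F'.card ≤ F.card := Finset.card_le_card (fun γ h => f1 γ h)
    refine I0 S (n / 10 ^ 7) (by rw [hn, ← hcV]; exact hN) (l := l) (s := s) hls At hAAt hBAt hAt hBt (E ++ (L ++ Q))
      ?_ ?_ ?_ ?_ ?_ ?_ ?_ ?_ ?_
    · intro τ hτ
      rw [List.mem_append, List.mem_append] at hτ
      rcases hτ with h | h | h
      · exact e2 τ h
      · exact hL.f τ h
      · exact q6 τ h
    · rw [List.flatMap_append, List.flatMap_append, q1, List.append_nil, List.nodup_append]
      refine ⟨e3, hL.rv, ?_⟩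
      rintro x hx y hy rfl
      exact e5 x hx hy
    · rw [List.flatMap_append, List.flatMap_append, q2, List.nodup_append, List.nodup_append]
      refine ⟨e4, ⟨hL.rc, Finset.nodup_toList _, ?_⟩, ?_⟩
      · rintro x hx y hy rfl
        have h1 := hL.rcI x hx
        have h2 := (Finset.mem_filter.1 (f1 x (Finset.mem_toList.1 hy))).1
        simp [h1] at h2
      · rintro x hx y hy rfl
        rcases List.mem_append.1 hy with h | h
        · exact e6 x hx h
        · exact f2 x hx (Finset.mem_toList.1 h)
    · intro γ h1 h2
      rw [List.flatMap_append, List.flatMap_append, q2, List.mem_append, List.mem_append, not_or, not_or, Finset.mem_toList] at h2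
      by_contra hc
      rcases f3 γ (Finset.mem_filter.2 ⟨by simpa using h1, hc⟩) with h | h
      · exact h2.2.2 h
      · exact h2.1 h
    · rw [List.length_append, List.length_append, q3, ← hXd]
      have := hL.len
      omega
    · omega
    · omega
    · intro τ hτ
      rw [List.mem_append, List.mem_append] at hτ
      rcases hτ with h | h | h
      · exact e7 τ h
      · exact hL.sd τ h
      · exact q4 τ h
    · rw [List.map_append, List.map_append, List.sum_append, List.sum_append, hL.sum, q5, ← hsum, hAtc, hd]
      push_cast [hdk]; ring
  have fin0 : ∀ (L : List (Task V Γ)) (m a : ℕ), Sup G A B I l At At m L → m ≤ 2 * d + 1 → a ≤ F.card →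
      (2 * (d : ℤ) + 1 = m + (2 * a - F.card)) → THC G := by
    intro L m a hL hm ha hsum
    refine fin [] L m a F At hL hm (by simp) (by simp) (by simp) (by simp) (by simp) (by simp) (by simp) (fun _ h => h) (by simp)
      (fun _ h => Or.inl h) ha ?_
    rw [hsum]; simp
  rcases Nat.even_or_odd' F.card with ⟨c, hc | hc⟩
  · by_cases hUd : U.card = d
    · by_cases hc0 : c = 0
      · -- no noncrossable colours
        have hF0 : F = ∅ := Finset.card_eq_zero.1 (by omega)
        by_cases hE : ∃ γ, ∃ x ∈ At \ U, ∃ y ∈ At \ U, (G γ).Adj x y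
        · left
          obtain ⟨γ, x, hx, y, hy, hadj⟩ := hE
          rw [Finset.mem_sdiff] at hx hy
          obtain ⟨L, hL, hrc⟩ := supU (B := B) hUs hAt hUl (2 * d) (by omega)
          refine fin [.edge x γ y false false] L (2 * d) 0 ∅ U hL (by omega) (by simp) ?_ ?_ ?_ ?_ ?_ ?_ (by simp) (by simp) ?_ (by simp) ?_
          · intro τ hτ
            rw [List.mem_singleton] at hτ
            subst hτ
            exact ⟨hadj, hAt x hx.1, hAt y hy.1⟩
          · simp [Task.rv, hadj.ne]
          · simp [Task.rc]
          · intro v hv hv'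
            have hvU := hL.rvA v hv'
            simp only [List.flatMap_cons, List.flatMap_nil, Task.rv, List.append_nil, List.mem_cons, List.not_mem_nil, or_false] at hv
            rcases hv with rfl | rfl
            · exact hx.2 hvU
            · exact hy.2 hvU
          · rw [hrc]; simp
          · simp [Task.sds]
          · rw [hF0]; simp
          · simp [ph, Task.rv, Task.sds, wt, hx.1, hy.1, TH.hs]; ring
        · right
          push Not at hE
          apply acase S.hyp (At \ U)
          · rw [Finset.card_sdiff_of_subset hUs]; omega
          · exact hE
      · left
        by_cases hd0 : d = 0
        · -- special edge
          subst hd0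
          obtain ⟨γ0, hγ0⟩ : F.Nonempty := Finset.card_pos.1 (by omega)
          obtain ⟨b, hb⟩ : B.Nonempty := Finset.card_pos.1 (by omega)
          have : ∃ w ∈ At, (G γ0).Adj b w := by
            by_contra hcon
            push Not at hcon
            have h1 : nb G γ0 b ⊆ Atᶜ.erase b := by
              intro w hw
              rw [mem_nb] at hw
              rw [Finset.mem_erase, Finset.mem_compl]
              exact ⟨hw.ne', fun h => hcon w h hw⟩
            have h2 := Finset.card_le_card h1
            rw [Finset.card_erase_of_mem (Finset.mem_compl.2 (hBAt b hb))] at h2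
            have h3 := S.hyp.dg γ0 b
            omega
          obtain ⟨w, hw, hadj⟩ := this
          obtain ⟨L, hL, hrc⟩ := supU (B := B) hUs hAt hUl 0 (by omega)
          have hcF : (F.erase γ0).card = F.card - 1 := Finset.card_erase_of_mem hγ0
          have hrv : L.length = 0 := by have := hL.len; omega
          have hL0 : L = [] := List.length_eq_zero_iff.1 hrv
          subst hL0
          refine fin [.edge b γ0 w true false] [] 0 c (F.erase γ0) U hL (by omega) (by simp) ?_ ?_ ?_ ?_ ?_ ?_ ?_ ?_ ?_ ?_ ?_
          · intro τ hτ
            rw [List.mem_singleton] at hτ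
            subst hτ
            exact ⟨hadj, hBt b (hBAt b hb), hAt w hw⟩
          · simp [Task.rv, hadj.ne]
          · simp [Task.rc]
          · simp
          · simp
          · simp [Task.sds]
          · intro γ h; exact Finset.mem_of_mem_erase h
          · simp [Task.rc]
          · intro γ h
            by_cases hh : γ = γ0
            · right; simp [Task.rc, hh]
            · left; exact Finset.mem_erase.2 ⟨hh, h⟩
          · omega
          · rw [hcF, hc]
            have : ((2 * c - 1 : ℕ) : ℤ) = 2 * c - 1 := by omega
            rw [this]
            simp [ph, Task.rv, Task.sds, wt, hBAt b hb, hw, TH.hs]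
        · obtain ⟨L, hL⟩ := hsup (2 * d - 1) (Or.inl (by omega))
          refine fin0 L (2 * d - 1) (c + 1) hL (by omega) (by omega) ?_
          omega
    · left
      obtain ⟨L, hL⟩ := hsup (2 * d + 1) (Or.inr ⟨le_rfl, hUd⟩)
      refine fin0 L (2 * d + 1) c hL le_rfl (by omega) ?_
      omega
  · left
    obtain ⟨L, hL⟩ := hsup (2 * d) (Or.inl le_rfl)
    refine fin0 L (2 * d) (c + 1) hL (by omega) (by omega) ?_
    omega

theorem Ireg {G : Γ → SimpleGraph V} {k : ℕ} {A B : Finset V} {I K : Finset Γ}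
    (S : Setup G k (1 / 10 ^ 16) A B I K) (hk : 10 ^ 20 ≤ k) (hK : 1000 * K.card < 2 * k + 1) : THC G ∨ Ca G k := by
  have hX := setup_X S
  have hcA := S.cA
  have hcB := S.cB
  have hcV := S.hyp.cV
  have hrest := S.rest
  have hKI : I.card + K.card + ((I ∪ K)ᶜ).card = 2 * k + 1 := by
    rw [← Finset.card_union_of_disjoint S.ctx.dIK, Finset.card_add_card_compl, S.hyp.cG]
  obtain ⟨n, hn⟩ : ∃ n, n = 2 * k + 1 := ⟨_, rfl⟩
  set X := ((A ∪ B)ᶜ).card with hXd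
  rw [hcV, ← hn] at hX hcA hcB hrest
  have hnk : (n : ℝ) = 2 * k + 1 := by rw [hn]; push_cast; ring
  have hn20 : (2 * 10 ^ 20 : ℝ) ≤ n := by
    have : (10 ^ 20 : ℝ) ≤ k := by exact_mod_cast hk
    linarith
  have hKI' : (I.card : ℝ) + K.card + ((I ∪ K)ᶜ).card = n := by rw [hn]; exact_mod_cast hKI
  have hKR : 1000 * (K.card : ℝ) < n := by rw [hn]; exact_mod_cast hK
  have hIn : 0.9 * (n : ℝ) ≤ I.card := by linarith
  have hgen : ∀ (C D : Finset V), (1 / 2 - 1 / 10 ^ 16) * (n : ℝ) ≤ D.card → Near G (1 / 10 ^ 16 * (Fintype.card V : ℝ) ^ 2) (C, I, D) →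
      ∀ a ∈ C, (21 / 1000 * (2 * k + 1 : ℕ) ^ 2 : ℝ) ≤ lk G I a D := by
    intro C D hC hN a ha
    have h1 := hN.tl a ha
    have h2 := lk_add_mk G I a D
    have h2 : (lk G I a D : ℝ) + mk G I a D = D.card * I.card := by exact_mod_cast h2
    have h3 : (mk G I a D : ℝ) ≤ 1 / 10 ^ 16 * n ^ 2 := by rw [hn, ← hcV]; exact h1
    have h4 : (0.4 * n) * (0.9 * n) ≤ (D.card : ℝ) * I.card := by
      apply mul_le_mul <;> linarith
    rw [← hn]
    nlinarith
  have hlA := hgen A B hcB S.ctx.nAB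
  have hlB := hgen B A hcA S.ctx.nBA
  have hdi : ∀ x, ¬ ((21 / 1000 * (2 * k + 1 : ℕ) ^ 2 : ℝ) ≤ lk G I x B) → (21 / 1000 * (2 * k + 1 : ℕ) ^ 2 : ℝ) ≤ lk G I x A := by
    intro x h
    have h1 := lk_two S.hyp A B I x
    have h1 : ((I.card : ℝ)) * k ≤ lk G I x A + lk G I x B + I.card * X := by exact_mod_cast h1
    push Not at h
    rw [← hn] at h ⊢
    have h2 : (0.9 * n : ℝ) * (0.4 * n) ≤ I.card * (k - X) := by
      apply mul_le_mul <;> linarith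
    nlinarith
  set At := A ∪ (Bᶜ).filter (fun x => (21 / 1000 * (2 * k + 1 : ℕ) ^ 2 : ℝ) ≤ lk G I x B) with hAt
  have q1 : ∀ x ∈ At, (21 / 1000 * (2 * k + 1 : ℕ) ^ 2 : ℝ) ≤ lk G I x B := by
    intro x hx
    rcases Finset.mem_union.1 hx with h | h
    · exact hlA x h
    · exact (Finset.mem_filter.1 h).2
  have q2 : ∀ x, x ∉ At → (21 / 1000 * (2 * k + 1 : ℕ) ^ 2 : ℝ) ≤ lk G I x A := by
    intro x hx
    by_cases hB : x ∈ B
    · exact hlB x hB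
    · apply hdi
      intro h
      exact hx (Finset.mem_union_right _ (Finset.mem_filter.2 ⟨by simp [hB], h⟩))
  have q3 : ∀ b ∈ B, b ∉ At := by
    intro b hb h
    rcases Finset.mem_union.1 h with h | h
    · exact Finset.disjoint_left.1 S.ctx.dAB h hb
    · have := (Finset.mem_filter.1 h).1
      simp [hb] at this
  by_cases hc : k + 1 ≤ At.card
  · exact Iaux S hk hK At Finset.subset_union_left q3 hc q1 q2
  · refine Iaux S.swap hk hK Atᶜ ?_ ?_ ?_ ?_ ?_
    · intro b hb
      rw [Finset.mem_compl]
      exact q3 b hb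
    · intro a ha
      rw [Finset.mem_compl, not_not]
      exact Finset.mem_union_left _ ha
    · rw [Finset.card_compl, hcV]; omega
    · intro x hx; exact q2 x (Finset.mem_compl.1 hx)
    · intro x hx; exact q1 x (by simpa using hx)

theorem extremal {G : Γ → SimpleGraph V} {k : ℕ} (hy : Hyp G k) (hk : 10 ^ 20 ≤ k) {A : Finset V} {I K : Finset Γ}
    (h : ExtW G ((1 / 10 ^ 16 : ℝ) ^ 2 / 8) A I K) : THC G ∨ Ca G k ∨ Cb G k := by
  obtain ⟨A1, B1, S⟩ := setup_exists hy (by norm_num) (by norm_num) h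
  by_cases hK : 2 * k + 1 ≤ 1000 * K.card
  · rcases Kreg S hk hK with h | h
    · exact Or.inl h
    · exact Or.inr (Or.inr h)
  · rcases Ireg S hk (by omega) with h | h
    · exact Or.inl h
    · exact Or.inr (Or.inl h)
end IMain
end TH

open SimpleGraph
set_option linter.unusedSectionVars false
set_option linter.unusedVariables false
namespace TH
open scoped Classical

section PathD
variable {V Γ : Type}

/-- indicator of a violated joint -/
noncomputable def bad (G : Γ → SimpleGraph V) (c : Γ) (x y : V) : ℕ := if (G c).Adj x y then 0 else 1

lemma bad_symm (G : Γ → SimpleGraph V) (c : Γ) (x y : V) : bad G c x y = bad G c y x := by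
  simp [bad, SimpleGraph.adj_comm]

lemma bad_le (G : Γ → SimpleGraph V) (c : Γ) (x y : V) : bad G c x y ≤ 1 := by
  unfold bad; split_ifs <;> omega

lemma bad_adj {G : Γ → SimpleGraph V} {c : Γ} {x y : V} (h : (G c).Adj x y) : bad G c x y = 0 := by
  simp [bad, h]

/-- coloured path with given ends, vertex multiset, colour multiset, number of violated joints -/
inductive PD (G : Γ → SimpleGraph V) : V → V → Multiset V → Multiset Γ → ℕ → Prop
  | base (v : V) : PD G v v {v} 0 0
  | join {f l f' l' : V} {vs vs' : Multiset V} {cs cs' : Multiset Γ} {i i' : ℕ} (c : Γ)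
      (h : PD G f l vs cs i) (h' : PD G f' l' vs' cs' i') :
      PD G f l' (vs + vs') (cs + cs' + {c}) (i + i' + bad G c l f')

variable {G : Γ → SimpleGraph V}

lemma PD.cast {f l f' l' : V} {vs vs' : Multiset V} {cs cs' : Multiset Γ} {i i' : ℕ}
    (h : PD G f l vs cs i) (e0 : f = f') (e00 : l = l') (e1 : vs = vs') (e2 : cs = cs') (e3 : i = i') :
    PD G f' l' vs' cs' i' := by
  subst e0 e00 e1 e2 e3; exact h

lemma PD.rev {f l : V} {vs : Multiset V} {cs : Multiset Γ} {i : ℕ} (h : PD G f l vs cs i) :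
    PD G l f vs cs i := by
  induction h with
  | base v => exact PD.base v
  | join c h h' ih ih' =>
    refine (PD.join c ih' ih).cast rfl rfl (by abel) (by abel) ?_
    rw [bad_symm]; ring

/-- up to fewer violations -/
def PL (G : Γ → SimpleGraph V) (f l : V) (vs : Multiset V) (cs : Multiset Γ) (i : ℕ) : Prop :=
  ∃ j, j ≤ i ∧ PD G f l vs cs j

lemma PD.pl {f l : V} {vs : Multiset V} {cs : Multiset Γ} {i : ℕ} (h : PD G f l vs cs i) :
    PL G f l vs cs i := ⟨i, le_rfl, h⟩

lemma PL.rev {f l : V} {vs : Multiset V} {cs : Multiset Γ} {i : ℕ} (h : PL G f l vs cs i) :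
    PL G l f vs cs i := by
  obtain ⟨j, h1, h2⟩ := h
  exact ⟨j, h1, h2.rev⟩

lemma PL.jG {f l f' l' : V} {vs vs' : Multiset V} {cs cs' : Multiset Γ} {i i' : ℕ} (c : Γ)
    (h : PL G f l vs cs i) (h' : PL G f' l' vs' cs' i') (ha : (G c).Adj l f') :
    PL G f l' (vs + vs') (cs + cs' + {c}) (i + i') := by
  obtain ⟨j, h1, h2⟩ := h
  obtain ⟨j', h1', h2'⟩ := h'
  refine ⟨_, ?_, PD.join c h2 h2'⟩
  rw [bad_adj ha]; omega

lemma PL.jB {f l f' l' : V} {vs vs' : Multiset V} {cs cs' : Multiset Γ} {i i' : ℕ} (c : Γ)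
    (h : PL G f l vs cs i) (h' : PL G f' l' vs' cs' i') :
    PL G f l' (vs + vs') (cs + cs' + {c}) (i + i' + 1) := by
  obtain ⟨j, h1, h2⟩ := h
  obtain ⟨j', h1', h2'⟩ := h'
  refine ⟨_, ?_, PD.join c h2 h2'⟩
  have := bad_le G c l f'; omega

lemma sum_glue {A : Type} [AddCommMonoid A] {B : Type} (f g : ℕ → B) (F : B → A) (M N : ℕ) :
    ∑ x ∈ Finset.range (M + N), F (if x < M then f x else g (x - M)) =
    ∑ x ∈ Finset.range M, F (f x) + ∑ x ∈ Finset.range N, F (g x) := by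
  rw [Finset.sum_range_add]
  congr 1
  · exact Finset.sum_congr rfl fun x hx => by rw [if_pos (Finset.mem_range.1 hx)]
  · exact Finset.sum_congr rfl fun x hx => by rw [if_neg (by omega)]; congr 2; omega

/-- indexed version -/
structure Idx (G : Γ → SimpleGraph V) (f l : V) (vs : Multiset V) (cs : Multiset Γ) (i M : ℕ)
    (v : ℕ → V) (c : ℕ → Γ) : Prop where
  h0 : v 0 = f
  hM : v M = l
  hv : vs = ∑ x ∈ Finset.range (M + 1), {v x}
  hc : cs = ∑ x ∈ Finset.range M, {c x}
  hi : i = ∑ x ∈ Finset.range M, bad G (c x) (v x) (v (x + 1))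

lemma PD.idx [Nonempty Γ] {f l : V} {vs : Multiset V} {cs : Multiset Γ} {i : ℕ} (h : PD G f l vs cs i) :
    ∃ M v c, Idx G f l vs cs i M v c := by
  induction h with
  | base u => exact ⟨0, fun _ => u, fun _ => Classical.arbitrary Γ, rfl, rfl, by simp, by simp, by simp⟩
  | join d h h' ih ih' =>
    obtain ⟨M, v, c, ⟨a1, a2, a3, a4, a5⟩⟩ := ih
    obtain ⟨M', v', c', ⟨b1, b2, b3, b4, b5⟩⟩ := ih'
    refine ⟨M + 1 + M', fun x => if x < M + 1 then v x else v' (x - (M + 1)),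
      fun x => if x < M then c x else if x = M then d else c' (x - (M + 1)), ?_, ?_, ?_, ?_, ?_⟩
    · simpa using a1
    · rw [if_neg (by omega), ← b2]; congr 1; omega
    · rw [a3, b3, add_assoc, sum_glue v v' (fun x => ({x} : Multiset V))]
    · rw [a4, b4, add_assoc M, Finset.sum_range_add, add_assoc (Finset.sum _ _)]
      congr 1
      · exact Finset.sum_congr rfl fun x hx => by rw [if_pos (Finset.mem_range.1 hx)]
      · rw [add_comm 1 M', Finset.sum_range_succ']
        congr 1
        · exact Finset.sum_congr rfl fun x hx => by
            rw [if_neg (by omega), if_neg (by omega)]; congr 2; omega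
        · simp
    · rw [a5, b5, add_assoc M, Finset.sum_range_add, add_assoc (Finset.sum _ _)]
      congr 1
      · refine Finset.sum_congr rfl fun x hx => ?_
        have := Finset.mem_range.1 hx
        rw [if_pos this, if_pos (by omega), if_pos (by omega)]
      · rw [add_comm 1 M', Finset.sum_range_succ']
        congr 1
        · refine Finset.sum_congr rfl fun x hx => ?_
          have := Finset.mem_range.1 hx
          rw [if_neg (by omega), if_neg (by omega), if_neg (by omega), if_neg (by omega)]
          have e1 : M + (x + 1) - (M + 1) = x := by omega
          have e2 : M + (x + 1) + 1 - (M + 1) = x + 1 := by omega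
          rw [e1, e2]
        · simp [a2, b1]

lemma seg (v : ℕ → V) (c : ℕ → Γ) (i j : ℕ) (h : i ≤ j) :
    PD G (v i) (v j) (∑ x ∈ Finset.Ico i (j + 1), {v x}) (∑ x ∈ Finset.Ico i j, {c x})
      (∑ x ∈ Finset.Ico i j, bad G (c x) (v x) (v (x + 1))) := by
  induction j, h using Nat.le_induction with
  | base => simpa using PD.base (v i)
  | succ j h ih =>
    refine (PD.join (c j) ih (PD.base (v (j + 1)))).cast rfl rfl ?_ ?_ ?_
    · rw [Finset.sum_Ico_succ_top (b := j + 1) (by omega)]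
    · rw [Finset.sum_Ico_succ_top h, add_zero]
    · rw [Finset.sum_Ico_succ_top h, add_zero]

lemma sum_cut {A : Type} [AddCommMonoid A] (F : ℕ → A) {i j k : ℕ} (h : i ≤ j) (h' : j ≤ k) :
    ∑ x ∈ Finset.Ico i k, F x = ∑ x ∈ Finset.Ico i j, F x + ∑ x ∈ Finset.Ico j k, F x :=
  (Finset.sum_Ico_consecutive F h h').symm

lemma sum_cut1 {A : Type} [AddCommMonoid A] (F : ℕ → A) {i j k : ℕ} (h : i ≤ j) (h' : j < k) :
    ∑ x ∈ Finset.Ico i k, F x = ∑ x ∈ Finset.Ico i j, F x + F j + ∑ x ∈ Finset.Ico (j + 1) k, F x := by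
  rw [sum_cut F h h'.le, Finset.sum_eq_sum_Ico_succ_bot h', add_assoc]

lemma extract [Nonempty Γ] {f l : V} {vs : Multiset V} {cs : Multiset Γ} {i g : ℕ} (h : PD G f l vs cs i)
    (hg : 0 < g) (hi : Multiset.card vs / g + 1 < i) :
    ∃ a b vq cq vm cm im c, PD G a b vq cq 0 ∧ PD G f l vm cm im ∧ Multiset.card vq ≤ g ∧
      vs = vq + vm ∧ cs = cq + cm + {c} ∧ im + 1 ≤ i ∧ i ≤ im + 2 := by
  obtain ⟨M, v, c, ⟨h0, hM, hv, hc, hb⟩⟩ := h.idx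
  have hcard : Multiset.card vs = M + 1 := by rw [hv]; simp
  set B := (Finset.range M).filter (fun x => ¬ (G (c x)).Adj (v x) (v (x + 1))) with hB
  have hBi : B.card = i := by
    rw [hb, hB, Finset.card_filter]
    refine Finset.sum_congr rfl fun x _ => ?_
    by_cases h : (G (c x)).Adj (v x) (v (x + 1)) <;> simp [bad, h]
  obtain ⟨x, hx, y, hy, hxy, he⟩ := Finset.exists_ne_map_eq_of_card_lt_of_maps_to (s := B)
    (t := Finset.range ((M + 1) / g + 1)) (f := fun x => x / g) (by rw [Finset.card_range, hBi, ← hcard]; omega)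
    (by
      intro x hx
      simp only [hB, Finset.coe_filter, Set.mem_setOf_eq, Finset.mem_range] at hx
      simp only [Finset.coe_range, Set.mem_Iio]
      have : x / g ≤ (M + 1) / g := Nat.div_le_div_right (by omega)
      omega)
  have key : ∃ x ∈ B, ∃ y ∈ B, x < y ∧ y < x + g := by
    have e1 := Nat.div_add_mod x g
    have e2 := Nat.div_add_mod y g
    have e3 := Nat.mod_lt x hg
    have e4 := Nat.mod_lt y hg
    rw [he] at e1
    rcases lt_or_gt_of_ne hxy with h | h
    · exact ⟨x, hx, y, hy, h, by omega⟩
    · exact ⟨y, hy, x, hx, h, by omega⟩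
  clear hx hy hxy he x y
  obtain ⟨x, hx, y0, hy0, hxy0, hyx0⟩ := key
  have hex : ∃ y, y ∈ B ∧ x < y := ⟨y0, hy0, hxy0⟩
  obtain ⟨y, ⟨hy, hxy⟩, hyy, hmin⟩ : ∃ y, (y ∈ B ∧ x < y) ∧ y ≤ y0 ∧ ∀ z, z < y → ¬ (z ∈ B ∧ x < z) :=
    ⟨Nat.find hex, Nat.find_spec hex, Nat.find_min' hex ⟨hy0, hxy0⟩, fun z hz => Nat.find_min hex hz⟩
  have hbet : ∀ z, x < z → z < y → (G (c z)).Adj (v z) (v (z + 1)) := by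
    intro z h1 h2
    have := hmin z h2
    by_contra h3
    refine this ⟨?_, h1⟩
    simp only [hB, Finset.mem_filter, Finset.mem_range]
    refine ⟨?_, h3⟩
    have := (Finset.mem_filter.1 hy).1
    rw [Finset.mem_range] at this; omega
  simp only [hB, Finset.mem_filter, Finset.mem_range] at hx hy
  have hbx : bad G (c x) (v x) (v (x + 1)) = 1 := by simp [bad, hx.2]
  have hby : bad G (c y) (v y) (v (y + 1)) = 1 := by
    have := hy.2
    simp only [bad]; rw [if_neg this]
  have p1 := seg (G := G) v c (x + 1) y (by omega)
  have p2 := seg (G := G) v c 0 x (by omega)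
  have p3 := seg (G := G) v c (y + 1) M (by omega)
  have p4 := PD.join (c x) p2 p3
  have hz : ∑ z ∈ Finset.Ico (x + 1) y, bad G (c z) (v z) (v (z + 1)) = 0 := by
    refine Finset.sum_eq_zero fun z hz => ?_
    rw [Finset.mem_Ico] at hz
    exact bad_adj (hbet z (by omega) (by omega))
  rw [hz] at p1
  rw [h0, hM] at p4
  refine ⟨_, _, _, _, _, _, _, c y, p1, p4, ?_, ?_, ?_, ?_⟩
  · simp; omega
  · rw [hv, Finset.range_eq_Ico, sum_cut _ (show 0 ≤ x + 1 by omega) (show x + 1 ≤ M + 1 by omega),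
      sum_cut _ (show x + 1 ≤ y + 1 by omega) (show y + 1 ≤ M + 1 by omega)]
    abel
  · rw [hc, Finset.range_eq_Ico, sum_cut1 _ (show 0 ≤ x by omega) (show x < M by omega),
      sum_cut1 _ (show x + 1 ≤ y by omega) (show y < M by omega)]
    abel
  · rw [Finset.range_eq_Ico, sum_cut1 _ (show 0 ≤ x by omega) (show x < M by omega),
      sum_cut1 _ (show x + 1 ≤ y by omega) (show y < M by omega), hbx, hby, hz] at hb
    have := bad_le G (c x) (v x) (v (y + 1))
    omega

end PathD
end TH

open SimpleGraph
set_option linter.unusedSectionVars false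
set_option linter.unusedVariables false
namespace TH
open scoped Classical

section Recomb
variable {V Γ : Type} {G : Γ → SimpleGraph V}

lemma PL.cast {f l : V} {vs vs' : Multiset V} {cs cs' : Multiset Γ} {i i' : ℕ}
    (h : PL G f l vs cs i) (e1 : vs = vs') (e2 : cs = cs') (e3 : i ≤ i') :
    PL G f l vs' cs' i' := by
  obtain ⟨j, h1, h2⟩ := h
  subst e1 e2; exact ⟨j, by omega, h2⟩

lemma R1 {a₁ e₁ a₂ e₂ a₃ e₃ : V} {v₁ v₂ v₃ : Multiset V} {k₁ k₂ k₃ : Multiset Γ} {d₁ d₂ d₃ : Γ}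
    (q₁ : PL G a₁ e₁ v₁ k₁ 0) (q₂ : PL G a₂ e₂ v₂ k₂ 0) (q₃ : PL G a₃ e₃ v₃ k₃ 0)
    {vs : Multiset V} {cs : Multiset Γ} {M : ℕ} {v : ℕ → V} {c : ℕ → Γ}
    (hv : vs = v₁ + v₂ + v₃ + ∑ x ∈ Finset.range (M + 1), {v x})
    (hc : cs = k₁ + k₂ + k₃ + ∑ x ∈ Finset.range M, {c x} + {d₁} + {d₂} + {d₃})
    (hmin : ∀ f l j, PL G f l vs cs j → ∑ x ∈ Finset.range M, bad G (c x) (v x) (v (x + 1)) + 3 ≤ j)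
    {p : ℕ} (hp : p < M) (h1 : (G d₁).Adj e₁ (v p)) (h2 : (G d₂).Adj e₂ (v (p + 1))) : False := by
  have p1 := (seg (G := G) v c 0 p (by omega)).pl
  have p2 := (seg (G := G) v c (p + 1) M (by omega)).pl
  have w := ((q₃.jB (c p) q₁).jG d₁ p1.rev h1).jB d₃ (q₂.jG d₂ p2 h2)
  rw [Finset.range_eq_Ico, sum_cut _ (show 0 ≤ p + 1 by omega) (show p + 1 ≤ M + 1 by omega)] at hv
  rw [Finset.range_eq_Ico, sum_cut1 _ (show 0 ≤ p by omega) hp] at hc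
  rw [Finset.range_eq_Ico, sum_cut1 _ (show 0 ≤ p by omega) hp] at hmin
  have := hmin _ _ _ (w.cast (vs' := vs) (cs' := cs) (by rw [hv]; abel) (by rw [hc]; abel) le_rfl)
  omega

lemma tri {f x y l f' l' a e : V} {vP vP' vC vQ vs : Multiset V} {cP cP' cC cQ cs : Multiset Γ}
    {iP iP' iC : ℕ} {d₁ g g' : Γ} (P : PL G f x vP cP iP) (P' : PL G y l vP' cP' iP')
    (C : PL G f' l' vC cC iC) (Q : PL G a e vQ cQ 0)
    (h : (G d₁).Adj e x ∨ (G d₁).Adj e y)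
    (hv : vs = vP + vP' + vC + vQ) (hc : cs = cP + cP' + cC + cQ + {d₁} + {g} + {g'}) :
    ∃ f l, PL G f l vs cs (iP + iP' + iC + 2) := by
  rcases h with h | h
  · exact ⟨_, _, (((P.jG d₁ Q.rev h.symm).jB g P').jB g' C).cast (by rw [hv]; abel) (by rw [hc]; abel) (by omega)⟩
  · exact ⟨_, _, ((P.jB g (Q.jG d₁ P' h)).jB g' C).cast (by rw [hv]; abel) (by rw [hc]; abel) (by omega)⟩

lemma R2 {a₁ e₁ a₂ e₂ a₃ e₃ : V} {v₁ v₂ v₃ : Multiset V} {k₁ k₂ k₃ : Multiset Γ} {d₁ d₂ d₃ : Γ}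
    (q₁ : PL G a₁ e₁ v₁ k₁ 0) (q₂ : PL G a₂ e₂ v₂ k₂ 0) (q₃ : PL G a₃ e₃ v₃ k₃ 0)
    {vs : Multiset V} {cs : Multiset Γ} {M : ℕ} {v : ℕ → V} {c : ℕ → Γ}
    (hv : vs = v₁ + v₂ + v₃ + ∑ x ∈ Finset.range (M + 1), {v x})
    (hc : cs = k₁ + k₂ + k₃ + ∑ x ∈ Finset.range M, {c x} + {d₁} + {d₂} + {d₃})
    (hmin : ∀ f l j, PL G f l vs cs j → ∑ x ∈ Finset.range M, bad G (c x) (v x) (v (x + 1)) + 3 ≤ j)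
    {p i j : ℕ} (hp : p < M) (h1 : (G d₁).Adj e₁ (v p) ∨ (G d₁).Adj e₁ (v (p + 1)))
    (hij : i < j) (hjM : j < M - 1) (hpi : p ≠ i + 1) (hpj : p ≠ j)
    (hi2 : (G d₂).Adj e₂ (v i)) (hi3' : (G d₃).Adj e₃ (v (i + 2)))
    (hj2 : (G d₂).Adj e₂ (v j)) (hj3 : (G d₃).Adj e₃ (v j)) (hj2' : (G d₂).Adj e₂ (v (j + 2)))
    (ha : (G (c p)).Adj (v (i + 1)) (v (j + 1))) : False := by
  rcases lt_trichotomy p (i + 1) with h | h | h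
  · have x1 := (seg (G := G) v c 0 p (by omega)).pl
    have x2 := (seg (G := G) v c (p + 1) (i + 1) (by omega)).pl
    have x3 := (seg (G := G) v c (i + 1 + 1) (j + 1) (by omega)).pl
    have x4 := (seg (G := G) v c (j + 1 + 1) M (by omega)).pl
    have hv' := hv
    have hc' := hc
    rw [Finset.range_eq_Ico, sum_cut _ (show 0 ≤ p + 1 by omega) (show p + 1 ≤ M + 1 by omega),
      sum_cut _ (show p + 1 ≤ i + 1 + 1 by omega) (show i + 1 + 1 ≤ M + 1 by omega),
      sum_cut _ (show i + 1 + 1 ≤ j + 1 + 1 by omega) (show j + 1 + 1 ≤ M + 1 by omega)] at hv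
    rw [Finset.range_eq_Ico, sum_cut1 _ (show 0 ≤ p by omega) hp, 
      sum_cut1 _ (show p + 1 ≤ i + 1 by omega) (show i + 1 < M by omega),
      sum_cut1 _ (show i + 1 + 1 ≤ j + 1 by omega) (show j + 1 < M by omega)] at hc
    obtain ⟨f, l, w⟩ := tri (g := c (i + 1)) (g' := c (j + 1)) (vs := vs) (cs := cs) x1
      ((x2.jG (c p) x3.rev ha).jG d₃ q₃.rev hi3'.symm) (q₂.jG d₂ x4 hj2') q₁ h1 
      (by rw [hv]; abel) (by rw [hc]; abel)
    have := hmin _ _ _ w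
    rw [Finset.range_eq_Ico, sum_cut1 _ (show 0 ≤ p by omega) hp, 
      sum_cut1 _ (show p + 1 ≤ i + 1 by omega) (show i + 1 < M by omega),
      sum_cut1 _ (show i + 1 + 1 ≤ j + 1 by omega) (show j + 1 < M by omega)] at this
    omega
  · exact hpi h
  rcases lt_trichotomy p j with h' | h' | h'
  · have x1 := (seg (G := G) v c 0 (i + 1) (by omega)).pl
    have x2 := (seg (G := G) v c (i + 1 + 1) p (by omega)).pl
    have x3 := (seg (G := G) v c (p + 1) j (by omega)).pl
    have x4 := (seg (G := G) v c (j + 1) M (by omega)).pl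
    rw [Finset.range_eq_Ico, sum_cut _ (show 0 ≤ i + 1 + 1 by omega) (show i + 1 + 1 ≤ M + 1 by omega),
      sum_cut _ (show i + 1 + 1 ≤ p + 1 by omega) (show p + 1 ≤ M + 1 by omega),
      sum_cut _ (show p + 1 ≤ j + 1 by omega) (show j + 1 ≤ M + 1 by omega)] at hv
    rw [Finset.range_eq_Ico, sum_cut1 _ (show 0 ≤ i + 1 by omega) (show i + 1 < M by omega),
      sum_cut1 _ (show i + 1 + 1 ≤ p by omega) hp,
      sum_cut1 _ (show p + 1 ≤ j by omega) (show j < M by omega)] at hc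
    obtain ⟨f, l, w⟩ := tri (g := c (i + 1)) (g' := c j) (vs := vs) (cs := cs) (q₃.jG d₃ x2 hi3')
      (x3.jG d₂ q₂.rev hj2.symm) (x1.jG (c p) x4 ha) q₁ h1 
      (by rw [hv]; abel) (by rw [hc]; abel)
    have := hmin _ _ _ w
    rw [Finset.range_eq_Ico, sum_cut1 _ (show 0 ≤ i + 1 by omega) (show i + 1 < M by omega),
      sum_cut1 _ (show i + 1 + 1 ≤ p by omega) hp,
      sum_cut1 _ (show p + 1 ≤ j by omega) (show j < M by omega)] at this
    omega
  · exact hpj h'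
  · have x1 := (seg (G := G) v c 0 i (by omega)).pl
    have x2 := (seg (G := G) v c (i + 1) j (by omega)).pl
    have x3 := (seg (G := G) v c (j + 1) p (by omega)).pl
    have x4 := (seg (G := G) v c (p + 1) M (by omega)).pl
    rw [Finset.range_eq_Ico, sum_cut _ (show 0 ≤ i + 1 by omega) (show i + 1 ≤ M + 1 by omega),
      sum_cut _ (show i + 1 ≤ j + 1 by omega) (show j + 1 ≤ M + 1 by omega),
      sum_cut _ (show j + 1 ≤ p + 1 by omega) (show p + 1 ≤ M + 1 by omega)] at hv
    rw [Finset.range_eq_Ico, sum_cut1 _ (show 0 ≤ i by omega) (show i < M by omega),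
      sum_cut1 _ (show i + 1 ≤ j by omega) (show j < M by omega),
      sum_cut1 _ (show j + 1 ≤ p by omega) hp] at hc
    obtain ⟨f, l, w⟩ := tri (g := c i) (g' := c j) (vs := vs) (cs := cs) 
      ((q₃.jG d₃ x2.rev hj3).jG (c p) x3 ha) x4 (x1.jG d₂ q₂.rev hi2.symm) q₁ h1 
      (by rw [hv]; abel) (by rw [hc]; abel)
    have := hmin _ _ _ w
    rw [Finset.range_eq_Ico, sum_cut1 _ (show 0 ≤ i by omega) (show i < M by omega),
      sum_cut1 _ (show i + 1 ≤ j by omega) (show j < M by omega),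
      sum_cut1 _ (show j + 1 ≤ p by omega) hp] at this
    omega

end Recomb

section NSets

lemma card_pred (S : Finset ℕ) : S.card ≤ (S.erase 0 |>.image (fun x => x - 1)).card + 1 := by
  rw [Finset.card_image_of_injOn]
  · have := Finset.pred_card_le_card_erase (s := S) (a := 0)
    omega
  · intro x hx y hy h
    simp at hx hy h; omega

lemma card_succ (S : Finset ℕ) : (S.image (fun x => x + 1)).card = S.card :=
  Finset.card_image_of_injective _ (fun x y h => by simpa using h)

lemma nsets_inter {M : ℕ} {A B C : Finset ℕ} (hA : A ⊆ Finset.range (M + 1)) (hB : B ⊆ Finset.range (M + 1))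
    (hC : C ⊆ Finset.range (M + 1))
    (h1 : ∀ p, p < M → p ∈ C → p + 1 ∉ A) (h2 : ∀ p, p < M → p ∈ C → p + 1 ∉ B) :
    A.card + B.card + C.card ≤ (A ∩ B).card + M + 2 := by
  have h3 := Finset.card_union_add_card_inter A B
  set C' := (C.erase M).image (fun x => x + 1) with hC'
  have h4 : C'.card = (C.erase M).card := card_succ _
  have h5 := Finset.pred_card_le_card_erase (s := C) (a := M)
  have h6 : Disjoint (A ∪ B) C' := by
    rw [Finset.disjoint_left]
    intro x hx hx'
    simp only [hC', Finset.mem_image, Finset.mem_erase] at hx'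
    obtain ⟨p, ⟨hpM, hpC⟩, rfl⟩ := hx'
    have : p < M := by have := Finset.mem_range.1 (hC hpC); omega
    rcases Finset.mem_union.1 hx with h | h
    · exact h1 p this hpC h
    · exact h2 p this hpC h
  have h7 : (A ∪ B) ∪ C' ⊆ Finset.range (M + 1) := by
    refine Finset.union_subset (Finset.union_subset hA hB) ?_
    intro x hx'
    simp only [hC', Finset.mem_image, Finset.mem_erase] at hx'
    obtain ⟨p, ⟨hpM, hpC⟩, rfl⟩ := hx'
    have := Finset.mem_range.1 (hC hpC)
    simp; omega
  have h8 := Finset.card_le_card h7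
  rw [Finset.card_union_of_disjoint h6, Finset.card_range] at h8
  omega

lemma nsets {M k b : ℕ} {N1 N2 N3 : Finset ℕ} (hM : M + 1 + b = 2 * k + 1)
    (s1 : N1 ⊆ Finset.range (M + 1)) (s2 : N2 ⊆ Finset.range (M + 1)) (s3 : N3 ⊆ Finset.range (M + 1))
    (c1 : k ≤ N1.card + b) (c2 : k ≤ N2.card + b) (c3 : k ≤ N3.card + b)
    (h12 : ∀ p, p < M → p ∈ N1 → p + 1 ∉ N2) (h13 : ∀ p, p < M → p ∈ N1 → p + 1 ∉ N3)
    (h31 : ∀ p, p < M → p ∈ N3 → p + 1 ∉ N1) (h32 : ∀ p, p < M → p ∈ N3 → p + 1 ∉ N2)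
    (h21 : ∀ p, p < M → p ∈ N2 → p + 1 ∉ N1) :
    (∃ T : Finset ℕ, k ≤ T.card + 4 * b + 7 ∧
      ∀ p ∈ T, p < M - 1 ∧ p ∈ N2 ∧ p ∈ N3 ∧ p + 2 ∈ N2 ∧ p + 2 ∈ N3) ∧
    ∃ D : Finset ℕ, D ⊆ Finset.range M ∧ (∀ p ∈ D, p ∈ N1 ∨ p + 1 ∈ N1) ∧ 2 * k ≤ D.card + 3 * b + 4 := by
  have i23 := nsets_inter s2 s3 s1 h12 h13
  have i12 := nsets_inter s1 s2 s3 h31 h32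
  constructor
  · set D := N2 ∩ N3 with hD
    set P := D.image (fun x => x + 1)
    set Q := (D.erase 0).image (fun x => x - 1)
    have e1 : P.card = D.card := card_succ _
    have e2 : D.card ≤ Q.card + 1 := card_pred _
    have hPQ : P ∪ Q ⊆ Finset.range (M + 2) \ N1 := by
      refine Finset.union_subset ?_ ?_
      · intro x hx
        obtain ⟨p, hp, rfl⟩ := Finset.mem_image.1 hx
        rw [hD, Finset.mem_inter] at hp
        have h1 := Finset.mem_range.1 (s2 hp.1)
        rw [Finset.mem_sdiff, Finset.mem_range]
        refine ⟨by omega, fun h => ?_⟩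
        have h2 := Finset.mem_range.1 (s1 h)
        exact h21 p (by omega) hp.1 h
      · intro x hx
        obtain ⟨p, hp, rfl⟩ := Finset.mem_image.1 hx
        rw [hD, Finset.mem_erase, Finset.mem_inter] at hp
        have h1 := Finset.mem_range.1 (s2 hp.2.1)
        rw [Finset.mem_sdiff, Finset.mem_range]
        have h3 := hp.1
        refine ⟨by omega, fun h => ?_⟩
        refine h12 (p - 1) (by omega) h ?_
        rw [show p - 1 + 1 = p by omega]
        exact hp.2.1
    have e3 := Finset.card_le_card hPQ
    rw [Finset.card_sdiff_of_subset (s1.trans (Finset.range_subset_range.2 (by omega))), Finset.card_range] at e3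
    have e4 := Finset.card_union_add_card_inter P Q
    have e5 : N1.card ≤ M + 1 := by simpa using Finset.card_le_card s1
    refine ⟨(P ∩ Q).image (fun x => x - 1), ?_, ?_⟩
    · rw [Finset.card_image_of_injOn]
      · omega
      · intro x hx y hy h
        simp only [Finset.coe_inter, Set.mem_inter_iff, Finset.mem_coe] at hx hy
        obtain ⟨a, _, ha⟩ := Finset.mem_image.1 hx.1
        obtain ⟨b, _, hb⟩ := Finset.mem_image.1 hy.1
        simp only at h ha hb; omega
    · intro p hp
      obtain ⟨x, hx, hxp⟩ := Finset.mem_image.1 hp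
      rw [Finset.mem_inter] at hx
      obtain ⟨a, ha, hax⟩ := Finset.mem_image.1 hx.1
      obtain ⟨b, hb, hbx⟩ := Finset.mem_image.1 hx.2
      rw [Finset.mem_erase] at hb
      have : a = p := by omega
      subst this
      have : b = a + 2 := by omega
      subst this
      rw [hD, Finset.mem_inter] at ha hb
      have h1 := Finset.mem_range.1 (s2 hb.2.1)
      exact ⟨by omega, ha.1, ha.2, hb.2.1, hb.2.2⟩
  · set A := N1.erase M
    set B := ((N1 ∩ N2).erase 0).image (fun x => x - 1)
    have e1 : N1.card - 1 ≤ A.card := Finset.pred_card_le_card_erase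
    have e2 : (N1 ∩ N2).card ≤ B.card + 1 := card_pred _
    have dis : Disjoint A B := by
      rw [Finset.disjoint_left]
      intro x hx hx'
      obtain ⟨p, hp, rfl⟩ := Finset.mem_image.1 hx'
      rw [Finset.mem_erase, Finset.mem_inter] at hp
      have h1 := Finset.mem_range.1 (s1 hp.2.1)
      have h3 := hp.1
      refine h12 (p - 1) (by omega) (Finset.mem_erase.1 hx).2 ?_
      rw [show p - 1 + 1 = p by omega]
      exact hp.2.2
    refine ⟨A ∪ B, ?_, ?_, ?_⟩
    · refine Finset.union_subset ?_ ?_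
      · intro x hx
        rw [Finset.mem_erase] at hx
        have := Finset.mem_range.1 (s1 hx.2)
        have := hx.1
        simp; omega
      · intro x hx'
        obtain ⟨p, hp, rfl⟩ := Finset.mem_image.1 hx'
        rw [Finset.mem_erase, Finset.mem_inter] at hp
        have h1 := Finset.mem_range.1 (s1 hp.2.1)
        have h3 := hp.1
        simp; omega
    · intro p hp
      rcases Finset.mem_union.1 hp with h | h
      · exact Or.inl (Finset.mem_erase.1 h).2
      · obtain ⟨q, hq, rfl⟩ := Finset.mem_image.1 h
        rw [Finset.mem_erase, Finset.mem_inter] at hq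
        have h3 := hq.1
        right; rw [show q - 1 + 1 = q by omega]; exact hq.2.1
    · rw [Finset.card_union_of_disjoint dis]
      omega

end NSets
end TH

open SimpleGraph
set_option linter.unusedSectionVars false
set_option linter.unusedVariables false
namespace TH
open scoped Classical

section Core
variable {V Γ : Type} [Fintype V] [Fintype Γ] {G : Γ → SimpleGraph V}

lemma sum_single_eq {A : Type} (s : Finset ℕ) (f : ℕ → A) : 
    ∑ x ∈ s, ({f x} : Multiset A) = s.val.map f := by
  rw [Finset.sum]
  induction s.val using Multiset.induction_on with
  | empty => simp
  | cons a t ih => simp [ih]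

lemma injOn_of_sum {A : Type} {s : Finset ℕ} {f : ℕ → A} {W : Multiset A} (hW : W.Nodup)
    (h : ∑ x ∈ s, ({f x} : Multiset A) ≤ W) : Set.InjOn f s := by
  rw [sum_single_eq] at h
  have := Multiset.nodup_of_le h hW
  intro x hx y hy hxy
  exact Multiset.inj_on_of_nodup_map this x hx y hy hxy

lemma core_cnt {k M b : ℕ} (hy : Hyp G k) {v : ℕ → V} (hvi : Set.InjOn v (Finset.range (M + 1)))
    (hM : M + 1 + b = 2 * k + 1) (γ : Γ) (e : V) :
    k ≤ ((Finset.range (M + 1)).filter (fun p => (G γ).Adj e (v p))).card + b := by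
  have h1 := hy.dg γ e
  set N := (Finset.range (M + 1)).filter (fun p => (G γ).Adj e (v p))
  have h2 : (N.image v).card ≤ N.card := Finset.card_image_le
  have h3 : ((Finset.range (M + 1)).image v).card = M + 1 := by
    rw [Finset.card_image_of_injOn hvi, Finset.card_range]
  have h4 : nb G γ e ⊆ N.image v ∪ ((Finset.range (M + 1)).image v)ᶜ := by
    intro x hx
    rw [Finset.mem_union]
    by_cases h : x ∈ (Finset.range (M + 1)).image v
    · left
      obtain ⟨p, hp, rfl⟩ := Finset.mem_image.1 h
      exact Finset.mem_image.2 ⟨p, Finset.mem_filter.2 ⟨hp, by simpa using hx⟩, rfl⟩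
    · right; simpa using h
  have h5 := (Finset.card_le_card h4).trans (Finset.card_union_le _ _)
  rw [Finset.card_compl, h3, hy.cV] at h5
  omega

lemma core {k : ℕ} (hy : Hyp G k) {ν β : ℝ} (hne : NE G ν β)
    {a₁ e₁ a₂ e₂ a₃ e₃ : V} {v₁ v₂ v₃ : Multiset V} {k₁ k₂ k₃ : Multiset Γ} {d₁ d₂ d₃ : Γ}
    (q₁ : PL G a₁ e₁ v₁ k₁ 0) (q₂ : PL G a₂ e₂ v₂ k₂ 0) (q₃ : PL G a₃ e₃ v₃ k₃ 0)
    {vs : Multiset V} {cs : Multiset Γ} {M : ℕ} {v : ℕ → V} {c : ℕ → Γ}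
    (hvn : vs.Nodup) (hcn : cs.Nodup)
    (hv : vs = v₁ + v₂ + v₃ + ∑ x ∈ Finset.range (M + 1), {v x})
    (hc : cs = k₁ + k₂ + k₃ + ∑ x ∈ Finset.range M, {c x} + {d₁} + {d₂} + {d₃})
    (hmin : ∀ f l j, PL G f l vs cs j → ∑ x ∈ Finset.range M, bad G (c x) (v x) (v (x + 1)) + 3 ≤ j)
    {b : ℕ} (hM : M + 1 + b = 2 * k + 1)
    (hβ : (4 * b + 9 : ℝ) ≤ β * Fintype.card V) (hν : (3 * b + 9 : ℝ) < ν * Fintype.card V) : False := by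
  have hvi : Set.InjOn v (Finset.range (M + 1)) := injOn_of_sum hvn (by rw [hv]; exact Multiset.le_add_left _ _)
  have hci : Set.InjOn c (Finset.range M) := by
    refine injOn_of_sum hcn ?_
    rw [hc, add_assoc, add_assoc, add_comm (k₁ + k₂ + k₃), add_assoc]; exact Multiset.le_add_right _ _
  set N1 := (Finset.range (M + 1)).filter (fun p => (G d₁).Adj e₁ (v p)) with hN1
  set N2 := (Finset.range (M + 1)).filter (fun p => (G d₂).Adj e₂ (v p)) with hN2
  set N3 := (Finset.range (M + 1)).filter (fun p => (G d₃).Adj e₃ (v p)) with hN3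
  have m1 : ∀ {p}, p ∈ N1 → (G d₁).Adj e₁ (v p) := fun h => (Finset.mem_filter.1 h).2
  have m2 : ∀ {p}, p ∈ N2 → (G d₂).Adj e₂ (v p) := fun h => (Finset.mem_filter.1 h).2
  have m3 : ∀ {p}, p ∈ N3 → (G d₃).Adj e₃ (v p) := fun h => (Finset.mem_filter.1 h).2
  obtain ⟨⟨T, hT, hT'⟩, D, hD, hD', hDc⟩ := nsets (N1 := N1) (N2 := N2) (N3 := N3) hM
    (Finset.filter_subset _ _) (Finset.filter_subset _ _) (Finset.filter_subset _ _)
    (core_cnt hy hvi hM _ _) (core_cnt hy hvi hM _ _) (core_cnt hy hvi hM _ _)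
    (fun p hp h h' => R1 q₁ q₂ q₃ hv hc hmin hp (m1 h) (m2 h'))
    (fun p hp h h' => R1 (d₃ := d₂) q₁ q₃ q₂ (by rw [hv]; abel) (by rw [hc]; abel) hmin hp (m1 h) (m3 h'))
    (fun p hp h h' => R1 (d₃ := d₂) q₃ q₁ q₂ (by rw [hv]; abel) (by rw [hc]; abel) hmin hp (m3 h) (m1 h'))
    (fun p hp h h' => R1 (d₃ := d₁) q₃ q₂ q₁ (by rw [hv]; abel) (by rw [hc]; abel) hmin hp (m3 h) (m2 h'))
    (fun p hp h h' => R1 (d₃ := d₃) q₂ q₁ q₃ (by rw [hv]; abel) (by rw [hc]; abel) hmin hp (m2 h) (m1 h'))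
  have key : ∀ p ∈ D, ∀ i ∈ T, ∀ j ∈ T, i < j → p ≠ i + 1 → p ≠ j → ¬ (G (c p)).Adj (v (i + 1)) (v (j + 1)) := by
    intro p hp i hi j hj hij h1 h2 ha
    obtain ⟨i1, i2, i3, i4, i5⟩ := hT' i hi
    obtain ⟨j1, j2, j3, j4, j5⟩ := hT' j hj
    refine R2 q₁ q₂ q₃ hv hc hmin (Finset.mem_range.1 (hD hp)) ?_ hij j1 h1 h2 (m2 i2) (m3 i5)
      (m2 j2) (m3 j3) (m2 j4) ha
    rcases hD' p hp with h | h
    · exact Or.inl (m1 h)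
    · exact Or.inr (m1 h)
  set S := T.image (fun p => v (p + 1)) with hS
  have hSc : S.card = T.card := by
    refine Finset.card_image_of_injOn ?_
    intro x hx y hy' h
    have h1 := (hT' x hx).1
    have h2 := (hT' y hy').1
    have := hvi (by simp; omega) (by simp; omega) h
    omega
  have hn : (Fintype.card V : ℝ) = 2 * k + 1 := by exact_mod_cast hy.cV
  have hTr : (k : ℝ) ≤ T.card + 4 * b + 7 := by exact_mod_cast hT
  have hSb : (1 / 2 - β) * Fintype.card V ≤ S.card := by
    rw [hSc]; linarith
  have hfin := hne S (fun _ => S) hSb (fun _ => hSb)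
  set n := Fintype.card V with hnd
  set C := D.image c with hC
  have hCc : C.card = D.card := Finset.card_image_of_injOn (hci.mono (by exact_mod_cast hD))
  have hSn : S.card ≤ n := Finset.card_le_univ _
  have b1 : ∀ γ ∈ C, ed G γ S S ≤ 4 * n := by
    intro γ hγ
    obtain ⟨p, hp, rfl⟩ := Finset.mem_image.1 hγ
    set E : Finset V := {v p, v (p + 1)}
    have hE : E.card ≤ 2 := Finset.card_le_two
    have : (S ×ˢ S).filter (fun q => (G (c p)).Adj q.1 q.2) ⊆ (E ×ˢ S) ∪ (S ×ˢ E) := by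
      rintro ⟨x, y⟩ hxy
      simp only [Finset.mem_filter, Finset.mem_product] at hxy
      obtain ⟨⟨hx, hy'⟩, ha⟩ := hxy
      obtain ⟨i, hi, rfl⟩ := Finset.mem_image.1 hx
      obtain ⟨j, hj, rfl⟩ := Finset.mem_image.1 hy'
      simp only [Finset.mem_union, Finset.mem_product]
      rcases lt_trichotomy i j with h | h | h
      · by_cases h1 : p = i + 1
        · left; exact ⟨by simp [E, h1], hy'⟩
        · by_cases h2 : p = j
          · right; exact ⟨hx, by simp [E, h2]⟩
          · exact absurd ha (key p hp i hi j hj h h1 h2)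
      · subst h; exact absurd rfl ha.ne
      · by_cases h1 : p = j + 1
        · right; exact ⟨hx, by simp [E, h1]⟩
        · by_cases h2 : p = i
          · left; exact ⟨by simp [E, h2], hy'⟩
          · exact absurd ha.symm (key p hp j hj i hi h h1 h2)
    have h1 := (Finset.card_le_card this).trans (Finset.card_union_le _ _)
    rw [Finset.card_product, Finset.card_product] at h1
    unfold ed
    nlinarith
  have b2 : ∑ γ, ed G γ S S ≤ (3 * b + 5) * (n * n) + n * (4 * n) := by
    rw [← Finset.sum_compl_add_sum C]
    refine add_le_add ?_ ?_
    · have h1 : ∑ γ ∈ Cᶜ, ed G γ S S ≤ Cᶜ.card • (n * n) :=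
        Finset.sum_le_card_nsmul _ _ _ (fun γ _ => (ed_le_mul γ S S).trans (Nat.mul_le_mul hSn hSn))
      refine h1.trans ?_
      rw [smul_eq_mul]
      refine Nat.mul_le_mul_right _ ?_
      rw [Finset.card_compl, hy.cG, hCc]; omega
    · have h1 : ∑ γ ∈ C, ed G γ S S ≤ C.card • (4 * n) := Finset.sum_le_card_nsmul _ _ _ b1
      refine h1.trans ?_
      rw [smul_eq_mul]
      refine Nat.mul_le_mul_right _ ?_
      have := Finset.card_le_univ C
      rw [hy.cG] at this; have := hy.cV; omega
  have b3 : (∑ γ, (ed G γ S S : ℝ)) ≤ (3 * b + 5) * (n * n) + n * (4 * n) := by exact_mod_cast b2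
  have hn0 : (0 : ℝ) < n := by rw [hn]; positivity
  have h9 : (3 * b + 9 : ℝ) * (n * n) < ν * n * (n * n) := by gcongr
  nlinarith

lemma PD.exists_init (vs : Multiset V) (cs : Multiset Γ) (h : Multiset.card vs = Multiset.card cs + 1) :
    ∃ f l i, PD G f l vs cs i := by
  induction cs using Multiset.induction_on generalizing vs with
  | empty =>
    obtain ⟨a, rfl⟩ := Multiset.card_eq_one.1 (by simpa using h)
    exact ⟨a, a, 0, PD.base a⟩
  | cons c cs ih =>
    have h0 : vs ≠ 0 := by rintro rfl; simp at h
    obtain ⟨a, ha⟩ := Multiset.exists_mem_of_ne_zero h0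
    obtain ⟨t, rfl⟩ := Multiset.exists_cons_of_mem ha
    obtain ⟨f, l, i, hp⟩ := ih t (by simpa using h)
    refine ⟨_, _, _, (PD.join c (PD.base a) hp).cast rfl rfl ?_ ?_ rfl⟩
    · simp
    · rw [zero_add, add_comm]; simp

/-- few violations suffice -/
lemma path_cover {k : ℕ} (hy : Hyp G k) {ν β : ℝ} (hne : NE G ν β) {vs : Multiset V} {cs : Multiset Γ}
    (hvn : vs.Nodup) (hcn : cs.Nodup) (h : Multiset.card vs = Multiset.card cs + 1)
    {t g K : ℕ} (hg : 0 < g) (hK : (2 * k + 1) / g + 6 ≤ K) (ht : 2 * k + 1 ≤ Multiset.card vs + t)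
    (hβ : (4 * (t + 3 * g) + 9 : ℝ) ≤ β * Fintype.card V)
    (hν : (3 * (t + 3 * g) + 9 : ℝ) < ν * Fintype.card V) :
    ∃ f l i, i < K ∧ PD G f l vs cs i := by
  have hex : ∃ i, ∃ f l, PD G f l vs cs i := by
    obtain ⟨f, l, i, h⟩ := PD.exists_init (G := G) vs cs h
    exact ⟨i, f, l, h⟩
  obtain ⟨s, ⟨f, l, hs⟩, hmin⟩ : ∃ s, (∃ f l, PD G f l vs cs s) ∧ ∀ f l j, PL G f l vs cs j → s ≤ j :=
    ⟨Nat.find hex, Nat.find_spec hex, fun f l j ⟨i, h1, h2⟩ => (Nat.find_min' hex ⟨f, l, h2⟩).trans h1⟩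
  by_contra hcon
  push Not at hcon
  have hsK := hcon f l s
  have hsK : K ≤ s := by
    by_contra h'; exact hsK (by omega) hs
  have : Nonempty Γ := Fintype.card_pos_iff.1 (by rw [hy.cG]; omega)
  have hvle : Multiset.card vs ≤ 2 * k + 1 := by
    rw [← hy.cV]
    have : vs ≤ (Finset.univ : Finset V).val := (Multiset.le_iff_subset hvn).2 (fun x _ => Finset.mem_univ x)
    exact Multiset.card_le_card this
  have hd := Nat.div_le_div_right (c := g) hvle
  obtain ⟨a₁, e₁, v₁, k₁, vm, cm, im, d₁, q₁, p₁, g₁, rfl, rfl, r₁, r₁'⟩ := extract hs hg (by omega)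
  simp only [Multiset.card_add] at *
  have hd1 := Nat.div_le_div_right (c := g) (show Multiset.card vm ≤ 2 * k + 1 by omega)
  obtain ⟨a₂, e₂, v₂, k₂, vm', cm', im', d₂, q₂, p₂, g₂, rfl, rfl, r₂, r₂'⟩ := extract p₁ hg (by omega)
  simp only [Multiset.card_add] at *
  have hd2 := Nat.div_le_div_right (c := g) (show Multiset.card vm' ≤ 2 * k + 1 by omega)
  obtain ⟨a₃, e₃, v₃, k₃, vmB, cmB, imB, d₃, q₃, p₃, g₃, rfl, rfl, r₃, r₃'⟩ := extract p₂ hg (by omega)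
  simp only [Multiset.card_add] at *
  obtain ⟨M, v, c, hix⟩ := p₃.idx
  have hMc : Multiset.card vmB = M + 1 := by rw [hix.hv]; simp
  obtain ⟨b, hb⟩ : ∃ b, M + 1 + b = 2 * k + 1 := ⟨2 * k + 1 - (M + 1), by omega⟩
  have hbt : (b : ℝ) ≤ t + 3 * g := by
    have : b ≤ t + 3 * g := by omega
    exact_mod_cast this
  refine core hy hne q₁.pl q₂.pl q₃.pl (d₁ := d₁) (d₂ := d₂) (d₃ := d₃) (v := v) (c := c) hvn hcn ?_ ?_ ?_ hb
    (by linarith) (by linarith)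
  · rw [hix.hv]; abel
  · rw [hix.hc]; abel
  · intro f l j hj
    have := hmin f l j hj
    rw [← hix.hi]; omega

end Core
end TH

open SimpleGraph
set_option linter.unusedSectionVars false
set_option linter.unusedVariables false
namespace TH
open scoped Classical

section Absorb
variable {V Γ : Type} {G : Γ → SimpleGraph V}

/-- internally good segment -/
def GS (G : Γ → SimpleGraph V) (s : List (V × Γ)) : Prop :=
  ∃ z x c, s = z ++ [(x, c)] ∧ ∀ t ∈ os z x, good G t

lemma PD.real {f l : V} {vs : Multiset V} {cs : Multiset Γ} {i : ℕ} (h : PD G f l vs cs i) :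
    ∀ c : Γ, ∃ z : List (V × Γ), hd z l = f ∧ ((z ++ [(l, c)]).map Prod.fst : Multiset V) = vs ∧
      ((z ++ [(l, c)]).map Prod.snd : Multiset Γ) = cs + {c} ∧
      ((os z l).map (fun s => bad G s.2.1 s.1 s.2.2)).sum = i := by
  induction h with
  | base v => intro c; exact ⟨[], rfl, rfl, rfl, rfl⟩
  | @join f l f' l' vs vs' cs cs' i i' d h h' ih ih' =>
    intro c
    obtain ⟨z, a1, a2, a3, a4⟩ := ih d
    obtain ⟨z', b1, b2, b3, b4⟩ := ih' c
    refine ⟨(z ++ [(l, d)]) ++ z', ?_, ?_, ?_, ?_⟩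
    · simp [hd_append, a1]
    · rw [List.append_assoc, List.map_append, ← Multiset.coe_add, a2, b2]
    · rw [List.append_assoc, List.map_append, ← Multiset.coe_add, a3, b3]; abel
    · simp only [os_append, hd_cons, os_cons, os_nil, List.map_append, List.sum_append, a4, b4, hd_append,
        b1]
      simp [a4, b1]; omega

lemma split_segs (z : List (V × Γ)) (l : V) (c : Γ) : ∃ L : List (List (V × Γ)), 
    L.length = ((os z l).map (fun s => bad G s.2.1 s.1 s.2.2)).sum + 1 ∧ L.flatten = z ++ [(l, c)] ∧
    ∀ s ∈ L, GS G s := by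
  induction z with
  | nil => exact ⟨[[(l, c)]], by simp, by simp, by simpa using ⟨[], l, c, rfl, by simp⟩⟩
  | cons a z ih =>
    obtain ⟨L, h1, h2, h3⟩ := ih
    by_cases hg : (G a.2).Adj a.1 (hd z l)
    · cases L with
      | nil => simp at h1
      | cons s L' =>
        refine ⟨(a :: s) :: L', ?_, ?_, ?_⟩
        · simp only [os_cons, List.map_cons, List.sum_cons, bad_adj hg, zero_add]
          simpa using h1
        · simp only [List.flatten_cons, List.cons_append] at h2 ⊢; rw [h2]
        · intro t ht
          rcases List.mem_cons.1 ht with rfl | ht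
          · obtain ⟨y, x, d, rfl, hy⟩ := h3 s (by simp)
            refine ⟨a :: y, x, d, rfl, ?_⟩
            have : hd z l = hd y x := by
              have e := congrArg (fun w => hd w l) h2
              simpa [hd_append] using e.symm
            intro t ht
            rw [os_cons] at ht
            rcases List.mem_cons.1 ht with rfl | ht
            · rw [this] at hg; exact hg
            · exact hy t ht
          · exact h3 t (by simp [ht])
    · refine ⟨[a] :: L, ?_, ?_, ?_⟩
      · simp only [os_cons, List.map_cons, List.sum_cons, bad, if_neg hg, List.length_cons]
        simp only [bad] at h1; omega
      · simp [h2]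
      · intro t ht
        rcases List.mem_cons.1 ht with rfl | ht
        · exact ⟨[], a.1, a.2, rfl, by simp⟩
        · exact h3 t ht

/-- slot matches the demand -/
def mt (G : Γ → SimpleGraph V) (d : V × V × Γ) (s : V × Γ × V) : Prop :=
  (G s.2.1).Adj s.1 d.1 ∧ (G d.2.2).Adj s.2.2 d.2.1

lemma rot_close {z : List (V × Γ)} {s : V × Γ × V} (h : s ∈ cyc z) :
    ∃ d, (d ++ [(s.1, s.2.1)]).Perm z ∧ hd d s.1 = s.2.2 ∧ (cyc z).Perm (os d s.1 ++ [s]) := by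
  cases z with
  | nil => simp [cyc] at h
  | cons a r =>
    rw [cyc_cons] at h
    obtain ⟨A, B, hAB⟩ := List.append_of_mem h
    obtain ⟨x, y, hz, h1, h2, h3⟩ := os_split_one hAB
    have ha : a.1 = hd x s.1 := by
      have := congrArg (fun w => hd w s.1) hz
      simpa [hd_append] using this
    have hh : hd (y ++ x) s.1 = s.2.2 := by rw [hd_append, ← ha, h1]
    refine ⟨y ++ x, ?_, hh, ?_⟩
    · rw [hz, List.append_assoc]
      refine List.perm_append_comm.trans ?_
      simp
    · rw [hz, show x ++ (s.1, s.2.1) :: y = (x ++ [(s.1, s.2.1)]) ++ y by simp]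
      refine (cyc_rotate _ _).trans ?_
      rw [← List.append_assoc, cyc_one, hh]

lemma absorb (L : List (List (V × Γ))) : ∀ (z : List (V × Γ)) (R : Finset (V × Γ × V)),
    (∀ s ∈ L, GS G s) → (∀ s ∈ cyc z, good G s) → (∀ s ∈ R, s ∈ cyc z) →
    (∀ d, L.length ≤ (R.filter (mt G d)).card) → 
    ∃ z', z'.Perm (z ++ L.flatten) ∧ ∀ s ∈ cyc z', good G s := by
  induction L with
  | nil => intro z R _ h2 _ _; exact ⟨z, by simp, h2⟩
  | cons s L ih =>
    intro z R h1 h2 h3 h4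
    obtain ⟨y, x, c, rfl, hy⟩ := h1 s (by simp)
    have := h4 (hd y x, x, c)
    obtain ⟨σ, hσ⟩ : (R.filter (mt G (hd y x, x, c))).Nonempty := by
      rw [← Finset.card_pos]; simp at this; omega
    rw [Finset.mem_filter] at hσ
    obtain ⟨hσR, hσ1, hσ2⟩ := hσ
    obtain ⟨d, hd1, hd2, hd3⟩ := rot_close (h3 σ hσR)
    have hcyc : cyc ((d ++ [(σ.1, σ.2.1)]) ++ (y ++ [(x, c)])) = 
        os d σ.1 ++ (σ.1, σ.2.1, hd y x) :: (os y x ++ [(x, c, σ.2.2)]) := by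
      rw [cyc_append _ _ x x (by simp) (by simp)]
      simp [os_append, hd_append, hd2]
    obtain ⟨z', hz', hg⟩ := ih ((d ++ [(σ.1, σ.2.1)]) ++ (y ++ [(x, c)])) (R.erase σ)
      (fun s hs => h1 s (by simp [hs])) (by
        intro s hs
        rw [hcyc] at hs
        simp only [List.mem_append, List.mem_cons, List.mem_singleton, List.not_mem_nil, or_false] at hs
        rcases hs with hs | rfl | hs | rfl
        · exact h2 s (hd3.mem_iff.2 (by simp [hs]))
        · exact hσ1
        · exact hy s hs
        · exact hσ2.symm) (by
        intro s hs
        rw [Finset.mem_erase] at hs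
        have := hd3.mem_iff.1 (h3 s hs.2)
        rw [hcyc]
        simp only [List.mem_append, List.mem_singleton] at this
        rcases this with h | h
        · simp [h]
        · exact absurd h hs.1) (by
        intro q
        have h5 := h4 q
        rw [Finset.filter_erase]
        have := Finset.pred_card_le_card_erase (s := R.filter (mt G q)) (a := σ)
        simp only [List.length_cons] at h5
        omega)
    refine ⟨z', hz'.trans ?_, hg⟩
    rw [List.flatten_cons, ← List.append_assoc z]
    exact List.Perm.append_right _ (List.Perm.append_right _ hd1)

end Absorb
end TH

open SimpleGraph
set_option linter.unusedSectionVars false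
set_option linter.unusedVariables false
namespace TH
open scoped Classical

section Greedy
variable {V Γ : Type} [Fintype V] [Fintype Γ] {G : Γ → SimpleGraph V}

lemma connect {k : ℕ} (hy : Hyp G k) {ν β : ℝ} (hne : NE G ν β) {w : ℕ}
    (hβ : (6 * (w + 3) : ℝ) ≤ β * Fintype.card V) (hν : (6 * (w + 3) : ℝ) ≤ ν * Fintype.card V)
    (hν1 : ν ≤ 1) (W : Finset V) (F : Finset Γ) (hW : W.card ≤ w) (hF : F.card ≤ w) (u p : V) :
    ∃ γ₁ γ₂ γ₃ a b, (γ₁ ∉ F ∧ γ₂ ∉ F ∧ γ₃ ∉ F) ∧ (γ₁ ≠ γ₂ ∧ γ₁ ≠ γ₃ ∧ γ₂ ≠ γ₃) ∧ (a ∉ W ∧ b ∉ W ∧ a ≠ b) ∧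
      (G γ₁).Adj u a ∧ (G γ₂).Adj a b ∧ (G γ₃).Adj b p := by
  have hn : (Fintype.card V : ℝ) = 2 * k + 1 := by exact_mod_cast hy.cV
  have hn0 : (0 : ℝ) < Fintype.card V := by rw [hn]; positivity
  have hwn : w + 3 ≤ 2 * k + 1 := by
    have : (w + 3 : ℝ) ≤ 2 * k + 1 := by rw [← hn]; nlinarith
    exact_mod_cast this
  obtain ⟨γ₁, h1⟩ : ∃ γ, γ ∉ F := by
    by_contra h; push Not at h
    have : F = Finset.univ := by ext x; simp [h x]
    rw [this, Finset.card_univ, hy.cG] at hF; omega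
  obtain ⟨γ₃, h3⟩ : ∃ γ, γ ∉ insert γ₁ F := by
    by_contra h; push Not at h
    have : insert γ₁ F = Finset.univ := by ext x; simpa using h x
    have h' := Finset.card_insert_le γ₁ F
    rw [this, Finset.card_univ, hy.cG] at h'; omega
  have big : ∀ γ v, (1 / 2 - β) * Fintype.card V ≤ ((nb G γ v \ W).card : ℝ) := by
    intro γ v
    have h1 := hy.dg γ v
    have h2 := Finset.le_card_sdiff W (nb G γ v)
    have h3 : (k : ℝ) ≤ (nb G γ v \ W).card + w := by
      have : k ≤ (nb G γ v \ W).card + w := by omega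
      exact_mod_cast this
    have : (0 : ℝ) ≤ w := by positivity
    nlinarith
  have hs := hne (nb G γ₃ p \ W) (fun _ => nb G γ₁ u \ W) (big _ _) (fun _ => big _ _)
  set S := nb G γ₃ p \ W
  set Y := nb G γ₁ u \ W
  set F' := insert γ₃ (insert γ₁ F) with hF'
  have hF'c : F'.card ≤ w + 2 := by
    have h' := Finset.card_insert_le γ₁ F
    have hBB := Finset.card_insert_le γ₃ (insert γ₁ F)
    rw [← hF'] at hBB
    omega
  obtain ⟨γ₂, h2, h2e⟩ : ∃ γ, γ ∉ F' ∧ ed G γ Y S ≠ 0 := by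
    by_contra h
    push Not at h
    have b1 : ∑ γ, ed G γ Y S ≤ (w + 2) * (Fintype.card V * Fintype.card V) := by
      rw [← Finset.sum_compl_add_sum F']
      rw [Finset.sum_eq_zero (fun γ hγ => h γ (Finset.mem_compl.1 hγ)), zero_add]
      refine (Finset.sum_le_card_nsmul _ _ (Fintype.card V * Fintype.card V)
        (fun γ _ => (ed_le_mul γ Y S).trans (Nat.mul_le_mul (Finset.card_le_univ _) (Finset.card_le_univ _)))).trans ?_
      rw [smul_eq_mul]; exact Nat.mul_le_mul_right _ hF'c
    have b2 : (∑ γ, (ed G γ Y S : ℝ)) ≤ (w + 2) * ((Fintype.card V : ℝ) * Fintype.card V) := by exact_mod_cast b1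
    have b3 : (w + 2 : ℝ) < ν * Fintype.card V := by
      have : (0 : ℝ) ≤ w := by positivity
      linarith
    have b4 : (w + 2 : ℝ) * ((Fintype.card V : ℝ) * Fintype.card V) < 
        ν * Fintype.card V * ((Fintype.card V : ℝ) * Fintype.card V) := by gcongr
    nlinarith
  obtain ⟨⟨a, b⟩, hab⟩ := Finset.card_pos.1 (Nat.pos_of_ne_zero h2e)
  simp only [Finset.mem_filter, Finset.mem_product, Y, S, Finset.mem_sdiff, mem_nb] at hab
  simp only [hF', Finset.mem_insert, not_or] at h2 h3
  exact ⟨γ₁, γ₂, γ₃, a, b, ⟨h1, h2.2.2, h3.2⟩, ⟨Ne.symm h2.2.1, Ne.symm h3.1, h2.1⟩,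
    ⟨hab.1.1.2, hab.1.2.2, hab.2.ne⟩, hab.1.1.1, hab.2, hab.1.2.1.symm⟩

/-- fresh good slots -/
def fr (G : Γ → SimpleGraph V) (W : Finset V) (F : Finset Γ) (s : V × Γ × V) : Prop :=
  good G s ∧ s.1 ∉ W ∧ s.2.1 ∉ F ∧ s.2.2 ∉ W

lemma fresh_count {k : ℕ} (hy : Hyp G k) {ν β : ℝ} (hne : NE G ν β) {w : ℕ}
    (hβ : (6 * (w + 3) : ℝ) ≤ β * Fintype.card V) (hν : (6 * (w + 3) : ℝ) ≤ ν * Fintype.card V)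
    (W : Finset V) (F : Finset Γ) (hW : W.card ≤ w) (hF : F.card ≤ w) (d : V × V × Γ) :
    ν / 2 * (Fintype.card V : ℝ) ^ 3 ≤ ((Finset.univ.filter (fun s => fr G W F s ∧ mt G d s)).card : ℝ) := by
  have hn : (Fintype.card V : ℝ) = 2 * k + 1 := by exact_mod_cast hy.cV
  have big : ∀ γ v, (1 / 2 - β) * Fintype.card V ≤ ((nb G γ v).card : ℝ) := by
    intro γ v
    have h1 : (k : ℝ) ≤ (nb G γ v).card := by exact_mod_cast hy.dg γ v
    have : (0 : ℝ) ≤ w := by positivity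
    nlinarith
  have hs := hne (nb G d.2.2 d.2.1) (fun γ => nb G γ d.1) (big _ _) (fun _ => big _ _)
  set A : Finset (V × Γ × V) := Finset.univ.filter (fun s => good G s ∧ mt G d s) with hA
  set B : Finset (V × Γ × V) := Finset.univ.filter (fun s => fr G W F s ∧ mt G d s) with hB
  have mA : ∀ s, s ∈ A ↔ good G s ∧ mt G d s := by intro s; simp [hA]
  have mB : ∀ s, s ∈ B ↔ fr G W F s ∧ mt G d s := by intro s; simp [hB]
  have hAc : ∑ γ, ed G γ (nb G γ d.1) (nb G d.2.2 d.2.1) = A.card := by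
    have : A = Finset.univ.biUnion (fun γ => (((nb G γ d.1) ×ˢ (nb G d.2.2 d.2.1)).filter
        (fun p => (G γ).Adj p.1 p.2)).image (fun p => (p.1, γ, p.2))) := by
      ext ⟨a, γ, b⟩
      rw [mA]
      simp only [Finset.mem_filter, Finset.mem_univ, true_and, good, mt, Finset.mem_biUnion,
        Finset.mem_image, Finset.mem_product, mem_nb, Prod.exists, Prod.mk.injEq]
      constructor
      · rintro ⟨h1, h2, h3⟩
        exact ⟨γ, a, b, ⟨⟨h2.symm, h3.symm⟩, h1⟩, rfl, rfl, rfl⟩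
      · rintro ⟨γ', a', b', ⟨⟨h1, h2⟩, h3⟩, rfl, rfl, rfl⟩
        exact ⟨h3, h1.symm, h2.symm⟩
    rw [this, Finset.card_biUnion]
    · refine Finset.sum_congr rfl fun γ _ => ?_
      rw [Finset.card_image_of_injective]
      · rfl
      · rintro ⟨a, b⟩ ⟨a', b'⟩ h
        simp only [Prod.mk.injEq] at h ⊢
        exact ⟨h.1, h.2.2⟩
    · intro γ _ γ' _ hne'
      rw [Function.onFun, Finset.disjoint_left]
      intro s h1 h2
      simp only [Finset.mem_image] at h1 h2
      obtain ⟨p, _, rfl⟩ := h1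
      obtain ⟨q, _, h⟩ := h2
      simp only [Prod.mk.injEq] at h
      exact hne' h.2.1.symm
  have hsub : A ⊆ B ∪ (W ×ˢ (Finset.univ ×ˢ Finset.univ)) ∪ (Finset.univ ×ˢ (F ×ˢ Finset.univ)) ∪
      (Finset.univ ×ˢ (Finset.univ ×ˢ W)) := by
    intro s hs
    rw [mA] at hs
    simp only [mB, fr, Finset.mem_univ, true_and, Finset.mem_union, Finset.mem_product,
      and_true]
    by_cases h1 : s.1 ∈ W
    · tauto
    by_cases h2 : s.2.1 ∈ F
    · tauto
    by_cases h3 : s.2.2 ∈ W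
    · tauto
    tauto
  have hc : A.card ≤ B.card + 3 * w * (Fintype.card V * Fintype.card V) := by
    have h1 := Finset.card_le_card hsub
    have h2 := Finset.card_union_le (B ∪ (W ×ˢ (Finset.univ ×ˢ Finset.univ)) ∪ (Finset.univ ×ˢ (F ×ˢ Finset.univ)))
      (Finset.univ ×ˢ (Finset.univ ×ˢ W))
    have h3 := Finset.card_union_le (B ∪ (W ×ˢ (Finset.univ ×ˢ Finset.univ))) 
      (Finset.univ ×ˢ (F ×ˢ Finset.univ))
    have h4 := Finset.card_union_le B (W ×ˢ (Finset.univ ×ˢ Finset.univ))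
    simp only [Finset.card_product, Finset.card_univ] at h2 h3 h4
    have e : Fintype.card Γ = Fintype.card V := by rw [hy.cG, hy.cV]
    rw [e] at h2 h4
    have h5 := Nat.mul_le_mul_right (Fintype.card V * Fintype.card V) hW
    have h6 := Nat.mul_le_mul_right (Fintype.card V * Fintype.card V) hF
    nlinarith
  have hc' : (A.card : ℝ) ≤ B.card + 3 * w * ((Fintype.card V : ℝ) * Fintype.card V) := by exact_mod_cast hc
  have hs' : ν * (Fintype.card V : ℝ) ^ 3 ≤ A.card := by
    refine hs.trans (le_of_eq ?_); exact_mod_cast hAc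
  have h7 : (3 * w : ℝ) * ((Fintype.card V : ℝ) * Fintype.card V) ≤
      (ν / 2 * Fintype.card V) * ((Fintype.card V : ℝ) * Fintype.card V) := by
    refine mul_le_mul_of_nonneg_right ?_ (by positivity)
    linarith
  nlinarith

/-- potential -/
noncomputable def Phi (G : Γ → SimpleGraph V) (R : Finset (V × Γ × V)) : ℝ :=
  ∑ d : V × V × Γ, (1 / 2 : ℝ) ^ (R.filter (mt G d)).card

lemma pick {k : ℕ} (hy : Hyp G k) {ν β : ℝ} (hne : NE G ν β) {w : ℕ} (hν0 : 0 < ν)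
    (hβ : (6 * (w + 3) : ℝ) ≤ β * Fintype.card V) (hν : (6 * (w + 3) : ℝ) ≤ ν * Fintype.card V)
    (W : Finset V) (F : Finset Γ) (hW : W.card ≤ w) (hF : F.card ≤ w) (R : Finset (V × Γ × V)) 
    (hR : ∀ s ∈ R, s.2.1 ∈ F) :
    ∃ s, fr G W F s ∧ Phi G (insert s R) ≤ Phi G R * (1 - ν / 4) := by
  have hn : (Fintype.card V : ℝ) = 2 * k + 1 := by exact_mod_cast hy.cV
  have hn0 : (0 : ℝ) < Fintype.card V := by rw [hn]; positivity
  have hVn : Nonempty V := Fintype.card_pos_iff.1 (by rw [hy.cV]; omega)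
  have hGn : Nonempty Γ := Fintype.card_pos_iff.1 (by rw [hy.cG]; omega)
  set wt : V × V × Γ → ℝ := fun d => (1 / 2 : ℝ) ^ (R.filter (mt G d)).card with hwt
  have hwpos : ∀ d, 0 < wt d := fun d => by simp only [hwt]; positivity
  have hPhi : Phi G R = ∑ d, wt d := rfl
  have hpos : 0 < ∑ d, wt d := Finset.sum_pos (fun d _ => hwpos d) Finset.univ_nonempty
  have e1 : ∑ s : V × Γ × V, (ν / 2 * ∑ d, wt d) ≤ 
      ∑ s : V × Γ × V, (if fr G W F s then ∑ d, (if mt G d s then wt d else 0) else 0) := by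
    have : ∀ s : V × Γ × V, (if fr G W F s then ∑ d, (if mt G d s then wt d else 0) else 0) =
        ∑ d, (if fr G W F s ∧ mt G d s then wt d else 0) := by
      intro s
      by_cases h : fr G W F s <;> simp [h]
    rw [Finset.sum_congr rfl (fun s _ => this s), Finset.sum_comm, Finset.sum_const, nsmul_eq_mul,
      Finset.mul_sum, Finset.mul_sum]
    refine Finset.sum_le_sum fun d _ => ?_
    rw [← Finset.sum_filter, Finset.sum_const, nsmul_eq_mul]
    have h1 := fresh_count hy hne hβ hν W F hW hF d
    have h2 : ((Finset.univ : Finset (V × Γ × V)).card : ℝ) = (Fintype.card V : ℝ) ^ 3 := by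
      rw [Finset.card_univ, Fintype.card_prod, Fintype.card_prod]
      have e : Fintype.card Γ = Fintype.card V := by rw [hy.cG, hy.cV]
      rw [e]; push_cast; ring
    rw [h2]
    have := mul_le_mul_of_nonneg_right h1 (hwpos d).le
    linarith
  obtain ⟨s, _, hs⟩ := Finset.exists_le_of_sum_le Finset.univ_nonempty e1
  have hfr : fr G W F s := by
    by_contra h
    rw [if_neg h] at hs
    have : 0 < ν / 2 * ∑ d, wt d := by positivity
    linarith
  rw [if_pos hfr] at hs
  refine ⟨s, hfr, ?_⟩
  have hsR : s ∉ R := fun h => hfr.2.2.1 (hR s h)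
  have e2 : Phi G (insert s R) = ∑ d, (wt d - (1 / 2) * (if mt G d s then wt d else 0)) := by
    unfold Phi
    refine Finset.sum_congr rfl fun d _ => ?_
    rw [Finset.filter_insert]
    by_cases h : mt G d s
    · rw [if_pos h, if_pos h, Finset.card_insert_of_notMem (by simp [hsR]), pow_succ]
      simp only [hwt]; ring
    · rw [if_neg h, if_neg h]; simp [hwt]
  rw [e2, Finset.sum_sub_distrib, ← Finset.mul_sum, hPhi]
  nlinarith

end Greedy
end TH

open SimpleGraph
set_option linter.unusedSectionVars false
set_option linter.unusedVariables false
namespace TH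
open scoped Classical

section Cycle
variable {V Γ : Type} [Fintype V] [Fintype Γ] {G : Γ → SimpleGraph V}

/-- greedy_abs state -/
structure St (G : Γ → SimpleGraph V) (ν : ℝ) (j : ℕ) (l : List (V × Γ)) (u : V) (R : Finset (V × Γ × V)) : Prop where
  len : l.length = 4 * j
  vn : (l.map Prod.fst ++ [u]).Nodup
  cn : (l.map Prod.snd).Nodup
  gd : ∀ s ∈ os l u, good G s
  sub : ∀ s ∈ R, s ∈ os l u
  pot : Phi G R ≤ (Fintype.card V : ℝ) ^ 3 * (1 - ν / 4) ^ j

lemma os_col {l : List (V × Γ)} {u : V} {s : V × Γ × V} (h : s ∈ os l u) : s.2.1 ∈ l.map Prod.snd := by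
  induction l with
  | nil => simp at h
  | cons a r ih =>
    rw [os_cons] at h
    rcases List.mem_cons.1 h with rfl | h
    · simp
    · rw [List.map_cons]; exact List.mem_cons_of_mem _ (ih h)

lemma greedy_abs {k : ℕ} (hy : Hyp G k) {ν β : ℝ} (hne : NE G ν β) (hν0 : 0 < ν) (hν1 : ν ≤ 1) {T : ℕ}
    (hβ : (6 * ((4 * T + 3 : ℕ) + 3) : ℝ) ≤ β * Fintype.card V)
    (hν : (6 * ((4 * T + 3 : ℕ) + 3) : ℝ) ≤ ν * Fintype.card V) :
    ∀ j ≤ T, ∃ l u R, St G ν j l u R := by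
  intro j
  induction j with
  | zero =>
    intro _
    have hVn : Nonempty V := Fintype.card_pos_iff.1 (by rw [hy.cV]; omega)
    refine ⟨[], Classical.arbitrary V, ∅, rfl, by simp, by simp, by simp, by simp, ?_⟩
    have e : Fintype.card Γ = Fintype.card V := by rw [hy.cG, hy.cV]
    simp only [Phi, Finset.filter_empty, Finset.card_empty, pow_zero, Finset.sum_const, Finset.card_univ,
      Fintype.card_prod, e, nsmul_eq_mul, mul_one]
    push_cast
    apply le_of_eq; ring
  | succ j ih =>
    intro hj
    obtain ⟨l, u, R, h⟩ := ih (by omega)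
    set W : Finset V := (l.map Prod.fst ++ [u]).toFinset with hWd
    set F : Finset Γ := (l.map Prod.snd).toFinset with hFd
    have hW : W.card ≤ 4 * j + 1 := by
      refine (List.toFinset_card_le _).trans ?_
      simp [h.len]
    have hF : F.card ≤ 4 * j := by
      refine (List.toFinset_card_le _).trans ?_
      simp [h.len]
    obtain ⟨⟨p, γ, p'⟩, ⟨hg, hf1, hf2, hf3⟩, hphi⟩ := pick hy hne hν0 hβ hν W F (by omega) (by omega) R
      (fun s hs => by rw [hFd, List.mem_toFinset]; exact os_col (h.sub s hs))
    simp only at hf1 hf2 hf3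
    have hpp : p ≠ p' := hg.ne
    obtain ⟨γ₁, γ₂, γ₃, a, b, ⟨c1, c2, c3⟩, ⟨n1, n2, n3⟩, ⟨v1, v2, v3⟩, a1, a2, a3⟩ :=
      connect hy hne hβ hν hν1 (insert p (insert p' W)) (insert γ F)
        (by have := Finset.card_insert_le p (insert p' W); have := Finset.card_insert_le p' W; omega)
        (by have := Finset.card_insert_le γ F; omega) u p
    refine ⟨l ++ [(u, γ₁), (a, γ₂), (b, γ₃), (p, γ)], p', insert (p, γ, p') R, ?_, ?_, ?_, ?_, ?_, ?_⟩
    · simp [h.len]; omega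
    · have e : (List.map Prod.fst (l ++ [(u, γ₁), (a, γ₂), (b, γ₃), (p, γ)]) ++ [p']) =
        (l.map Prod.fst ++ [u]) ++ [a, b, p, p'] := by simp
      rw [e, List.nodup_append]
      simp only [hWd, Finset.mem_insert, List.mem_toFinset, not_or] at v1 v2 hf1 hf3
      refine ⟨h.vn, ?_, ?_⟩
      · simp only [List.nodup_cons, List.mem_cons, List.not_mem_nil, or_false, not_or, not_false_eq_true,
          List.nodup_nil, and_true]
        exact ⟨⟨v3, v1.1, v1.2.1⟩, ⟨v2.1, v2.2.1⟩, hpp⟩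
      · intro x hx y hy' hxy
        subst hxy
        simp only [List.mem_cons, List.not_mem_nil, or_false] at hy'
        rcases hy' with rfl | rfl | rfl | rfl
        · exact v1.2.2 hx
        · exact v2.2.2 hx
        · exact hf1 hx
        · exact hf3 hx
    · rw [List.map_append, List.nodup_append]
      simp only [hFd, Finset.mem_insert, List.mem_toFinset, not_or] at c1 c2 c3 hf2
      refine ⟨h.cn, ?_, ?_⟩
      · simp only [List.map_cons, List.map_nil, List.nodup_cons, List.mem_cons, List.not_mem_nil, or_false,
          not_or, not_false_eq_true, List.nodup_nil, and_true]
        exact ⟨⟨n1, n2, c1.1⟩, ⟨n3, c2.1⟩, c3.1⟩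
      · intro x hx y hy' hxy
        subst hxy
        simp only [List.map_cons, List.map_nil, List.mem_cons, List.not_mem_nil, or_false] at hy'
        rcases hy' with rfl | rfl | rfl | rfl
        · exact c1.2 hx
        · exact c2.2 hx
        · exact c3.2 hx
        · exact hf2 hx
    · intro s hs
      rw [os_append] at hs
      simp only [hd_cons, os_cons, os_nil, hd_nil, List.mem_append, List.mem_cons, List.not_mem_nil, or_false] at hs
      rcases hs with hs | rfl | rfl | rfl | rfl
      · exact h.gd s hs
      · exact a1
      · exact a2
      · exact a3
      · exact hg
    · intro s hs
      rw [os_append]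
      simp only [hd_cons, os_cons, os_nil, hd_nil, List.mem_append, List.mem_cons, List.not_mem_nil, or_false]
      rcases Finset.mem_insert.1 hs with rfl | hs
      · simp
      · exact Or.inl (h.sub s hs)
    · refine hphi.trans ?_
      have e : (Fintype.card V : ℝ) ^ 3 * (1 - ν / 4) ^ (j + 1) =
          ((Fintype.card V : ℝ) ^ 3 * (1 - ν / 4) ^ j) * (1 - ν / 4) := by ring
      rw [e]
      exact mul_le_mul_of_nonneg_right h.pot (by linarith)

lemma absorbing {k : ℕ} (hy : Hyp G k) {ν β : ℝ} (hne : NE G ν β) (hν0 : 0 < ν) (hν1 : ν ≤ 1) {T K : ℕ}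
    (hβ : (6 * ((4 * T + 3 : ℕ) + 3) : ℝ) ≤ β * Fintype.card V)
    (hν : (6 * ((4 * T + 3 : ℕ) + 3) : ℝ) ≤ ν * Fintype.card V)
    (hT : (Fintype.card V : ℝ) ^ 3 * (1 - ν / 4) ^ T < (1 / 2) ^ K) :
    ∃ (z : List (V × Γ)) (R : Finset (V × Γ × V)), z.length = 4 * T + 3 ∧ (z.map Prod.fst).Nodup ∧
      (z.map Prod.snd).Nodup ∧ (∀ s ∈ cyc z, good G s) ∧ (∀ s ∈ R, s ∈ cyc z) ∧
      ∀ d, K ≤ (R.filter (mt G d)).card := by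
  obtain ⟨l, u, R, h⟩ := greedy_abs hy hne hν0 hν1 hβ hν T le_rfl
  set W : Finset V := (l.map Prod.fst ++ [u]).toFinset with hWd
  set F : Finset Γ := (l.map Prod.snd).toFinset with hFd
  have hW : W.card ≤ 4 * T + 1 := by
    refine (List.toFinset_card_le _).trans ?_
    simp [h.len]
  have hF : F.card ≤ 4 * T := by
    refine (List.toFinset_card_le _).trans ?_
    simp [h.len]
  obtain ⟨γ₁, γ₂, γ₃, a, b, ⟨c1, c2, c3⟩, ⟨n1, n2, n3⟩, ⟨v1, v2, v3⟩, a1, a2, a3⟩ :=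
    connect hy hne hβ hν hν1 W F (by omega) (by omega) u (hd l u)
  have hcyc : cyc (l ++ [(u, γ₁), (a, γ₂), (b, γ₃)]) = os l u ++ [(u, γ₁, a), (a, γ₂, b), (b, γ₃, hd l u)] := by
    rw [show l ++ [(u, γ₁), (a, γ₂), (b, γ₃)] = (l ++ [(u, γ₁), (a, γ₂)]) ++ [(b, γ₃)] by simp, cyc_one]
    simp [os_append, hd_append]
  simp only [hWd, hFd, List.mem_toFinset] at v1 v2 c1 c2 c3
  refine ⟨l ++ [(u, γ₁), (a, γ₂), (b, γ₃)], R, by simp [h.len], ?_, ?_, ?_, ?_, ?_⟩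
  · have e : (List.map Prod.fst (l ++ [(u, γ₁), (a, γ₂), (b, γ₃)])) =
        (l.map Prod.fst ++ [u]) ++ [a, b] := by simp
    rw [e, List.nodup_append]
    refine ⟨h.vn, by simpa using v3, ?_⟩
    intro x hx y hy' hxy
    subst hxy
    simp only [List.mem_cons, List.not_mem_nil, or_false] at hy'
    rcases hy' with rfl | rfl
    · exact v1 hx
    · exact v2 hx
  · rw [List.map_append, List.nodup_append]
    refine ⟨h.cn, by simp [n1, n2, n3], ?_⟩
    intro x hx y hy' hxy
    subst hxy
    simp only [List.map_cons, List.map_nil, List.mem_cons, List.not_mem_nil, or_false] at hy'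
    rcases hy' with rfl | rfl | rfl
    · exact c1 hx
    · exact c2 hx
    · exact c3 hx
  · intro s hs
    rw [hcyc] at hs
    simp only [List.mem_append, List.mem_cons, List.not_mem_nil, or_false] at hs
    rcases hs with hs | rfl | rfl | rfl
    · exact h.gd s hs
    · exact a1
    · exact a2
    · exact a3
  · intro s hs
    rw [hcyc, List.mem_append]; exact Or.inl (h.sub s hs)
  · intro d
    by_contra hcon
    push Not at hcon
    have h1 : (1 / 2 : ℝ) ^ (R.filter (mt G d)).card ≤ Phi G R := by
      unfold Phi
      exact Finset.single_le_sum (f := fun d => (1 / 2 : ℝ) ^ (R.filter (mt G d)).card)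
        (fun d _ => by positivity) (Finset.mem_univ d)
    have h2 : (1 / 2 : ℝ) ^ K ≤ (1 / 2) ^ (R.filter (mt G d)).card :=
      pow_le_pow_of_le_one (by norm_num) (by norm_num) hcon.le
    linarith [h.pot]

lemma combine {k : ℕ} (hy : Hyp G k) {ν β : ℝ} (hne : NE G ν β) (hν0 : 0 < ν) (hν1 : ν ≤ 1) {T g K : ℕ}
    (hβ : (6 * ((4 * T + 3 : ℕ) + 3) : ℝ) ≤ β * Fintype.card V)
    (hν : (6 * ((4 * T + 3 : ℕ) + 3) : ℝ) ≤ ν * Fintype.card V)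
    (hT : (Fintype.card V : ℝ) ^ 3 * (1 - ν / 4) ^ T < (1 / 2) ^ K)
    (hg : 0 < g) (hK : (2 * k + 1) / g + 6 ≤ K)
    (hβ' : (4 * ((4 * T + 3 : ℕ) + 3 * g) + 9 : ℝ) ≤ β * Fintype.card V)
    (hν' : (3 * ((4 * T + 3 : ℕ) + 3 * g) + 9 : ℝ) < ν * Fintype.card V) : THC G := by
  obtain ⟨z, R, z1, z2, z3, z4, z5, z6⟩ := absorbing hy hne hν0 hν1 hβ hν hT
  have hn : (Fintype.card V : ℝ) = 2 * k + 1 := by exact_mod_cast hy.cV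
  have hlt : 4 * T + 3 < 2 * k + 1 := by
    have : ((4 * T + 3 : ℕ) : ℝ) < (2 * k + 1 : ℕ) := by
      have hg0 : (0 : ℝ) ≤ g := by positivity
      have h0 : (0 : ℝ) ≤ ((4 * T + 3 : ℕ) : ℝ) := by positivity
      push_cast at *
      nlinarith
    exact_mod_cast this
  set VV : Finset V := (z.map Prod.fst).toFinsetᶜ with hVV
  set CC : Finset Γ := (z.map Prod.snd).toFinsetᶜ with hCC
  have cV : VV.card = 2 * k + 1 - (4 * T + 3) := by
    rw [hVV, Finset.card_compl, hy.cV, List.toFinset_card_of_nodup z2, List.length_map, z1]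
  have cC : CC.card = 2 * k + 1 - (4 * T + 3) := by
    rw [hCC, Finset.card_compl, hy.cG, List.toFinset_card_of_nodup z3, List.length_map, z1]
  obtain ⟨c, hc⟩ : CC.Nonempty := by rw [← Finset.card_pos]; omega
  have cE : (CC.erase c).card + 1 = CC.card := Finset.card_erase_add_one hc
  obtain ⟨f, l, i, hi, hp⟩ := path_cover hy hne (vs := VV.val) (cs := (CC.erase c).val) VV.nodup
    (CC.erase c).nodup (by rw [Finset.card_val, Finset.card_val]; omega) hg hK (t := 4 * T + 3) 
    (by rw [Finset.card_val]; omega) hβ' hν'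
  obtain ⟨y, _, y2, y3, y4⟩ := hp.real c
  obtain ⟨L, L1, L2, L3⟩ := split_segs (G := G) y l c
  obtain ⟨z', hz', hgood⟩ := absorb L z R L3 z4 z5 (fun d => by have := z6 d; omega)
  rw [L2] at hz'
  refine ⟨z', ?_, hgood⟩
  have p1 : ((z'.map Prod.fst : List V) : Multiset V) = (Finset.univ : Finset V).val := by
    rw [Multiset.coe_eq_coe.2 (hz'.map Prod.fst), List.map_append, ← Multiset.coe_add, y2]
    have e : ((z.map Prod.fst : List V) : Multiset V) = (z.map Prod.fst).toFinset.val := by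
      rw [List.toFinset_val, z2.dedup]
    rw [e, hVV, ← Finset.union_compl (z.map Prod.fst).toFinset, ← Finset.disjUnion_eq_union _ _ disjoint_compl_right]
    rfl
  have p2 : ((z'.map Prod.snd : List Γ) : Multiset Γ) = (Finset.univ : Finset Γ).val := by
    rw [Multiset.coe_eq_coe.2 (hz'.map Prod.snd), List.map_append, ← Multiset.coe_add, y3]
    have e : ((z.map Prod.snd : List Γ) : Multiset Γ) = (z.map Prod.snd).toFinset.val := by
      rw [List.toFinset_val, z3.dedup]
    have e2 : (CC.erase c).val + {c} = CC.val := by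
      rw [Finset.erase_val, add_comm, Multiset.singleton_add, Multiset.cons_erase hc]
    rw [e, e2, hCC, ← Finset.union_compl (z.map Prod.snd).toFinset, ← Finset.disjUnion_eq_union _ _ disjoint_compl_right]
    rfl
  refine ⟨?_, ?_, ?_⟩
  · rw [← Multiset.coe_nodup, p1]; exact Finset.nodup _
  · intro v
    rw [← Multiset.mem_coe, p1]; exact Finset.mem_univ v
  · rw [← Multiset.coe_nodup, p2]; exact Finset.nodup _

end Cycle

lemma nonext {ν β : ℝ} (hν : 0 < ν) (hβ : 0 < β) (hν1 : ν ≤ 1) : ∃ n0 : ℕ, ∀ (V Γ : Type) [Fintype V] [Fintype Γ]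
    (G : Γ → SimpleGraph V) (k : ℕ), n0 ≤ k → Hyp G k → NE G ν β → THC G := by
  set μ := min ν β with hμ
  have hμ0 : 0 < μ := lt_min hν hβ
  obtain ⟨m, hm⟩ := exists_nat_ge (100 / μ)
  have hm0 : 0 < m := by
    have : (0 : ℝ) < m := lt_of_lt_of_le (by positivity) hm
    exact_mod_cast this
  set K := 2 * m + 6 with hK
  have hr := tendsto_pow_const_mul_const_pow_of_abs_lt_one 3 (r := 1 - ν / 4) (by rw [abs_lt]; constructor <;> linarith)
  have hr' : ∀ᶠ T : ℕ in Filter.atTop, (T : ℝ) ^ 3 * (1 - ν / 4) ^ T < (1 / 2) ^ K / (2 * m) ^ 3 :=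
    hr.eventually_lt_const (by positivity)
  obtain ⟨T0, hT0⟩ := Filter.eventually_atTop.1 hr'
  obtain ⟨N, hN⟩ := exists_nat_ge (200 / μ)
  refine ⟨m * (T0 + 1) + N, ?_⟩
  intro V Γ _ _ G k hk hy hne
  have hn : (Fintype.card V : ℝ) = 2 * k + 1 := by exact_mod_cast hy.cV
  set T := (2 * k + 1) / m with hT
  have hTT : T0 + 1 ≤ T := by
    rw [hT, Nat.le_div_iff_mul_le hm0]
    nlinarith
  have hTm : T * m ≤ 2 * k + 1 := Nat.div_mul_le_self _ _
  have hTm' : 2 * k + 1 < (T + 1) * m := by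
    have := Nat.lt_div_mul_add (a := 2 * k + 1) hm0
    rw [← hT] at this; nlinarith
  have hle : 2 * k + 1 ≤ 2 * m * T := by nlinarith
  have r1 : (T : ℝ) * 100 ≤ μ * Fintype.card V := by
    have h1 : (T : ℝ) * m ≤ Fintype.card V := by rw [hn]; exact_mod_cast hTm
    rw [div_le_iff₀ hμ0] at hm
    have : (T : ℝ) * 100 ≤ T * (m * μ) := by gcongr
    nlinarith
  have r2 : (200 : ℝ) < μ * Fintype.card V := by
    have h1 : (N : ℝ) ≤ k := by exact_mod_cast (by nlinarith : N ≤ k)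
    rw [div_le_iff₀ hμ0] at hN
    rw [hn]; nlinarith
  have r3 : μ * Fintype.card V ≤ ν * Fintype.card V := by gcongr; exact min_le_left _ _
  have r4 : μ * Fintype.card V ≤ β * Fintype.card V := by gcongr; exact min_le_right _ _
  have hT0' : (0 : ℝ) ≤ T := by positivity
  have hTpos : 0 < T := by omega
  refine combine hy hne hν hν1 (T := T) (g := T) (K := K) ?_ ?_ ?_ hTpos ?_ ?_ ?_
  · push_cast; linarith
  · push_cast; linarith
  · have h1 := hT0 T (by omega)
    rw [lt_div_iff₀ (by positivity)] at h1
    refine lt_of_le_of_lt ?_ h1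
    have h2 : (Fintype.card V : ℝ) ≤ 2 * m * T := by rw [hn]; exact_mod_cast hle
    have h3 : (Fintype.card V : ℝ) ^ 3 ≤ (2 * m * T) ^ 3 := by gcongr
    have h4 : (0 : ℝ) ≤ (1 - ν / 4) ^ T := pow_nonneg (by linarith) _
    calc _ ≤ (2 * m * T : ℝ) ^ 3 * (1 - ν / 4) ^ T := by gcongr
      _ = _ := by ring
  · have : (2 * k + 1) / T ≤ 2 * m := by
      rw [Nat.div_le_iff_le_mul_add_pred hTpos]; nlinarith
    omega
  · push_cast; linarith
  · push_cast; linarith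

end TH

open SimpleGraph
set_option linter.unusedSectionVars false
set_option linter.unusedVariables false

theorem stmt_13 :
    ∃ n₀ : ℕ, ∀ n : ℕ, n₀ ≤ n → Odd n →
      ∀ (V : Type) [Fintype V] [DecidableEq V] (Gs : Fin n → SimpleGraph V),
        Fintype.card V = n →
        (∀ i v, n - 1 ≤ 2 * deg (Gs i) v) →
        ¬ HasTransHamCycle Gs →
        Xor'
          (∃ A : Set V, A.ncard = (n + 1) / 2 ∧
            (∀ i, ∀ x ∈ A, ∀ y ∈ A, ¬ (Gs i).Adj x y) ∧
            (∀ i, ∀ x ∈ A, ∀ y ∉ A, (Gs i).Adj x y))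
          (∃ (u : V) (A B : Set V), Disjoint A B ∧ A ∪ B = Set.univ \ {u} ∧
            A.ncard = (n - 1) / 2 ∧ B.ncard = (n - 1) / 2 ∧
            (∀ i, ∀ v, v ≠ u → (Gs i).Adj u v) ∧
            (∀ i x y, x ≠ u → y ≠ u →
              ((Gs i).Adj x y ↔ x ≠ y ∧ ((x ∈ A ∧ y ∈ A) ∨ (x ∈ B ∧ y ∈ B))))) := by
  obtain ⟨ε, hεd⟩ : ∃ ε : ℝ, ε = (1 / 10 ^ 16 : ℝ) ^ 2 / 8 := ⟨_, rfl⟩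
  have hε : 0 < ε := by rw [hεd]; positivity
  have hε1 : ε ≤ 1 / 2 := by rw [hεd]; norm_num
  obtain ⟨n1, hn1⟩ := TH.nonext (ν := ε ^ 3 / 32) (β := ε ^ 2 / 64) (by positivity) (by positivity)
    (by have : ε ^ 3 ≤ (1 / 2) ^ 3 := by gcongr
        linarith)
  obtain ⟨n2, hn2⟩ := exists_nat_ge ((1 / 2) / (ε ^ 2 / 64))
  obtain ⟨n3, hn3⟩ : ∃ n3 : ℕ, 10 ^ 20 = n3 := ⟨_, rfl⟩
  refine ⟨2 * (n1 + n2 + n3 + 3) + 1, ?_⟩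
  intro n hn hodd V _ hdec Gs hV hdeg hno
  obtain ⟨k, hk⟩ := hodd
  have hk1 : n1 ≤ k := by clear hn3 hεd; omega
  have hk2 : n2 ≤ k := by clear hn3 hεd; omega
  have hk3 : n3 ≤ k := by clear hn3 hεd; omega
  have hy : TH.Hyp Gs k := by
    refine ⟨by omega, by simp [hk], ?_⟩
    intro γ v
    have h1 := hdeg γ v
    have h2 : deg (Gs γ) v = (TH.nb Gs γ v).card := by
      unfold deg
      rw [← Set.ncard_coe_finset]
      congr 1
      ext w
      simp [TH.mem_nb]
    omega
  have hnT : ¬ TH.THC Gs := by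
    intro h
    exact hno (by convert TH.THC.toHam Gs hV (by omega) h)
  have main : TH.Ca Gs k ∨ TH.Cb Gs k := by
    by_cases hx : ∃ A I K, TH.ExtW Gs ε A I K
    · obtain ⟨A, I, K, h⟩ := hx
      rw [hεd] at h
      rcases TH.extremal hy (hn3 ▸ hk3) h with h | h
      · exact absurd h hnT
      · exact h
    · refine absurd (hn1 V (Fin n) Gs k hk1 hy (TH.dichotomy hy hε hε1 ?_ hx)) hnT
      have h1 : (n2 : ℝ) ≤ Fintype.card V := by rw [hV]; exact_mod_cast (by omega : n2 ≤ n)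
      have h2 := hn2.trans h1
      rw [div_le_iff₀ (by positivity)] at h2
      linarith
  have hk5 : 3 ≤ k := by clear hn3 hεd; omega
  clear hn3 hεd hk3
  have e1 : (n + 1) / 2 = k + 1 := by omega
  have e2 : (n - 1) / 2 = k := by omega
  have i0 : Fin n := ⟨0, by omega⟩
  rw [e1, e2]
  have excl : (∃ A : Set V, A.ncard = k + 1 ∧
            (∀ i, ∀ x ∈ A, ∀ y ∈ A, ¬ (Gs i).Adj x y) ∧
            (∀ i, ∀ x ∈ A, ∀ y ∉ A, (Gs i).Adj x y)) →
          (∃ (u : V) (A B : Set V), Disjoint A B ∧ A ∪ B = Set.univ \ {u} ∧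
            A.ncard = k ∧ B.ncard = k ∧
            (∀ i, ∀ v, v ≠ u → (Gs i).Adj u v) ∧
            (∀ i x y, x ≠ u → y ≠ u →
              ((Gs i).Adj x y ↔ x ≠ y ∧ ((x ∈ A ∧ y ∈ A) ∨ (x ∈ B ∧ y ∈ B))))) → False := by
    rintro ⟨S, hS, hS1, -⟩ ⟨u, A, B, -, hAB, -, -, hu, hab⟩
    have h3 : 2 < S.ncard := by omega
    obtain ⟨x, y, z, hx, hy', hz, hxy, hxz, hyz⟩ := (Set.two_lt_ncard_iff (Set.toFinite S)).1 h3
    have hmem : ∀ w, w ≠ u → w ∈ A ∨ w ∈ B := by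
      intro w hw
      have : w ∈ A ∪ B := by rw [hAB]; simp [hw]
      exact this
    have hSu : u ∉ S := by
      intro huS
      by_cases hxu : x = u
      · exact hS1 i0 u huS y hy' (hu i0 y (fun h => hxy (hxu.trans h.symm)))
      · exact hS1 i0 u huS x hx (hu i0 x hxu)
    have hxu : x ≠ u := fun h => hSu (h ▸ hx)
    have hyu : y ≠ u := fun h => hSu (h ▸ hy')
    have hzu : z ≠ u := fun h => hSu (h ▸ hz)
    have m1 := hmem x hxu
    have m2 := hmem y hyu
    have m3 := hmem z hzu
    have f1 : ∀ w w' : V, w ∈ S → w' ∈ S → w ≠ w' → ¬ ((w ∈ A ∧ w' ∈ A) ∨ (w ∈ B ∧ w' ∈ B)) := by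
      intro w w' hw hw' hne h
      exact hS1 i0 w hw w' hw' ((hab i0 w w' (fun h => hSu (h ▸ hw)) (fun h => hSu (h ▸ hw'))).2 ⟨hne, h⟩)
    have p1 := f1 x y hx hy' hxy
    have p2 := f1 x z hx hz hxz
    have p3 := f1 y z hy' hz hyz
    clear f1
    rcases m1 with m1 | m1 <;> rcases m2 with m2 | m2 <;> rcases m3 with m3 | m3 <;> simp_all
  rcases main with ⟨A, hA, hA1, hA2⟩ | ⟨u, A, B, hd, hm, hA, hB, hu, hab⟩
  · have ha : (∃ A : Set V, A.ncard = k + 1 ∧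
            (∀ i, ∀ x ∈ A, ∀ y ∈ A, ¬ (Gs i).Adj x y) ∧
            (∀ i, ∀ x ∈ A, ∀ y ∉ A, (Gs i).Adj x y)) :=
      ⟨↑A, by rw [Set.ncard_coe_finset, hA], by simpa using hA1, by simpa using hA2⟩
    exact Or.inl ⟨ha, excl ha⟩
  · refine Or.inr ⟨?_, ?_⟩
    · refine ⟨u, ↑A, ↑B, by exact_mod_cast hd, ?_, by rw [Set.ncard_coe_finset, hA],
        by rw [Set.ncard_coe_finset, hB], hu, by simpa using hab⟩
      ext v
      simpa using hm v
    · intro ha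
      refine excl ha ⟨u, ↑A, ↑B, by exact_mod_cast hd, ?_, by rw [Set.ncard_coe_finset, hA],
        by rw [Set.ncard_coe_finset, hB], hu, by simpa using hab⟩
      ext v
      simpa using hm v
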